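/- There exist constants k# and C, depending only on m and n, such that the following holds. Let E ⊂ ℝⁿ be an arbitrary (not necessarily finite) set, let f : E → [0,∞), and let M₀ > 0. Suppose that for each S ⊆ E with #(S) ≤ k# there exists a family (P^x)_{x∈S} of polynomials of degree at most m−1 such that P^x ∈ Γ'_f(x, M₀) for all x ∈ S, and |∂^β(P^x − P^y)(x)| ≤ M₀|x − y|^{m−|β|} for all x, y ∈ S and |β| ≤ m−1. Then there exists F ∈ C^{m-1,1}(ℝⁿ) such that ‖F‖_{C^{m-1,1}(ℝⁿ)} ≤ CM₀, F ≥ 0 everywhere on ℝⁿ, and F = f on E. -/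

import Mathlib

open scoped BigOperators

noncomputable section

abbrev Euc (n : ℕ) : Type := EuclideanSpace ℝ (Fin n)
abbrev MPoly (n : ℕ) : Type := MvPolynomial (Fin n) ℝ

/-- Partial derivative in the `i`-th coordinate direction. -/
noncomputable def pD {n : ℕ} (i : Fin n) (F : Euc n → ℝ) : Euc n → ℝ :=
  fun x => fderiv ℝ F x (EuclideanSpace.single i (1 : ℝ))

/-- The multi-index partial derivative `∂^α F`. -/
noncomputable def mD {n : ℕ} (α : Fin n → ℕ) (F : Euc n → ℝ) : Euc n → ℝ :=
  (((List.finRange n).flatMap fun i => List.replicate (α i) i)).foldr pD F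

/-- Partial derivative within a set. -/
noncomputable def pDW {n : ℕ} (s : Set (Euc n)) (i : Fin n) (F : Euc n → ℝ) : Euc n → ℝ :=
  fun x => fderivWithin ℝ F s x (EuclideanSpace.single i (1 : ℝ))

/-- Multi-index partial derivative within a set. -/
noncomputable def mDW {n : ℕ} (s : Set (Euc n)) (α : Fin n → ℕ) (F : Euc n → ℝ) : Euc n → ℝ :=
  (((List.finRange n).flatMap fun i => List.replicate (α i) i)).foldr (pDW s) F

/-- The order `|α|` of a multi-index. -/
def deg {n : ℕ} (α : Fin n → ℕ) : ℕ := ∑ i, α i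

/-- Evaluation of an `n`-variable polynomial at a point of `ℝⁿ`. -/
noncomputable def peval {n : ℕ} (P : MPoly n) (x : Euc n) : ℝ :=
  MvPolynomial.eval (fun i => x i) P

/-- `F ∈ C^m(ℝⁿ)` with `‖F‖_{C^m(ℝⁿ)} ≤ M`. -/
def CmNormLe (m n : ℕ) (F : Euc n → ℝ) (M : ℝ) : Prop :=
  ContDiff ℝ (m : ℕ∞) F ∧ ∀ α : Fin n → ℕ, deg α ≤ m → ∀ x : Euc n, |mD α F x| ≤ M

/-- `F ∈ C^{m-1,1}(ℝⁿ)` with `‖F‖_{C^{m-1,1}(ℝⁿ)} ≤ M`. -/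
def CmLipNormLe (m n : ℕ) (F : Euc n → ℝ) (M : ℝ) : Prop :=
  ContDiff ℝ ((m - 1 : ℕ) : ℕ∞) F ∧
  (∀ α : Fin n → ℕ, deg α ≤ m - 1 → ∀ x : Euc n, |mD α F x| ≤ M) ∧
  (∀ α : Fin n → ℕ, deg α = m - 1 → ∀ i : Fin n, ∀ x : Euc n, ∀ t : ℝ,
    |mD α F (x + t • EuclideanSpace.single i (1 : ℝ)) - mD α F x| ≤ M * |t|)

/-- `J_x(F) = P`, i.e. `P` is the `(m-1)`-st order Taylor polynomial of `F` at `x`. -/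
def IsJetAt (m n : ℕ) (F : Euc n → ℝ) (x : Euc n) (P : MPoly n) : Prop :=
  P.totalDegree ≤ m - 1 ∧
  ∀ α : Fin n → ℕ, deg α ≤ m - 1 → mD α (peval P) x = mD α F x

/-- `J_x^+(F) = P`, i.e. `P` is the `m`-th order Taylor polynomial of `F` at `x`. -/
def IsJetPlusAt (m n : ℕ) (F : Euc n → ℝ) (x : Euc n) (P : MPoly n) : Prop :=
  P.totalDegree ≤ m ∧
  ∀ α : Fin n → ℕ, deg α ≤ m → mD α (peval P) x = mD α F x

/-- Truncation of a polynomial: keep the monomials of total degree `≤ d`. -/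
noncomputable def truncLE {n : ℕ} (d : ℕ) (P : MPoly n) : MPoly n :=
  ∑ s ∈ P.support.filter (fun s => (s.sum fun _ e => e) ≤ d),
    MvPolynomial.monomial s (P.coeff s)

/-- Substitution `y ↦ y + v` in a polynomial. -/
noncomputable def polyShift {n : ℕ} (v : Fin n → ℝ) (P : MPoly n) : MPoly n :=
  MvPolynomial.aeval (fun i => (MvPolynomial.X i + MvPolynomial.C (v i) : MPoly n)) P

/-- The `(m-1)`-st order Taylor polynomial of a polynomial `P` at `x`. -/
noncomputable def jetTrunc (m n : ℕ) (x : Euc n) (P : MPoly n) : MPoly n :=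
  polyShift (fun i => -(x i)) (truncLE (m - 1) (polyShift (fun i => x i) P))

/-- Multiplication of `(m-1)`-jets at `x`: `P ⊙_x Q = J_x(PQ)`. -/
noncomputable def jmul (m n : ℕ) (x : Euc n) (P Q : MPoly n) : MPoly n :=
  jetTrunc m n x (P * Q)

/-- `Γ*(x,M)`. -/
def GammaStar (m n : ℕ) (x : Euc n) (M : ℝ) : Set (MPoly n) :=
  {P | ∃ F : Euc n → ℝ, CmNormLe m n F M ∧ (∀ y, 0 ≤ F y) ∧ IsJetAt m n F x P}

/-- `Γ_f(x,M)`. -/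
def GammaF (m n : ℕ) (f : Euc n → ℝ) (x : Euc n) (M : ℝ) : Set (MPoly n) :=
  {P ∈ GammaStar m n x M | peval P x = f x}

/-- `Γ'*(x,M)` (the `C^{m-1,1}` version). -/
def GammaStar' (m n : ℕ) (x : Euc n) (M : ℝ) : Set (MPoly n) :=
  {P | ∃ F : Euc n → ℝ, CmLipNormLe m n F M ∧ (∀ y, 0 ≤ F y) ∧ IsJetAt m n F x P}

/-- `Γ'_f(x,M)`. -/
def GammaF' (m n : ℕ) (f : Euc n → ℝ) (x : Euc n) (M : ℝ) : Set (MPoly n) :=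
  {P ∈ GammaStar' m n x M | peval P x = f x}

/-- `Γ₀⁺`. -/
def Gamma0plus (m n : ℕ) : Set (MPoly n) :=
  {P | P.totalDegree ≤ m ∧
    (∀ β : Fin n → ℕ, deg β ≤ m → |mD β (peval P) 0| ≤ 1) ∧
    (∀ x : Euc n, 0 ≤ peval P x + ‖x‖ ^ m) ∧
    (∀ ε : ℝ, 0 < ε → ∃ δ : ℝ, 0 < δ ∧ ∀ x : Euc n, ‖x‖ ≤ δ → 0 ≤ peval P x + ε * ‖x‖ ^ m)}

/-- `Γ̃₀'`. -/
def GammaTilde0' (m n : ℕ) : Set (MPoly n) :=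
  {P | P.totalDegree ≤ m - 1 ∧
    (∀ β : Fin n → ℕ, deg β ≤ m - 1 → |mD β (peval P) 0| ≤ 1) ∧
    ∀ x : Euc n, 0 ≤ peval P x + ‖x‖ ^ m}

/-- The closed axis-parallel cube with center `c` and sidelength `δ`. -/
def cube {n : ℕ} (c : Euc n) (δ : ℝ) : Set (Euc n) :=
  {y | ∀ i, |y i - c i| ≤ δ / 2}

/-- `F ∈ C^{m-1,1}(Q)` with `‖F‖_{C^{m-1,1}(Q)} ≤ M`, for the cube `Q` of center `c`,
sidelength `δ`. -/
def CmLipOnCubeLe (m n : ℕ) (c : Euc n) (δ : ℝ) (F : Euc n → ℝ) (M : ℝ) : Prop :=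
  ContDiffOn ℝ ((m - 1 : ℕ) : ℕ∞) F (cube c δ) ∧
  (∀ α : Fin n → ℕ, deg α ≤ m - 1 → ∀ x ∈ cube c δ, |mDW (cube c δ) α F x| ≤ M) ∧
  (∀ α : Fin n → ℕ, deg α = m - 1 → ∀ i : Fin n, ∀ x ∈ cube c δ, ∀ t : ℝ,
    x + t • EuclideanSpace.single i (1 : ℝ) ∈ cube c δ →
    |mDW (cube c δ) α F (x + t • EuclideanSpace.single i (1 : ℝ)) - mDW (cube c δ) α F x|
      ≤ M * |t|)

section
open scoped BigOperators ContDiff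

noncomputable section

/-- smooth functions -/
abbrev Sm {n : ℕ} (F : Euc n → ℝ) : Prop := ContDiff ℝ ∞ F

/-- norm of the `j`-th derivative -/
def dn {n : ℕ} (j : ℕ) (F : Euc n → ℝ) (x : Euc n) : ℝ := ‖iteratedFDeriv ℝ j F x‖

lemma Sm.at {n : ℕ} {F : Euc n → ℝ} (h : Sm F) (k : ℕ) (x : Euc n) : ContDiffAt ℝ k F x :=
  (h.of_le (by exact_mod_cast le_top)).contDiffAt

lemma Sm.nat {n : ℕ} {F : Euc n → ℝ} (h : Sm F) (k : ℕ) : ContDiff ℝ k F :=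
  (h.of_le (by exact_mod_cast le_top))

lemma dn_nonneg {n : ℕ} (j : ℕ) (F : Euc n → ℝ) (x : Euc n) : 0 ≤ dn j F x := norm_nonneg _

lemma dn_zero {n : ℕ} (F : Euc n → ℝ) (x : Euc n) : dn 0 F x = |F x| := by
  simp [dn]

lemma dn_add_le {n : ℕ} {F G : Euc n → ℝ} (hF : Sm F) (hG : Sm G) (j : ℕ) (x : Euc n) :
    dn j (F + G) x ≤ dn j F x + dn j G x := by
  unfold dn
  rw [iteratedFDeriv_add_apply (hF.at j x) (hG.at j x)]
  exact norm_add_le _ _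

lemma dn_sub_le {n : ℕ} {F G : Euc n → ℝ} (hF : Sm F) (hG : Sm G) (j : ℕ) (x : Euc n) :
    dn j (F - G) x ≤ dn j F x + dn j G x := by
  unfold dn
  rw [iteratedFDeriv_sub_apply (hF.at j x) (hG.at j x)]
  exact norm_sub_le _ _

lemma dn_smul {n : ℕ} {F : Euc n → ℝ} (hF : Sm F) (c : ℝ) (j : ℕ) (x : Euc n) :
    dn j (c • F) x = |c| * dn j F x := by
  unfold dn
  rw [iteratedFDeriv_const_smul_apply (hF.at j x), norm_smul, Real.norm_eq_abs]

lemma dn_neg {n : ℕ} (F : Euc n → ℝ) (j : ℕ) (x : Euc n) :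
    dn j (-F) x = dn j F x := by
  unfold dn
  rw [iteratedFDeriv_neg_apply, norm_neg]

lemma dn_sub_comm {n : ℕ} (F G : Euc n → ℝ) (j : ℕ) (x : Euc n) :
    dn j (F - G) x = dn j (G - F) x := by
  rw [← neg_sub, dn_neg]

lemma dn_mul_le {n : ℕ} {F G : Euc n → ℝ} (hF : Sm F) (hG : Sm G) (j : ℕ) (x : Euc n) :
    dn j (F * G) x ≤ ∑ i ∈ Finset.range (j + 1), (j.choose i : ℝ) * dn i F x * dn (j - i) G x := by
  unfold dn
  exact norm_iteratedFDeriv_mul_le hF hG x (by exact_mod_cast le_top)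

lemma dn_congr {n : ℕ} {F G : Euc n → ℝ} {x : Euc n} (h : F =ᶠ[nhds x] G) (j : ℕ) :
    dn j F x = dn j G x := by
  unfold dn
  rw [h.iteratedFDeriv ℝ j |>.eq_of_nhds]

/-- product estimate at a point, with scales -/
lemma dn_mul_scale {n m : ℕ} {F G : Euc n → ℝ} (hF : Sm F) (hG : Sm G) {j : ℕ} {x : Euc n}
    {B N r s : ℝ} (hr : 0 < r) (hs : 0 ≤ s) (hsr : s ≤ r) (hj : j ≤ m) (hN : 0 ≤ N)
    (h1 : ∀ i ≤ j, dn i F x ≤ B / r ^ i) (h2 : ∀ i ≤ j, dn i G x ≤ N * s ^ (m - i)) :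
    dn j (F * G) x ≤ 2 ^ m * B * N * s ^ (m - j) := by
  have hB : 0 ≤ B := by
    have := (dn_nonneg 0 F x).trans (h1 0 (Nat.zero_le _)); simpa using this
  calc dn j (F * G) x ≤ ∑ i ∈ Finset.range (j + 1), (j.choose i : ℝ) * dn i F x * dn (j - i) G x :=
        dn_mul_le hF hG j x
    _ ≤ ∑ i ∈ Finset.range (j + 1), (j.choose i : ℝ) * (B * N * s ^ (m - j)) := by
        apply Finset.sum_le_sum
        intro i hi
        have hi' : i ≤ j := by simpa [Nat.lt_succ_iff] using hi
        have e1 := h1 i hi'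
        have e2 := h2 (j - i) (Nat.sub_le _ _)
        have e3 : dn i F x * dn (j - i) G x ≤ (B / r ^ i) * (N * s ^ (m - (j - i))) :=
          mul_le_mul e1 e2 (dn_nonneg _ _ _) (by positivity)
        have e4 : m - (j - i) = (m - j) + i := by omega
        have e5 : s ^ i / r ^ i ≤ 1 := by
          rw [div_le_one (by positivity)]; exact pow_le_pow_left₀ hs hsr i
        have e6 : (B / r ^ i) * (N * s ^ (m - (j - i))) ≤ B * N * s ^ (m - j) := by
          rw [e4, pow_add]
          calc (B / r ^ i) * (N * (s ^ (m - j) * s ^ i))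
              = (B * N * s ^ (m - j)) * (s ^ i / r ^ i) := by ring
            _ ≤ (B * N * s ^ (m - j)) * 1 := by
                apply mul_le_mul_of_nonneg_left e5; positivity
            _ = _ := by ring
        rw [mul_assoc]
        exact mul_le_mul_of_nonneg_left (e3.trans e6) (by positivity)
    _ = 2 ^ j * (B * N * s ^ (m - j)) := by
        rw [← Finset.sum_mul]
        congr 1
        exact_mod_cast Nat.sum_range_choose j
    _ ≤ 2 ^ m * (B * N * s ^ (m - j)) := by
        apply mul_le_mul_of_nonneg_right _ (by positivity)
        exact pow_le_pow_right₀ (by norm_num) hj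
    _ = _ := by ring

lemma dn_mvt {n : ℕ} {F : Euc n → ℝ} {k j : ℕ} (hF : ContDiff ℝ k F) (hj : j < k)
    {s : Set (Euc n)} (hs : Convex ℝ s) {x y : Euc n} (hx : x ∈ s) (hy : y ∈ s) {L : ℝ}
    (hL : ∀ z ∈ s, dn (j + 1) F z ≤ L) :
    ‖iteratedFDeriv ℝ j F y - iteratedFDeriv ℝ j F x‖ ≤ L * ‖y - x‖ := by
  have hd : Differentiable ℝ (iteratedFDeriv ℝ j F) :=
    hF.differentiable_iteratedFDeriv (by exact_mod_cast hj)
  refine hs.norm_image_sub_le_of_norm_fderiv_le (𝕜 := ℝ) (fun z _ => hd z) (fun z hz => ?_) hx hy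
  rw [norm_fderiv_iteratedFDeriv]
  exact hL z hz

lemma dn_growth {n m : ℕ} {G : Euc n → ℝ} (hG : ContDiff ℝ m G) {s : Set (Euc n)}
    (hs : Convex ℝ s) {x : Euc n} (hx : x ∈ s) {N K r : ℝ} (hN : 0 ≤ N) (hK : 0 ≤ K) (hr : 0 ≤ r)
    (h0 : ∀ j < m, dn j G x ≤ N * r ^ (m - j)) (h1 : ∀ y ∈ s, dn m G y ≤ N)
    (h2 : ∀ y ∈ s, ‖y - x‖ ≤ K * r) :
    ∀ j ≤ m, ∀ y ∈ s, dn j G y ≤ N * (1 + K) ^ (m - j) * r ^ (m - j) := by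
  intro j hj
  obtain ⟨i, rfl⟩ : ∃ i, j = m - i := ⟨m - j, by omega⟩
  induction i with
  | zero => intro y hy; simpa using h1 y hy
  | succ i ih =>
    intro y hy
    by_cases him : m ≤ i
    · have : m - (i + 1) = m - i := by omega
      rw [this]; exact ih (by omega) y hy
    push Not at him
    set j := m - (i + 1) with hjdef
    have hj1 : m - i = j + 1 := by omega
    have hj2 : m - j = i + 1 := by omega
    have hj3 : m - (j + 1) = i := by omega
    rw [hj1, hj3] at ih
    have hb := dn_mvt hG (j := j) (by omega) hs hx hy (ih (by omega))
    have h0' := h0 j (by omega)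
    rw [hj2] at h0' ⊢
    have hpos : (0:ℝ) ≤ N * (1 + K) ^ i * r ^ i := by positivity
    have : dn j G y ≤ dn j G x + ‖iteratedFDeriv ℝ j G y - iteratedFDeriv ℝ j G x‖ := by
      unfold dn
      have := norm_add_le (iteratedFDeriv ℝ j G x) (iteratedFDeriv ℝ j G y - iteratedFDeriv ℝ j G x)
      simpa using this
    have h3 := h2 y hy
    have hone : (1:ℝ) ≤ (1 + K) ^ i := one_le_pow₀ (by linarith)
    calc dn j G y ≤ N * r ^ (i + 1) + N * (1 + K) ^ i * r ^ i * (K * r) := by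
          refine this.trans (add_le_add h0' (hb.trans (mul_le_mul_of_nonneg_left h3 hpos)))
      _ = N * r ^ (i + 1) * (1 + K * (1 + K) ^ i) := by ring
      _ ≤ N * r ^ (i + 1) * ((1 + K) ^ (i + 1)) := by
          apply mul_le_mul_of_nonneg_left _ (by positivity)
          rw [pow_succ]; nlinarith
      _ = _ := by ring

/-- jets bounded at scale `r` -/
def At {n : ℕ} (m : ℕ) (G : Euc n → ℝ) (x : Euc n) (r N : ℝ) : Prop :=
  ∀ j < m, dn j G x ≤ N * r ^ (m - j)

lemma At.mono_r {n m : ℕ} {G : Euc n → ℝ} {x : Euc n} {r r' N : ℝ} (h : At m G x r N)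
    (hN : 0 ≤ N) (hr : 0 ≤ r) (hrr : r ≤ r') : At m G x r' N := fun j hj =>
  (h j hj).trans (mul_le_mul_of_nonneg_left (pow_le_pow_left₀ hr hrr _) hN)

lemma At.mono_N {n m : ℕ} {G : Euc n → ℝ} {x : Euc n} {r N N' : ℝ} (h : At m G x r N)
    (hr : 0 ≤ r) (hN : N ≤ N') : At m G x r N' := fun j hj =>
  (h j hj).trans (mul_le_mul_of_nonneg_right hN (by positivity))

lemma At.add {n m : ℕ} {F G : Euc n → ℝ} {x : Euc n} {r N N' : ℝ} (hF : Sm F) (hG : Sm G)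
    (h : At m F x r N) (h' : At m G x r N') : At m (F + G) x r (N + N') := fun j hj =>
  (dn_add_le hF hG j x).trans (by rw [add_mul]; exact add_le_add (h j hj) (h' j hj))

lemma At.sub {n m : ℕ} {F G : Euc n → ℝ} {x : Euc n} {r N N' : ℝ} (hF : Sm F) (hG : Sm G)
    (h : At m F x r N) (h' : At m G x r N') : At m (F - G) x r (N + N') := fun j hj =>
  (dn_sub_le hF hG j x).trans (by rw [add_mul]; exact add_le_add (h j hj) (h' j hj))

lemma At.smul {n m : ℕ} {F : Euc n → ℝ} {x : Euc n} {r N : ℝ} (hF : Sm F)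
    (h : At m F x r N) (c : ℝ) : At m (c • F) x r (|c| * N) := fun j hj => by
  rw [dn_smul hF, mul_assoc]; exact mul_le_mul_of_nonneg_left (h j hj) (abs_nonneg _)

lemma At.symm {n m : ℕ} {F G : Euc n → ℝ} {x : Euc n} {r N : ℝ}
    (h : At m (F - G) x r N) : At m (G - F) x r N := fun j hj => by
  rw [dn_sub_comm]; exact h j hj

/-- going to a smaller scale, losing a factor -/
lemma At.shrink {n m : ℕ} {G : Euc n → ℝ} {x : Euc n} {r r' N K : ℝ} (h : At m G x r N)
    (hN : 0 ≤ N) (hr : 0 ≤ r) (hr' : 0 ≤ r') (hK : 1 ≤ K) (hrr : r ≤ K * r') :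
    At m G x r' (K ^ m * N) := fun j hj => by
  refine (h j hj).trans ?_
  have h1 : r ^ (m - j) ≤ (K * r') ^ (m - j) := pow_le_pow_left₀ hr hrr _
  have h2 : K ^ (m - j) ≤ K ^ m := pow_le_pow_right₀ hK (Nat.sub_le _ _)
  calc N * r ^ (m - j) ≤ N * (K * r') ^ (m - j) := mul_le_mul_of_nonneg_left h1 hN
    _ = K ^ (m - j) * (N * r' ^ (m - j)) := by rw [mul_pow]; ring
    _ ≤ K ^ m * (N * r' ^ (m - j)) := mul_le_mul_of_nonneg_right h2 (by positivity)
    _ = _ := by ring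

/-- polynomials of degree `< m` -/
def Pol (m n : ℕ) : Submodule ℝ (Euc n → ℝ) where
  carrier := {P | Sm P ∧ ∀ x, iteratedFDeriv ℝ m P x = 0}
  add_mem' := by
    rintro P Q ⟨h1, h2⟩ ⟨h3, h4⟩
    refine ⟨h1.add h3, fun x => ?_⟩
    rw [iteratedFDeriv_add_apply (h1.at m x) (h3.at m x), h2, h4, add_zero]
  zero_mem' := by
    refine ⟨contDiff_const, fun x => ?_⟩
    have : (0 : Euc n → ℝ) = fun _ => 0 := rfl
    rw [this, iteratedFDeriv_fun_zero]; rfl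
  smul_mem' := by
    rintro c P ⟨h1, h2⟩
    refine ⟨h1.const_smul c, fun x => ?_⟩
    rw [iteratedFDeriv_const_smul_apply (h1.at m x), h2, smul_zero]

lemma Pol.sm {m n : ℕ} {P : Euc n → ℝ} (h : P ∈ Pol m n) : Sm P := h.1

lemma Pol.dn {m n : ℕ} {P : Euc n → ℝ} (h : P ∈ Pol m n) (x : Euc n) : dn m P x = 0 := by
  unfold _root_.dn; rw [h.2, norm_zero]

/-- a polynomial controlled at `x` is controlled nearby -/
lemma Pol.near {m n : ℕ} {P : Euc n → ℝ} (hP : P ∈ Pol m n) {x y : Euc n} {r N K : ℝ}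
    (h : At m P x r N) (hN : 0 ≤ N) (hK : 0 ≤ K) (hr : 0 ≤ r) (hy : ‖y - x‖ ≤ K * r) {j : ℕ}
    (hj : j ≤ m) :
    _root_.dn j P y ≤ (1 + K) ^ m * N * r ^ (m - j) := by
  have := dn_growth (hP.1.nat m) (convex_closedBall x (K * r)) (x := x)
    (Metric.mem_closedBall_self (by positivity)) hN hK hr h
    (fun y _ => by rw [Pol.dn hP]; exact hN)
    (fun y hy => by simpa [dist_eq_norm] using hy) j hj y (by simpa [dist_eq_norm] using hy)
  refine this.trans ?_
  apply mul_le_mul_of_nonneg_right _ (by positivity)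
  rw [mul_comm]
  exact mul_le_mul_of_nonneg_right (pow_le_pow_right₀ (by linarith) (Nat.sub_le _ _)) hN

lemma Pol.recenter {m n : ℕ} {P : Euc n → ℝ} (hP : P ∈ Pol m n) {x y : Euc n} {r N K : ℝ}
    (h : At m P x r N) (hN : 0 ≤ N) (hK : 0 ≤ K) (hr : 0 ≤ r) (hy : ‖y - x‖ ≤ K * r) :
    At m P y r ((1 + K) ^ m * N) := fun _ hj => Pol.near hP h hN hK hr hy hj.le

/-- functions with vanishing jet -/
lemma dn_vanish {n m : ℕ} {G : Euc n → ℝ} (hG : Sm G) {x y : Euc n} {B : ℝ} (hB : 0 ≤ B)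
    (h0 : ∀ j < m, dn j G x = 0) (h1 : ∀ z, ‖z - x‖ ≤ ‖y - x‖ → dn m G z ≤ B) {j : ℕ} (hj : j ≤ m) :
    dn j G y ≤ 2 ^ m * B * ‖y - x‖ ^ (m - j) := by
  have := dn_growth (hG.nat m) (convex_closedBall x (‖y - x‖)) (x := x)
    (Metric.mem_closedBall_self (by positivity)) hB (K := 1) zero_le_one (norm_nonneg (y - x))
    (fun j hj => by rw [h0 j hj]; positivity)
    (fun z hz => h1 z (by simpa [dist_eq_norm] using hz))
    (fun y hy => by simpa [dist_eq_norm] using hy) j hj y (by simp [dist_eq_norm])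
  refine this.trans ?_
  apply mul_le_mul_of_nonneg_right _ (by positivity)
  rw [mul_comm]
  apply mul_le_mul_of_nonneg_right _ hB
  norm_num
  exact pow_le_pow_right₀ (by norm_num) (Nat.sub_le _ _)

end
end

section
open scoped BigOperators ContDiff

noncomputable section

/-- coordinate vectors -/
abbrev ee {n : ℕ} (i : Fin n) : Euc n := EuclideanSpace.single i (1 : ℝ)

/-- iterated partial derivative along a list -/
def dL {n : ℕ} (l : List (Fin n)) (F : Euc n → ℝ) : Euc n → ℝ := l.foldr pD F

/-- the list attached to a multi-index -/
def lst {n : ℕ} (α : Fin n → ℕ) : List (Fin n) :=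
  (List.finRange n).flatMap fun i => List.replicate (α i) i

lemma mD_eq {n : ℕ} (α : Fin n → ℕ) (F : Euc n → ℝ) : mD α F = dL (lst α) F := rfl

lemma dL_cons {n : ℕ} (i : Fin n) (l : List (Fin n)) (F : Euc n → ℝ) :
    dL (i :: l) F = pD i (dL l F) := rfl

lemma dL_nil {n : ℕ} (F : Euc n → ℝ) : dL [] F = F := rfl

lemma dL_append {n : ℕ} (l l' : List (Fin n)) (F : Euc n → ℝ) :
    dL (l ++ l') F = dL l (dL l' F) := by
  unfold dL; rw [List.foldr_append]

lemma lst_length {n : ℕ} (α : Fin n → ℕ) : (lst α).length = deg α := by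
  unfold lst deg
  rw [List.length_flatMap]
  simp [List.sum_ofFn, ← List.ofFn_eq_map]

lemma lst_count {n : ℕ} (α : Fin n → ℕ) (i : Fin n) : (lst α).count i = α i := by
  unfold lst
  rw [List.count_flatMap]
  have : (List.map (List.count i ∘ fun i => List.replicate (α i) i) (List.finRange n)).sum
      = ∑ j, (List.replicate (α j) j).count i := by
    rw [← List.ofFn_eq_map, List.sum_ofFn]; rfl
  rw [this]
  simp [List.count_replicate]

lemma contDiff_pD {n : ℕ} {k : ℕ} {F : Euc n → ℝ} (h : ContDiff ℝ (k + 1 : ℕ) F) (i : Fin n) :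
    ContDiff ℝ k (pD i F) := by
  unfold pD
  exact (h.fderiv_right (m := k) (by norm_cast)).clm_apply contDiff_const

lemma contDiff_dL {n : ℕ} {k : ℕ} {F : Euc n → ℝ} (l : List (Fin n))
    (h : ContDiff ℝ (k + l.length : ℕ) F) : ContDiff ℝ k (dL l F) := by
  induction l generalizing k with
  | nil => simpa [dL_nil] using h
  | cons i l ih =>
    rw [dL_cons]
    apply contDiff_pD
    apply ih
    simpa [add_assoc, add_comm 1] using h

lemma sm_iff {n : ℕ} {F : Euc n → ℝ} : Sm F ↔ ∀ k : ℕ, ContDiff ℝ k F := contDiff_infty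

lemma Sm.pD {n : ℕ} {F : Euc n → ℝ} (h : Sm F) (i : Fin n) : Sm (pD i F) :=
  sm_iff.2 fun _ => contDiff_pD (h.nat _) i

lemma Sm.dL {n : ℕ} {F : Euc n → ℝ} (h : Sm F) (l : List (Fin n)) : Sm (dL l F) :=
  sm_iff.2 fun _ => contDiff_dL l (h.nat _)

lemma Sm.mD {n : ℕ} {F : Euc n → ℝ} (h : Sm F) (α : Fin n → ℕ) : Sm (mD α F) := h.dL _

lemma dL_eq {n : ℕ} {F : Euc n → ℝ} (l : List (Fin n)) (h : ContDiff ℝ l.length F) (x : Euc n) :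
    dL l F x = iteratedFDeriv ℝ l.length F x (fun k => ee (l.get k)) := by
  induction l generalizing x with
  | nil => simp [dL]
  | cons i l ih =>
    have h' : ContDiff ℝ l.length F := h.of_le (by simp)
    have e : dL l F = fun y => iteratedFDeriv ℝ l.length F y (fun k => ee (l.get k)) := by
      funext y; exact ih h' y
    rw [dL_cons, e]
    show fderiv ℝ _ x (ee i) = iteratedFDeriv ℝ (l.length + 1) F x _
    rw [iteratedFDeriv_succ_apply_left, fderiv_continuousMultilinear_apply_const_apply]
    · rfl
    · apply (h.differentiable_iteratedFDeriv (m := l.length) _).differentiableAt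
      simp only [List.length_cons]; norm_cast; omega

lemma pD_comm {n : ℕ} {F : Euc n → ℝ} (h : ContDiff ℝ 2 F) (i j : Fin n) :
    pD i (pD j F) = pD j (pD i F) := by
  funext x
  have hs := (h.contDiffAt (x := x)).isSymmSndFDerivAt (by simp)
  have hd : DifferentiableAt ℝ (fderiv ℝ F) x :=
    ((h.fderiv_right (m := 1) (by norm_num)).differentiable (by norm_num)) x
  unfold pD
  rw [fderiv_clm_apply hd (by fun_prop), fderiv_clm_apply hd (by fun_prop)]
  simpa using hs (ee i) (ee j)

lemma dL_perm {n : ℕ} {F : Euc n → ℝ} {l l' : List (Fin n)} (hp : l.Perm l')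
    (h : ContDiff ℝ l.length F) : dL l F = dL l' F := by
  induction hp with
  | nil => rfl
  | cons a _ ih => rw [dL_cons, dL_cons, ih (h.of_le (by simp))]
  | swap a b l =>
    simp only [dL_cons]
    apply pD_comm
    apply contDiff_dL (k := 2)
    convert h using 2
    simp [add_comm, add_left_comm]
  | trans h1 h2 ih1 ih2 => rw [ih1 h, ih2 (by rwa [← h1.length_eq])]

lemma ee_norm {n : ℕ} (i : Fin n) : ‖(ee i : Euc n)‖ = 1 := by simp

lemma abs_dL_le {n : ℕ} {F : Euc n → ℝ} (l : List (Fin n)) (h : ContDiff ℝ l.length F) (x : Euc n) :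
    |dL l F x| ≤ dn l.length F x := by
  rw [dL_eq l h, ← Real.norm_eq_abs]
  refine (ContinuousMultilinearMap.le_opNorm _ _).trans ?_
  simp [dn]

lemma abs_mD_le {n : ℕ} {F : Euc n → ℝ} (α : Fin n → ℕ) (h : ContDiff ℝ (deg α) F) (x : Euc n) :
    |mD α F x| ≤ dn (deg α) F x := by
  have := abs_dL_le (lst α) (F := F) (by rwa [lst_length]) x
  rwa [lst_length] at this

lemma multilin_bound {n j : ℕ} (f : ContinuousMultilinearMap ℝ (fun _ : Fin j => Euc n) ℝ) {B : ℝ}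
    (hB : 0 ≤ B) (h : ∀ σ : Fin j → Fin n, |f (fun k => ee (σ k))| ≤ B) : ‖f‖ ≤ n ^ j * B := by
  apply ContinuousMultilinearMap.opNorm_le_bound (by positivity)
  intro v
  have hv : v = fun k => ∑ i : Fin n, (v k i) • (ee i : Euc n) := by
    funext k
    ext t
    simp [Finset.sum_apply, Pi.single_apply]
  have e : f v = ∑ σ : Fin j → Fin n, (∏ k, v k (σ k)) * f (fun k => ee (σ k)) := by
    conv_lhs => rw [hv]
    rw [ContinuousMultilinearMap.map_sum]
    apply Finset.sum_congr rfl
    intro σ _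
    rw [ContinuousMultilinearMap.map_smul_univ]; simp
  rw [e]
  calc ‖∑ σ : Fin j → Fin n, (∏ k, v k (σ k)) * f (fun k => ee (σ k))‖
      ≤ ∑ σ : Fin j → Fin n, ‖(∏ k, v k (σ k)) * f (fun k => ee (σ k))‖ := norm_sum_le _ _
    _ ≤ ∑ σ : Fin j → Fin n, (∏ k, ‖v k‖) * B := by
        apply Finset.sum_le_sum
        intro σ _
        rw [norm_mul, norm_prod]
        apply mul_le_mul _ (h σ) (abs_nonneg _) (by positivity)
        exact Finset.prod_le_prod (fun _ _ => norm_nonneg _) (fun k _ => PiLp.norm_apply_le _ _)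
    _ = _ := by simp; ring

lemma dn_le_of_mD {n j : ℕ} {F : Euc n → ℝ} (hF : ContDiff ℝ j F) {x : Euc n} {B : ℝ} (hB : 0 ≤ B)
    (h : ∀ α : Fin n → ℕ, deg α = j → |mD α F x| ≤ B) : dn j F x ≤ n ^ j * B := by
  apply multilin_bound _ hB
  intro σ
  set l := List.ofFn σ with hl
  have hlen : l.length = j := by simp [hl]
  set α : Fin n → ℕ := fun i => l.count i with hα
  have hp : l.Perm (lst α) := by
    rw [List.perm_iff_count]; intro a; rw [lst_count]
  have hd : deg α = j := by rw [← lst_length, ← hp.length_eq, hlen]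
  have := h α hd
  rw [mD_eq, ← dL_perm hp (by rwa [hlen]), dL_eq l (by rwa [hlen])] at this
  convert this using 2
  clear_value l
  subst hlen
  congr 1
  funext k
  congr 1
  have : σ = fun k => l.get k := by
    have h2 : List.ofFn σ = List.ofFn l.get := by rw [← hl, List.ofFn_get]
    exact List.ofFn_injective h2
  rw [this]

lemma dn_pD_le {n : ℕ} {F : Euc n → ℝ} (hF : Sm F) (i : Fin n) (k : ℕ) (x : Euc n) :
    dn k (pD i F) x ≤ dn (k + 1) F x := by
  have h1 : ContDiffAt ℝ k (fderiv ℝ F) x :=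
    ((hF.nat (k+1)).fderiv_right (m := k) (by norm_cast)).contDiffAt
  have := norm_iteratedFDeriv_clm_apply_const (c := (ee i : Euc n)) h1 (n := k) le_rfl
  unfold dn
  rw [norm_iteratedFDeriv_fderiv] at this
  simp only [ee_norm, one_mul] at this
  exact this

end
end

section
open scoped BigOperators ContDiff

noncomputable section

lemma Sm.diff {n : ℕ} {F : Euc n → ℝ} (h : Sm F) : Differentiable ℝ F :=
  h.differentiable (by simp)

lemma Sm.add' {n : ℕ} {F G : Euc n → ℝ} (hF : Sm F) (hG : Sm G) : Sm (F + G) := ContDiff.add hF hG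
lemma Sm.sub' {n : ℕ} {F G : Euc n → ℝ} (hF : Sm F) (hG : Sm G) : Sm (F - G) := ContDiff.sub hF hG
lemma Sm.mul' {n : ℕ} {F G : Euc n → ℝ} (hF : Sm F) (hG : Sm G) : Sm (F * G) := ContDiff.mul hF hG
lemma Sm.smul' {n : ℕ} {F : Euc n → ℝ} (hF : Sm F) (c : ℝ) : Sm (c • F) := ContDiff.const_smul c hF

lemma pD_add {n : ℕ} {F G : Euc n → ℝ} (hF : Sm F) (hG : Sm G) (i : Fin n) :
    pD i (F + G) = pD i F + pD i G := by
  funext x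
  simp only [pD, Pi.add_apply]
  rw [fderiv_add (hF.diff x) (hG.diff x)]; rfl

lemma pD_smul {n : ℕ} {F : Euc n → ℝ} (hF : Sm F) (c : ℝ) (i : Fin n) :
    pD i (c • F) = c • pD i F := by
  funext x
  simp only [pD, Pi.smul_apply]
  rw [fderiv_const_smul (hF.diff x)]; rfl

lemma dL_add {n : ℕ} {F G : Euc n → ℝ} (hF : Sm F) (hG : Sm G) (l : List (Fin n)) :
    dL l (F + G) = dL l F + dL l G := by
  induction l with
  | nil => rfl
  | cons i l ih => rw [dL_cons, ih, pD_add (hF.dL l) (hG.dL l)]; rfl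

lemma dL_smul {n : ℕ} {F : Euc n → ℝ} (hF : Sm F) (c : ℝ) (l : List (Fin n)) :
    dL l (c • F) = c • dL l F := by
  induction l with
  | nil => rfl
  | cons i l ih => rw [dL_cons, ih, pD_smul (hF.dL l)]; rfl

lemma mD_add {n : ℕ} {F G : Euc n → ℝ} (hF : Sm F) (hG : Sm G) (α : Fin n → ℕ) :
    mD α (F + G) = mD α F + mD α G := dL_add hF hG _

lemma mD_smul {n : ℕ} {F : Euc n → ℝ} (hF : Sm F) (c : ℝ) (α : Fin n → ℕ) :
    mD α (c • F) = c • mD α F := dL_smul hF c _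

lemma Sm.neg' {n : ℕ} {F : Euc n → ℝ} (hF : Sm F) : Sm (-F) := ContDiff.neg hF

lemma mD_sub {n : ℕ} {F G : Euc n → ℝ} (hF : Sm F) (hG : Sm G) (α : Fin n → ℕ) :
    mD α (F - G) = mD α F - mD α G := by
  have : F - G = F + (-1 : ℝ) • G := by simp [sub_eq_add_neg]
  rw [this, mD_add hF (hG.smul' _), mD_smul hG]; simp [sub_eq_add_neg]

lemma Sm.zero {n : ℕ} : Sm (0 : Euc n → ℝ) := contDiff_const

lemma mD_zero_fun {n : ℕ} (α : Fin n → ℕ) : mD α (0 : Euc n → ℝ) = 0 := by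
  have := mD_smul (Sm.zero (n := n)) 0 α
  simpa using this

lemma Sm.sum {n : ℕ} {ι : Type*} (s : Finset ι) {F : ι → Euc n → ℝ} (hF : ∀ i ∈ s, Sm (F i)) :
    Sm (∑ i ∈ s, F i) := by
  have : (∑ i ∈ s, F i) = fun x => ∑ i ∈ s, F i x := by funext x; simp
  rw [this]
  exact ContDiff.sum hF

lemma mD_sum {n : ℕ} {ι : Type*} (s : Finset ι) {F : ι → Euc n → ℝ} (hF : ∀ i ∈ s, Sm (F i))
    (α : Fin n → ℕ) : mD α (∑ i ∈ s, F i) = ∑ i ∈ s, mD α (F i) := by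
  classical
  induction s using Finset.induction_on with
  | empty => simp [mD_zero_fun]
  | insert a s ha ih =>
    rw [Finset.sum_insert ha, Finset.sum_insert ha, mD_add (hF a (by simp)), ih]
    · intro i hi; exact hF i (by simp [hi])
    · exact Sm.sum s fun i hi => hF i (by simp [hi])

/-- the coordinate function `y_i - x_i` -/
def lin {n : ℕ} (x : Euc n) (i : Fin n) : Euc n → ℝ := fun y => y i - x i

lemma lin_hasFDerivAt {n : ℕ} (x : Euc n) (i : Fin n) (y : Euc n) :
    HasFDerivAt (lin x i) (EuclideanSpace.proj i : Euc n →L[ℝ] ℝ) y := by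
  unfold lin
  exact ((EuclideanSpace.proj i : Euc n →L[ℝ] ℝ).hasFDerivAt (x := y)).sub_const _

lemma Sm.lin {n : ℕ} (x : Euc n) (i : Fin n) : Sm (lin x i) := by
  unfold _root_.lin
  exact ((EuclideanSpace.proj i : Euc n →L[ℝ] ℝ).contDiff).sub contDiff_const

lemma pD_lin_mul {n : ℕ} {R : Euc n → ℝ} (hR : Sm R) (x : Euc n) (i j : Fin n) :
    pD j (lin x i * R) = lin x i * pD j R + (if j = i then (1:ℝ) else 0) • R := by
  funext y
  have h := (lin_hasFDerivAt x i y).mul (hR.diff y).hasFDerivAt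
  simp only [pD]
  rw [h.fderiv]
  by_cases hij : i = j <;> simp [PiLp.single_apply, pD, eq_comm, hij]

lemma dL_lin_mul {n : ℕ} {R : Euc n → ℝ} (hR : Sm R) (x : Euc n) (i : Fin n) (l : List (Fin n)) :
    dL l (lin x i * R) = lin x i * dL l R + (l.count i : ℝ) • dL (l.erase i) R := by
  induction l with
  | nil => simp [dL_nil]
  | cons j l ih =>
    rw [dL_cons, ih, pD_add ((Sm.lin x i).mul' (hR.dL l)) ((hR.dL _).smul' _),
      pD_lin_mul (hR.dL l), pD_smul (hR.dL _)]
    by_cases hji : j = i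
    · subst hji
      by_cases hm : j ∈ l
      · have : pD j (dL (l.erase j) R) = dL l R := by
          rw [← dL_cons]
          exact (dL_perm (List.perm_cons_erase hm) (hR.nat _)).symm
        rw [this]
        simp [dL_cons]
        module
      · have : l.count j = 0 := List.count_eq_zero.2 hm
        simp [this, dL_cons]
    · have hij : ¬ (i = j) := fun h => hji h.symm
      simp [hji, dL_cons]

lemma dL_congr_mD {n : ℕ} {R : Euc n → ℝ} (hR : Sm R) (l : List (Fin n)) :
    dL l R = mD (fun i => l.count i) R := by
  rw [mD_eq]
  exact dL_perm (by rw [List.perm_iff_count]; intro a; rw [lst_count]) (hR.nat _)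

lemma mD_lin_mul {n : ℕ} {R : Euc n → ℝ} (hR : Sm R) (x : Euc n) (i : Fin n) (β : Fin n → ℕ) :
    mD β (lin x i * R) x = (β i : ℝ) * mD (β - Pi.single i 1) R x := by
  rw [mD_eq, dL_lin_mul hR, lst_count]
  have : dL ((lst β).erase i) R = mD (β - Pi.single i 1) R := by
    rw [dL_congr_mD hR]
    congr 1
    funext j
    rw [List.count_erase, lst_count]
    by_cases h : i = j
    · subst h; simp
    · simp [h, Pi.single_apply, fun h' : j = i => h h'.symm]
  simp [this, lin]

lemma mD_mD {n : ℕ} {R : Euc n → ℝ} (hR : Sm R) (α β : Fin n → ℕ) :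
    mD α (mD β R) = mD (α + β) R := by
  rw [mD_eq, mD_eq, ← dL_append, dL_congr_mD hR]
  congr 1
  funext i
  simp [lst_count]

lemma pol_of_mD {m n : ℕ} {P : Euc n → ℝ} (hP : Sm P)
    (h : ∀ α : Fin n → ℕ, deg α = m → ∀ x, mD α P x = 0) : P ∈ Pol m n := by
  refine ⟨hP, fun x => ?_⟩
  have := dn_le_of_mD (hP.nat m) (x := x) le_rfl (fun α hα => by rw [h α hα x]; simp)
  rw [mul_zero] at this
  exact norm_le_zero_iff.1 this

lemma pol_mD_zero {m n : ℕ} {P : Euc n → ℝ} (hP : P ∈ Pol m n) {α : Fin n → ℕ} (hα : deg α = m)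
    (x : Euc n) : mD α P x = 0 := by
  have := abs_mD_le α (hP.1.nat _) x
  rw [hα, Pol.dn hP] at this
  exact abs_nonpos_iff.1 this

lemma deg_add {n : ℕ} (α β : Fin n → ℕ) : deg (α + β) = deg α + deg β := by
  simp [deg, Finset.sum_add_distrib]

lemma deg_single {n : ℕ} (i : Fin n) (k : ℕ) : deg (Pi.single i k) = k := by
  simp [deg]

lemma pol_succ {m n : ℕ} {P : Euc n → ℝ} (hP : P ∈ Pol m n) : P ∈ Pol (m+1) n := by
  refine ⟨hP.1, fun x => ?_⟩
  have h : iteratedFDeriv ℝ m P = fun _ => 0 := funext hP.2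
  rw [← norm_eq_zero, ← norm_fderiv_iteratedFDeriv, h, fderiv_fun_const, Pi.zero_apply]; exact norm_zero (E := Euc n →L[ℝ] (ContinuousMultilinearMap ℝ (fun _ : Fin m => Euc n) ℝ))

lemma pol_mono {m m' n : ℕ} (h : m ≤ m') {P : Euc n → ℝ} (hP : P ∈ Pol m n) : P ∈ Pol m' n := by
  induction h with
  | refl => exact hP
  | step _ ih => exact pol_succ ih

lemma pol_pD {m n : ℕ} {P : Euc n → ℝ} (hP : P ∈ Pol m n) (i : Fin n) : pD i P ∈ Pol m n := by
  refine ⟨Sm.pD hP.1 i, fun x => ?_⟩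
  have := dn_pD_le hP.1 i m x
  rw [Pol.dn (pol_succ hP)] at this
  exact norm_le_zero_iff.1 this

lemma pol_mD {m n : ℕ} {P : Euc n → ℝ} (hP : P ∈ Pol m n) (α : Fin n → ℕ) : mD α P ∈ Pol m n := by
  rw [mD_eq]
  induction lst α with
  | nil => exact hP
  | cons i l ih => exact pol_pD ih i

lemma pol_lin_mul {m n : ℕ} {P : Euc n → ℝ} (hP : P ∈ Pol m n) (x : Euc n) (i : Fin n) :
    lin x i * P ∈ Pol (m+1) n := by
  apply pol_of_mD ((Sm.lin x i).mul' hP.1)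
  intro α hα y
  have key : mD α (lin x i * P) y = lin x i y * mD α P y
      + (α i : ℝ) * dL ((lst α).erase i) P y := by
    rw [mD_eq, dL_lin_mul hP.1, lst_count]; rfl
  rw [key, pol_mD_zero (pol_succ hP) hα]
  by_cases h0 : α i = 0
  · simp [h0]
  · have hm : i ∈ lst α := by
      rw [← List.count_pos_iff, lst_count]; omega
    have hl : ((lst α).erase i).length = m := by
      rw [List.length_erase_of_mem hm, lst_length, hα]; rfl
    have := abs_dL_le ((lst α).erase i) (hP.1.nat _) y
    rw [hl, Pol.dn hP] at this
    rw [abs_nonpos_iff.1 this]; simp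

lemma pol_one {n : ℕ} : (1 : Euc n → ℝ) ∈ Pol 1 n := by
  refine ⟨contDiff_const, fun x => ?_⟩
  rw [show (1 : Euc n → ℝ) = fun _ => (1:ℝ) from rfl, iteratedFDeriv_const_of_ne (by norm_num)]; rfl

lemma exists_basis {n : ℕ} (x : Euc n) (d : ℕ) : ∀ α : Fin n → ℕ, deg α = d →
    ∃ G : Euc n → ℝ, G ∈ Pol (d+1) n ∧ ∀ β, mD β G x = if β = α then 1 else 0 := by
  induction d with
  | zero =>
    intro α hα
    have hα0 : α = 0 := by
      funext i
      have : ∀ i ∈ Finset.univ, α i = 0 := Finset.sum_eq_zero_iff.1 hα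
      exact this i (Finset.mem_univ _)
    subst hα0
    refine ⟨1, pol_one, fun β => ?_⟩
    by_cases hβ : β = 0
    · subst hβ
      have : lst (0 : Fin n → ℕ) = [] := by
        rw [← List.length_eq_zero_iff, lst_length, hα]
      simp [mD_eq, this, dL_nil]
    · rw [if_neg hβ]
      have : deg β ≠ 0 := fun h => hβ (by
        funext i
        have : ∀ i ∈ Finset.univ, β i = 0 := Finset.sum_eq_zero_iff.1 h
        exact this i (Finset.mem_univ _))
      exact pol_mD_zero (pol_mono (by omega : 1 ≤ deg β) pol_one) rfl x
  | succ d ih =>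
    intro α hα
    obtain ⟨i, hi⟩ : ∃ i, α i ≠ 0 := by
      by_contra h
      push Not at h
      have : deg α = 0 := by simp [deg, h]
      omega
    have hsplit : α = (α - Pi.single i 1) + Pi.single i 1 := by
      funext j
      by_cases h : j = i
      · subst h; simp; omega
      · simp [h]
    have hd : deg (α - Pi.single i 1) = d := by
      have := deg_add (α - Pi.single i 1) (Pi.single i 1)
      rw [← hsplit, deg_single] at this; omega
    obtain ⟨G, hG, hGc⟩ := ih _ hd
    refine ⟨(α i : ℝ)⁻¹ • (lin x i * G), Submodule.smul_mem _ _ (pol_lin_mul hG x i), fun β => ?_⟩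
    rw [mD_smul ((Sm.lin x i).mul' hG.1), Pi.smul_apply, mD_lin_mul hG.1, hGc]
    by_cases hβ : β = α
    · subst hβ
      have : (β i : ℝ) ≠ 0 := by exact_mod_cast hi
      simp [this]
    · rw [if_neg hβ]
      by_cases hb0 : β i = 0
      · simp [hb0]
      · rw [if_neg]
        · simp
        · intro h
          apply hβ
          have hsplit' : β = (β - Pi.single i 1) + Pi.single i 1 := by
            funext j
            by_cases h : j = i
            · subst h; simp; omega
            · simp [h]
          rw [hsplit', h, ← hsplit]

/-- multi-indices of order `< m` -/
abbrev MI (m n : ℕ) : Type := {α : Fin n → ℕ // deg α < m}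

lemma le_deg {n : ℕ} (α : Fin n → ℕ) (i : Fin n) : α i ≤ deg α :=
  Finset.single_le_sum (f := α) (fun _ _ => Nat.zero_le _) (Finset.mem_univ i)

instance (m n : ℕ) : Finite (MI m n) := by
  apply Finite.of_injective (β := Fin n → Fin m)
    (fun α i => ⟨α.1 i, lt_of_le_of_lt (le_deg α.1 i) α.2⟩)
  intro α β h
  ext i
  have := congrFun h i
  simpa using this

noncomputable instance (m n : ℕ) : Fintype (MI m n) := Fintype.ofFinite _

/-- basis polynomials -/
def bas {m n : ℕ} (x : Euc n) (α : MI m n) : Euc n → ℝ := (exists_basis x _ α.1 rfl).choose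

lemma bas_mem {m n : ℕ} (x : Euc n) (α : MI m n) : bas x α ∈ Pol m n :=
  pol_mono α.2 (exists_basis x _ α.1 rfl).choose_spec.1

lemma bas_mD {m n : ℕ} (x : Euc n) (α β : MI m n) :
    mD β.1 (bas x α) x = if β = α then 1 else 0 := by
  rw [bas, (exists_basis x _ α.1 rfl).choose_spec.2]; simp [Subtype.ext_iff]

/-- polynomial with prescribed normalized coordinates -/
def pl {m n : ℕ} (x : Euc n) (δ : ℝ) : (MI m n → ℝ) →ₗ[ℝ] (Euc n → ℝ) where
  toFun v := ∑ α, (v α * δ ^ (m - deg α.1)) • bas x α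
  map_add' v w := by rw [← Finset.sum_add_distrib]; congr 1; funext α; simp only [Pi.add_apply]; module
  map_smul' c v := by
    rw [Finset.smul_sum]; congr 1; funext α
    simp only [Pi.smul_apply, smul_eq_mul, RingHom.id_apply]; module

lemma pl_def {m n : ℕ} (x : Euc n) (δ : ℝ) (v : MI m n → ℝ) :
    pl x δ v = ∑ α, (v α * δ ^ (m - deg α.1)) • bas x α := rfl

lemma pl_mem {m n : ℕ} (x : Euc n) (δ : ℝ) (v : MI m n → ℝ) : pl x δ v ∈ Pol m n :=
  Submodule.sum_mem _ fun α _ => Submodule.smul_mem _ _ (bas_mem x α)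

lemma pl_mD {m n : ℕ} (x : Euc n) (δ : ℝ) (v : MI m n → ℝ) (β : MI m n) :
    mD β.1 (pl x δ v) x = v β * δ ^ (m - deg β.1) := by
  rw [pl_def, mD_sum _ (fun α _ => Sm.smul' (bas_mem x α).1 _), Finset.sum_apply]
  rw [Finset.sum_eq_single β]
  · rw [mD_smul (bas_mem x β).1]; simp [bas_mD]
  · intro α _ h
    rw [mD_smul (bas_mem x α).1]; simp [bas_mD, h.symm]
  · simp

/-- vanishing jets from coordinates -/
lemma dn_zero_of_mD {m n : ℕ} {G : Euc n → ℝ} (hG : Sm G) {x : Euc n}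
    (h : ∀ β : MI m n, mD β.1 G x = 0) : ∀ j < m, dn j G x = 0 := by
  intro j hj
  have := dn_le_of_mD (hG.nat j) (x := x) le_rfl (fun α hα => by rw [h ⟨α, by omega⟩]; simp)
  rw [mul_zero] at this
  exact le_antisymm this (dn_nonneg _ _ _)

lemma pol_ext_zero {m n : ℕ} {P : Euc n → ℝ} (hP : P ∈ Pol m n) {x : Euc n}
    (h : ∀ j < m, dn j P x = 0) : P = 0 := by
  funext y
  have h1 : At m P x 1 0 := fun j hj => by rw [h j hj]; simp
  have := Pol.near hP h1 le_rfl (norm_nonneg (y - x)) zero_le_one (y := y) (by simp) (Nat.zero_le m)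
  rw [dn_zero] at this
  simp at this
  simpa using this

lemma pol_ext_mD {m n : ℕ} {P Q : Euc n → ℝ} (hP : P ∈ Pol m n) (hQ : Q ∈ Pol m n) {x : Euc n}
    (h : ∀ β : MI m n, mD β.1 P x = mD β.1 Q x) : P = Q := by
  have := pol_ext_zero (Submodule.sub_mem _ hP hQ) (x := x)
    (dn_zero_of_mD (Sm.sub' hP.1 hQ.1) fun β => by
      show mD β.1 (P - Q) x = 0
      rw [mD_sub hP.1 hQ.1]; simp [h])
  exact sub_eq_zero.1 this

/-- normalized coordinates -/
def nc {m n : ℕ} (x : Euc n) (δ : ℝ) (F : Euc n → ℝ) : MI m n → ℝ :=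
  fun β => mD β.1 F x / δ ^ (m - deg β.1)

lemma pl_nc {m n : ℕ} (x : Euc n) {δ : ℝ} (hδ : 0 < δ) {P : Euc n → ℝ} (hP : P ∈ Pol m n) :
    pl x δ (nc (m := m) x δ P) = P := by
  apply pol_ext_mD (pl_mem _ _ _) hP (x := x)
  intro β
  rw [pl_mD, nc]
  have : δ ^ (m - deg β.1) ≠ 0 := by positivity
  field_simp

lemma nc_pl {m n : ℕ} (x : Euc n) {δ : ℝ} (hδ : 0 < δ) (v : MI m n → ℝ) :
    nc x δ (pl x δ v) = v := by
  funext β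
  rw [nc, pl_mD]
  have : δ ^ (m - deg β.1) ≠ 0 := by positivity
  field_simp

/-- the jet of a smooth function -/
def jet (m : ℕ) {n : ℕ} (x : Euc n) (F : Euc n → ℝ) : Euc n → ℝ :=
  pl (m := m) x 1 (fun β => mD β.1 F x)

lemma jet_mem {m n : ℕ} (x : Euc n) (F : Euc n → ℝ) : jet m x F ∈ Pol m n := pl_mem _ _ _

lemma jet_mD {m n : ℕ} (x : Euc n) (F : Euc n → ℝ) (β : MI m n) :
    mD β.1 (jet m x F) x = mD β.1 F x := by simp [jet, pl_mD]

lemma jet_dn {m n : ℕ} (x : Euc n) {F : Euc n → ℝ} (hF : Sm F) :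
    ∀ j < m, dn j (jet m x F - F) x = 0 := by
  have h1 : Sm (jet m x F) := (jet_mem x F).1
  apply dn_zero_of_mD (Sm.sub' h1 hF)
  intro β
  show mD β.1 (jet m x F - F) x = 0
  rw [mD_sub h1 hF]; simp [jet_mD]

lemma At_pl {m n : ℕ} (hn : 1 ≤ n) (x : Euc n) {δ B : ℝ} (hδ : 0 < δ) (hB : 0 ≤ B)
    {v : MI m n → ℝ} (hv : ∀ β, |v β| ≤ B) : At m (pl x δ v) x δ (n ^ m * B) := by
  intro j hj
  have hn' : (1:ℝ) ≤ n := by exact_mod_cast hn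
  have := dn_le_of_mD ((pl_mem x δ v).1.nat j) (x := x) (B := B * δ ^ (m - j)) (by positivity)
    (fun α hα => by
      rw [pl_mD x δ v ⟨α, by omega⟩, abs_mul, abs_of_pos (by positivity : 0 < δ ^ (m - deg α))]
      simp only [hα]
      exact mul_le_mul_of_nonneg_right (hv _) (by positivity))
  refine this.trans ?_
  rw [← mul_assoc]
  gcongr

lemma abs_nc_le {m n : ℕ} {x : Euc n} {δ N : ℝ} (hδ : 0 < δ) {F : Euc n → ℝ} (hF : Sm F)
    (h : At m F x δ N) (β : MI m n) : |nc x δ F β| ≤ N := by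
  rw [nc, abs_div, abs_of_pos (by positivity : 0 < δ ^ (m - deg β.1)), div_le_iff₀ (by positivity)]
  exact (abs_mD_le β.1 (hF.nat _) x).trans (h _ β.2)

/-- upward closed sets of multi-indices -/
def UpC {m n : ℕ} (A : Set (MI m n)) : Prop :=
  ∀ α ∈ A, ∀ β : MI m n, α.1 ≤ β.1 → β ∈ A

lemma W_inv {m n : ℕ} {A : Set (MI m n)} (hA : UpC A) {R : Euc n → ℝ} (hR : R ∈ Pol m n) {x : Euc n}
    (h : ∀ α ∈ A, mD α.1 R x = 0) : ∀ α ∈ A, ∀ y, mD α.1 R y = 0 := by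
  intro α hα y
  have : mD α.1 R = 0 := by
    apply pol_ext_zero (pol_mD hR α.1) (x := x)
    apply dn_zero_of_mD (Sm.mD hR.1 α.1)
    intro β
    rw [mD_mD hR.1]
    by_cases hd : deg (β.1 + α.1) < m
    · exact h ⟨β.1 + α.1, hd⟩ (hA α hα _ (by intro i; simp))
    · exact pol_mD_zero (pol_mono (not_lt.1 hd) hR) rfl x
  rw [this]; rfl

instance (m n : ℕ) : FiniteDimensional ℝ (Pol m n) := by
  have : Function.Injective ((LinearMap.codRestrict (Pol m n) (pl (m := m) (n := n) 0 1)
    (fun v => pl_mem _ _ _))) := by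
    intro v w h
    have h' : pl (m := m) (n := n) 0 1 v = pl 0 1 w := congrArg Subtype.val h
    rw [← nc_pl (0 : Euc n) one_pos v, h', nc_pl _ one_pos]
  have hs : Function.Surjective ((LinearMap.codRestrict (Pol m n) (pl (m := m) (n := n) 0 1)
    (fun v => pl_mem _ _ _))) := by
    intro P
    refine ⟨nc 0 1 P.1, ?_⟩
    apply Subtype.ext
    exact pl_nc 0 one_pos P.2
  exact Module.Finite.of_surjective _ hs

end
end

section
open scoped BigOperators ContDiff

noncomputable section

/-- the nested families of admissible jets -/
def Gam {n : ℕ} (m : ℕ) (E : Set (Euc n)) (f : Euc n → ℝ) : ℕ → Euc n → ℝ → Set (Euc n → ℝ)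
  | 0, x, M => {P | P ∈ Pol m n ∧ P x = f x ∧ ∀ y, 0 ≤ P y + M * ‖y - x‖ ^ m}
  | l + 1, x, M => {P | P ∈ Gam m E f l x M ∧
      ∀ y ∈ E, ∃ P' ∈ Gam m E f l y M, At m (P - P') x ‖x - y‖ M}

section
variable {n m : ℕ} {E : Set (Euc n)} {f : Euc n → ℝ}

lemma Gam_pol {l : ℕ} {x : Euc n} {M : ℝ} {P : Euc n → ℝ} (h : P ∈ Gam m E f l x M) :
    P ∈ Pol m n := by
  induction l with
  | zero => exact h.1
  | succ l ih => exact ih h.1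

lemma Gam_sm {l : ℕ} {x : Euc n} {M : ℝ} {P : Euc n → ℝ} (h : P ∈ Gam m E f l x M) :
    Sm P := (Gam_pol h).1

lemma Gam_zero {l : ℕ} {x : Euc n} {M : ℝ} {P : Euc n → ℝ} (h : P ∈ Gam m E f l x M) :
    P ∈ Gam m E f 0 x M := by
  induction l with
  | zero => exact h
  | succ l ih => exact ih h.1

lemma Gam_le {l l' : ℕ} (hl : l' ≤ l) {x : Euc n} {M : ℝ} {P : Euc n → ℝ}
    (h : P ∈ Gam m E f l x M) : P ∈ Gam m E f l' x M := by
  induction hl with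
  | refl => exact h
  | step _ ih => exact ih h.1

lemma Gam_mono {l : ℕ} {x : Euc n} {M M' : ℝ} (hM : M ≤ M') {P : Euc n → ℝ}
    (h : P ∈ Gam m E f l x M) : P ∈ Gam m E f l x M' := by
  induction l generalizing x P with
  | zero =>
    refine ⟨h.1, h.2.1, fun y => (h.2.2 y).trans ?_⟩
    have : M * ‖y - x‖ ^ m ≤ M' * ‖y - x‖ ^ m := mul_le_mul_of_nonneg_right hM (by positivity)
    linarith
  | succ l ih =>
    refine ⟨ih h.1, fun y hy => ?_⟩
    obtain ⟨P', h1, h2⟩ := h.2 y hy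
    exact ⟨P', ih h1, h2.mono_N (norm_nonneg _) hM⟩

lemma Gam_convex {l : ℕ} {x : Euc n} {M N a b : ℝ} (ha : 0 ≤ a) (hb : 0 ≤ b) (hab : a + b = 1)
    {P Q : Euc n → ℝ} (h : P ∈ Gam m E f l x M) (h' : Q ∈ Gam m E f l x N) :
    a • P + b • Q ∈ Gam m E f l x (a * M + b * N) := by
  induction l generalizing x P Q with
  | zero =>
    refine ⟨Submodule.add_mem _ (Submodule.smul_mem _ _ h.1) (Submodule.smul_mem _ _ h'.1), ?_, ?_⟩
    · simp only [Pi.add_apply, Pi.smul_apply, smul_eq_mul]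
      rw [h.2.1, h'.2.1, ← add_mul, hab, one_mul]
    · intro y
      simp only [Pi.add_apply, Pi.smul_apply, smul_eq_mul]
      nlinarith [mul_nonneg ha (h.2.2 y), mul_nonneg hb (h'.2.2 y)]
  | succ l ih =>
    refine ⟨ih h.1 h'.1, fun y hy => ?_⟩
    obtain ⟨P', h1, h2⟩ := h.2 y hy
    obtain ⟨Q', h3, h4⟩ := h'.2 y hy
    refine ⟨a • P' + b • Q', ih h1 h3, ?_⟩
    have e : a • P + b • Q - (a • P' + b • Q') = a • (P - P') + b • (Q - Q') := by module
    rw [e]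
    have s1 := Sm.sub' (Gam_sm h.1) (Gam_sm h1)
    have s2 := Sm.sub' (Gam_sm h'.1) (Gam_sm h3)
    have := At.add (s1.smul' a) (s2.smul' b) (h2.smul s1 a) (h4.smul s2 b)
    rwa [abs_of_nonneg ha, abs_of_nonneg hb] at this

/-- cutoff functions at scale `δ` -/
def Cut {n : ℕ} (m : ℕ) (θ : Euc n → ℝ) (x : Euc n) (δ B : ℝ) : Prop :=
  ∀ y, ‖y - x‖ ≤ δ → 0 ≤ θ y ∧ θ y ≤ 1 ∧ ∀ j ≤ m, dn j θ y ≤ B / δ ^ j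

lemma Cut.half {θ : Euc n → ℝ} {x y : Euc n} {δ B : ℝ} (hδ : 0 < δ) (hB : 0 ≤ B)
    (h : Cut m θ x δ B) (hy : ‖y - x‖ ≤ δ / 2) : Cut m θ y (δ / 2) B := by
  intro z hz
  have hzx : ‖z - x‖ ≤ δ := by
    have := norm_add_le (z - y) (y - x)
    rw [sub_add_sub_cancel] at this; linarith
  obtain ⟨h1, h2, h3⟩ := h z hzx
  refine ⟨h1, h2, fun j hj => (h3 j hj).trans ?_⟩
  apply div_le_div_of_nonneg_left hB (by positivity)
  exact pow_le_pow_left₀ (by positivity) (by linarith) j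

lemma cut_mul_at {θ R : Euc n → ℝ} (hθ : Sm θ) (hR : Sm R) {x : Euc n} {δ B N s : ℝ}
    (hδ : 0 < δ) (hs : 0 ≤ s) (hsδ : s ≤ δ) (hN : 0 ≤ N) (hc : Cut m θ x δ B)
    (h : At m R x s N) : At m (θ * R) x s (2 ^ m * B * N) := by
  intro j hj
  apply dn_mul_scale hθ hR hδ hs hsδ hj.le hN
  · intro i hi; exact (hc x (by simpa using hδ.le)).2.2 i (by omega)
  · intro i hi; exact h i (by omega)

lemma cut_mul_top {θ R : Euc n → ℝ} (hθ : Sm θ) (hR : R ∈ Pol m n) {x z : Euc n} {δ B N : ℝ}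
    (hδ : 0 < δ) (hN : 0 ≤ N) (hc : Cut m θ x δ B)
    (h : At m R x δ N) (hz : ‖z - x‖ ≤ δ) : dn m (θ * R) z ≤ 4 ^ m * B * N := by
  have := dn_mul_scale (m := m) (j := m) (N := 2 ^ m * N) hθ hR.1 hδ hδ.le le_rfl le_rfl (by positivity)
    (fun i hi => (hc z hz).2.2 i hi)
    (fun i hi => by
      have := Pol.near hR h hN zero_le_one hδ.le (y := z) (by simpa using hz) hi
      norm_num at this ⊢
      exact this)
  refine this.trans (le_of_eq ?_)
  rw [show (4:ℝ) = 2 * 2 by norm_num, mul_pow]; simp; ring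

/-- a jet of `P2 + θ (P1 - P2)` -/
lemma mult_top {θ P P1 P2 : Euc n → ℝ} (hθ : Sm θ) (hP : P ∈ Pol m n) (hP1 : P1 ∈ Pol m n)
    (hP2 : P2 ∈ Pol m n) {x z : Euc n} {δ B N : ℝ}
    (hδ : 0 < δ) (hN : 0 ≤ N) (hc : Cut m θ x δ B)
    (h : At m (P1 - P2) x δ N) (hz : ‖z - x‖ ≤ δ) :
    dn m (P - (P2 + θ * (P1 - P2))) z ≤ 4 ^ m * B * N := by
  have hR := Submodule.sub_mem _ hP1 hP2
  have e : P - (P2 + θ * (P1 - P2)) = (P - P2) - θ * (P1 - P2) := by ring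
  rw [e]
  have := dn_sub_le (Submodule.sub_mem _ hP hP2).1 (hθ.mul' hR.1) m z
  rw [Pol.dn (Submodule.sub_mem _ hP hP2), zero_add] at this
  exact this.trans (cut_mul_top hθ hR hδ hN hc h hz)

lemma mult_vanish {θ P P1 P2 : Euc n → ℝ} (hθ : Sm θ) (hP : P ∈ Pol m n) (hP1 : P1 ∈ Pol m n)
    (hP2 : P2 ∈ Pol m n) {x y : Euc n} {δ B N : ℝ} (hB : 0 ≤ B)
    (hδ : 0 < δ) (hN : 0 ≤ N) (hc : Cut m θ x δ B)
    (h : At m (P1 - P2) x δ N) (hj : ∀ j < m, dn j (P - (P2 + θ * (P1 - P2))) x = 0)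
    (hy : ‖y - x‖ ≤ δ) {j : ℕ} (hjm : j ≤ m) :
    dn j (P - (P2 + θ * (P1 - P2))) y ≤ 2 ^ m * (4 ^ m * B * N) * ‖y - x‖ ^ (m - j) := by
  have hR := Submodule.sub_mem _ hP1 hP2
  exact dn_vanish (hP.1.sub' (hP2.1.add' (hθ.mul' hR.1))) (by positivity) hj
    (fun z hz => mult_top hθ hP hP1 hP2 hδ hN hc h (hz.trans hy)) hjm

lemma mult_at {θ P P1 P2 : Euc n → ℝ} (hθ : Sm θ) (hP : P ∈ Pol m n) (hP1 : P1 ∈ Pol m n)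
    (hP2 : P2 ∈ Pol m n) {x : Euc n} {δ B N : ℝ}
    (hδ : 0 < δ) (hN : 0 ≤ N) (hc : Cut m θ x δ B)
    (h : At m (P1 - P2) x δ N) (hj : ∀ j < m, dn j (P - (P2 + θ * (P1 - P2))) x = 0) :
    At m (P - P2) x δ (2 ^ m * B * N) := by
  have hR := Submodule.sub_mem _ hP1 hP2
  have e : P - P2 = (P - (P2 + θ * (P1 - P2))) + θ * (P1 - P2) := by ring
  rw [e]
  have h1 : At m (P - (P2 + θ * (P1 - P2))) x δ 0 := fun j hjm => by rw [hj j hjm]; simp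
  have := At.add (hP.1.sub' (hP2.1.add' (hθ.mul' hR.1))) (hθ.mul' hR.1) h1
    (cut_mul_at hθ hR.1 hδ hδ.le le_rfl hN hc h)
  rwa [zero_add] at this

lemma mult_zero (hm : 1 ≤ m) {B : ℝ} (hB : 1 ≤ B) {M δ : ℝ} (hM : 0 ≤ M) (hδ : 0 < δ) {x : Euc n}
    {θ P P1 P2 : Euc n → ℝ} (h1 : P1 ∈ Gam m E f 0 x M) (h2 : P2 ∈ Gam m E f 0 x M)
    (h12 : At m (P1 - P2) x δ M) (hθ : Sm θ) (hc : Cut m θ x δ B) (hP : P ∈ Pol m n)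
    (hj : ∀ j < m, dn j (P - (P2 + θ * (P1 - P2))) x = 0) :
    P ∈ Gam m E f 0 x ((1 + 8 ^ m * B) * M) := by
  have h8 : (8:ℝ) ^ m = 2 ^ m * 4 ^ m := by rw [← mul_pow]; norm_num
  refine ⟨hP, ?_, fun y => ?_⟩
  · have := hj 0 hm
    rw [dn_zero, abs_eq_zero] at this
    simp only [Pi.sub_apply, Pi.add_apply, Pi.mul_apply, h1.2.1, h2.2.1] at this
    linarith
  · by_cases hy : ‖y - x‖ ≤ δ
    · have := mult_vanish hθ hP h1.1 h2.1 (by linarith) hδ hM hc h12 hj hy (Nat.zero_le m)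
      rw [dn_zero] at this
      have h3 := (abs_le.1 this).1
      simp only [Pi.sub_apply, Pi.add_apply, Pi.mul_apply, Nat.sub_zero] at h3
      obtain ⟨c1, c2, _⟩ := hc y hy
      have e1 := mul_nonneg c1 (h1.2.2 y)
      have e2 := mul_nonneg (sub_nonneg.2 c2) (h2.2.2 y)
      rw [h8]
      nlinarith
    · push Not at hy
      have hQ := Submodule.sub_mem _ hP h2.1
      have h3 := (mult_at hθ hP h1.1 h2.1 hδ hM hc h12 hj).mono_r (by positivity) hδ.le hy.le
      have h4 := Pol.near hQ h3 (by positivity) zero_le_one (norm_nonneg _) (y := y) (by simp)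
        (Nat.zero_le m)
      rw [dn_zero] at h4
      have h5 := (abs_le.1 h4).1
      simp only [Pi.sub_apply, Nat.sub_zero] at h5
      have e2 := h2.2.2 y
      have h6 : (1 + 1 : ℝ) ^ m * (2 ^ m * B * M) * ‖y - x‖ ^ m ≤ 8 ^ m * B * M * ‖y - x‖ ^ m := by
        apply mul_le_mul_of_nonneg_right _ (by positivity)
        have : (1 + 1 : ℝ) ^ m * (2 ^ m * B * M) = 4 ^ m * (B * M) := by
          rw [show (4:ℝ) = 2 * 2 by norm_num, mul_pow]; norm_num; ring
        rw [this, mul_assoc]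
        apply mul_le_mul_of_nonneg_right _ (by positivity)
        exact pow_le_pow_left₀ (by norm_num) (by norm_num) m
      nlinarith

/-- The multiplication lemma. -/
lemma mult_lemma (hm : 1 ≤ m) (l : ℕ) {B : ℝ} (hB : 1 ≤ B) : ∃ C : ℝ, 1 ≤ C ∧
    ∀ (E : Set (Euc n)) (f : Euc n → ℝ) (M δ : ℝ), 0 ≤ M → 0 < δ → ∀ (x : Euc n)
    (θ P P1 P2 : Euc n → ℝ), P1 ∈ Gam m E f l x M → P2 ∈ Gam m E f l x M →
    At m (P1 - P2) x δ M → Sm θ → Cut m θ x δ B → P ∈ Pol m n →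
    (∀ j < m, dn j (P - (P2 + θ * (P1 - P2))) x = 0) → P ∈ Gam m E f l x (C * M) := by
  induction l with
  | zero =>
    refine ⟨1 + 8 ^ m * B, by nlinarith [pow_pos (show (0:ℝ) < 8 by norm_num) m], ?_⟩
    intro E f M δ hM hδ x θ P P1 P2 h1 h2 h12 hθ hc hP hj
    exact mult_zero hm hB hM hδ h1 h2 h12 hθ hc hP hj
  | succ l ih =>
    obtain ⟨C, hC, ih⟩ := ih
    set K : ℝ := 3 * 4 ^ m with hK
    have hK0 : 0 ≤ K := by positivity
    have hK1 : 1 ≤ K := by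
      have : (1:ℝ) ≤ 4 ^ m := one_le_pow₀ (by norm_num)
      linarith
    have hB0 : 0 ≤ B := by linarith
    have hC0 : 0 ≤ C := by linarith
    set D : ℝ := 2 ^ m * (2 ^ m * B) + 1 + (1 + 2 ^ m * B * 2) + 2 ^ m * (4 ^ m * B * K) with hD
    refine ⟨C * K + D, by nlinarith [show 0 ≤ D by positivity], ?_⟩
    intro E f M δ hM hδ x θ P P1 P2 h1 h2 h12 hθ hc hP hj
    have hM2 : M ≤ K * M := by nlinarith
    have hp1 := Gam_pol h1
    have hp2 := Gam_pol h2
    refine ⟨Gam_mono ?_ (ih E f M δ hM hδ x θ P P1 P2 h1.1 h2.1 h12 hθ hc hP hj), fun y hy => ?_⟩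
    · have : 0 ≤ D := by positivity
      nlinarith [mul_nonneg hC0 (mul_nonneg (sub_nonneg.2 hK1) hM), mul_nonneg this hM]
    obtain ⟨P1', g1, a1⟩ := h1.2 y hy
    obtain ⟨P2', g2, a2⟩ := h2.2 y hy
    set s := ‖x - y‖ with hs
    have hs0 : 0 ≤ s := norm_nonneg _
    have hq1 := Gam_pol g1
    have hq2 := Gam_pol g2
    by_cases hsδ : s ≤ δ / 2
    · have hsδ' : s ≤ δ := by linarith
      have hyx : ‖y - x‖ ≤ δ / 2 := by rwa [norm_sub_rev]
      have hc' := hc.half hδ hB0 hyx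
      have a12 : At m (P1' - P2') y (δ / 2) (K * M) := by
        have e : P1' - P2' = ((P1 - P2) - (P1 - P1')) + (P2 - P2') := by ring
        have t1 : At m (P1' - P2') x δ (M + M + M) := by
          rw [e]
          exact At.add ((hp1.1.sub' hp2.1).sub' (hp1.1.sub' hq1.1)) (hp2.1.sub' hq2.1)
            (At.sub (hp1.1.sub' hp2.1) (hp1.1.sub' hq1.1) h12 (a1.mono_r hM hs0 hsδ'))
            (a2.mono_r hM hs0 hsδ')
        have t2 := Pol.recenter (Submodule.sub_mem _ hq1 hq2) t1 (by positivity) zero_le_one hδ.le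
          (y := y) (by linarith)
        have t3 := t2.shrink (by positivity) hδ.le (by positivity : 0 ≤ δ / 2) (K := 2) (by norm_num)
          (by linarith)
        apply t3.mono_N (by positivity)
        apply le_of_eq
        rw [hK, show (4:ℝ) = 2 * 2 by norm_num, mul_pow]; norm_num; ring
      set P' := jet m y (P2' + θ * (P1' - P2')) with hP'
      have smH' : Sm (P2' + θ * (P1' - P2')) := hq2.1.add' (hθ.mul' (hq1.1.sub' hq2.1))
      have smH : Sm (P2 + θ * (P1 - P2)) := hp2.1.add' (hθ.mul' (hp1.1.sub' hp2.1))
      have hj' : ∀ j < m, dn j (P' - (P2' + θ * (P1' - P2'))) y = 0 := jet_dn y smH'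
      have hP'p : P' ∈ Pol m n := jet_mem _ _
      have g := ih E f (K * M) (δ / 2) (by positivity) (by positivity) y θ P' P1' P2'
        (Gam_mono hM2 g1) (Gam_mono hM2 g2) a12 hθ hc' hP'p hj'
      refine ⟨P', Gam_mono ?_ g, ?_⟩
      · have : 0 ≤ D := by positivity
        nlinarith [mul_nonneg this hM]
      have e : P - P' = (P - (P2 + θ * (P1 - P2))) + ((P2 - P2') + θ * ((P1 - P1') - (P2 - P2')))
          - (P' - (P2' + θ * (P1' - P2'))) := by ring
      rw [e]
      have b1 : At m (P - (P2 + θ * (P1 - P2))) x s 0 := fun j hjm => by rw [hj j hjm]; simp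
      have b2 : At m ((P1 - P1') - (P2 - P2')) x s (M + M) :=
        At.sub (hp1.1.sub' hq1.1) (hp2.1.sub' hq2.1) a1 a2
      have b3 := cut_mul_at hθ ((hp1.1.sub' hq1.1).sub' (hp2.1.sub' hq2.1)) hδ hs0 hsδ' (by positivity)
        hc b2
      have b4 := At.add (hp2.1.sub' hq2.1) (hθ.mul' ((hp1.1.sub' hq1.1).sub' (hp2.1.sub' hq2.1))) a2 b3
      have b5 : At m (P' - (P2' + θ * (P1' - P2'))) x s (2 ^ m * (4 ^ m * B * (K * M))) :=
        fun j hjm => mult_vanish hθ hP'p hq1 hq2 hB0 (by positivity) (by positivity) hc' a12 hj'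
          (y := x) hsδ hjm.le
      have b6 := At.sub ((hP.1.sub' smH).add' ((hp2.1.sub' hq2.1).add'
        (hθ.mul' ((hp1.1.sub' hq1.1).sub' (hp2.1.sub' hq2.1))))) (hP'p.1.sub' smH')
        (At.add (hP.1.sub' smH) ((hp2.1.sub' hq2.1).add'
        (hθ.mul' ((hp1.1.sub' hq1.1).sub' (hp2.1.sub' hq2.1)))) b1 b4) b5
      apply b6.mono_N hs0
      have : 0 ≤ C * K * M := by positivity
      have : 0 ≤ 2 ^ m * (2 ^ m * B) * M := by positivity
      rw [hD]; nlinarith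
    · push Not at hsδ
      refine ⟨P2', Gam_mono ?_ g2, ?_⟩
      · have : 1 ≤ C * K + D := by nlinarith [show 0 ≤ D by positivity]
        nlinarith
      have e : P - P2' = (P - P2) + (P2 - P2') := by ring
      rw [e]
      have b1 := (mult_at hθ hP hp1 hp2 hδ hM hc h12 hj).shrink (by positivity) hδ.le hs0 (K := 2)
        (by norm_num) (by linarith)
      have b2 := At.add (hP.1.sub' hp2.1) (hp2.1.sub' hq2.1) b1 a2
      apply b2.mono_N hs0
      have : 0 ≤ C * K * M := by positivity
      have : 0 ≤ (1 + 2 ^ m * B * 2) * M := by positivity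
      have : 0 ≤ 2 ^ m * (4 ^ m * B * K) * M := by positivity
      rw [hD]; nlinarith

end

end
end

section
open scoped BigOperators ContDiff

noncomputable section

section
variable {m n : ℕ}

/-- a weight on multi-indices giving a graded total order -/
def om (m : ℕ) {n : ℕ} (α : Fin n → ℕ) : ℕ := deg α * m ^ n + ∑ i, α i * m ^ (i : ℕ)

lemma om_add (α β : Fin n → ℕ) : om m (α + β) = om m α + om m β := by
  simp only [om, deg_add, Pi.add_apply, add_mul, Finset.sum_add_distrib]; ring

lemma om_tail_lt (α : MI m n) : ∑ i, α.1 i * m ^ (i : ℕ) < m ^ n := by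
  have := (finFunctionFinEquiv (m := m) (n := n)
    (fun i => ⟨α.1 i, lt_of_le_of_lt (le_deg α.1 i) α.2⟩)).2
  rw [finFunctionFinEquiv_apply] at this
  exact this

lemma om_div (α : MI m n) : om m α.1 / m ^ n = deg α.1 := by
  have h := om_tail_lt α
  rw [om, Nat.add_comm, Nat.add_mul_div_right _ _ (lt_of_le_of_lt (Nat.zero_le _) h),
    Nat.div_eq_of_lt h, zero_add]

lemma om_inj {α β : MI m n} (h : om m α.1 = om m β.1) : α = β := by
  have hd : deg α.1 = deg β.1 := by rw [← om_div α, ← om_div β, h]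
  have ht : ∑ i, α.1 i * m ^ (i : ℕ) = ∑ i, β.1 i * m ^ (i : ℕ) := by
    unfold om at h; rw [hd] at h; omega
  have : (fun i => (⟨α.1 i, lt_of_le_of_lt (le_deg α.1 i) α.2⟩ : Fin m))
      = (fun i => (⟨β.1 i, lt_of_le_of_lt (le_deg β.1 i) β.2⟩ : Fin m)) := by
    apply (finFunctionFinEquiv (m := m) (n := n)).injective
    apply Fin.ext
    rw [finFunctionFinEquiv_apply, finFunctionFinEquiv_apply]
    exact ht
  ext i
  have := congrFun this i
  simpa using this

lemma om_deg {α β : MI m n} (h : om m α.1 ≤ om m β.1) : deg α.1 ≤ deg β.1 := by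
  rw [← om_div α, ← om_div β]; exact Nat.div_le_div_right h

/-- the order on sets of multi-indices -/
def prec (A' A : Set (MI m n)) : Prop :=
  ∃ α ∈ A', α ∉ A ∧ ∀ β : MI m n, om m β.1 < om m α.1 → (β ∈ A ↔ β ∈ A')

lemma prec_irrefl (A : Set (MI m n)) : ¬ prec A A := fun ⟨_, h1, h2, _⟩ => h2 h1

lemma prec_trans {A B C : Set (MI m n)} (h1 : prec A B) (h2 : prec B C) : prec A C := by
  obtain ⟨α, a1, a2, a3⟩ := h1
  obtain ⟨β, b1, b2, b3⟩ := h2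
  rcases lt_trichotomy (om m α.1) (om m β.1) with h | h | h
  · exact ⟨α, a1, fun hc => a2 ((b3 α h).1 hc), fun γ hγ => (b3 γ (hγ.trans h)).trans (a3 γ hγ)⟩
  · exact absurd (om_inj h ▸ b1) a2
  · exact ⟨β, (a3 β h).1 b1, b2, fun γ hγ => (b3 γ hγ).trans (a3 γ (hγ.trans h))⟩

lemma prec_wf : WellFounded (prec (m := m) (n := n)) := by
  have : IsTrans (Set (MI m n)) prec := ⟨fun _ _ _ => prec_trans⟩
  have : Std.Irrefl (prec (m := m) (n := n)) := ⟨prec_irrefl⟩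
  exact Finite.wellFounded_of_trans_of_irrefl _

/-- lower a multi-index -/
def low (i : Fin n) (β : MI m n) : MI m n := ⟨β.1 - Pi.single i 1, by
  refine lt_of_le_of_lt ?_ β.2
  exact Finset.sum_le_sum fun j _ => Nat.sub_le _ _⟩

/-- multiplication by the `i`-th variable, on coordinates -/
def Xop (i : Fin n) (v : MI m n → ℝ) : MI m n → ℝ := fun β => (β.1 i : ℝ) * v (low i β)

/-- the abstract families -/
structure Fam (κ : ℝ → ℝ) (T : ℝ → Set (MI m n → ℝ)) : Prop where
  kap : ∀ A, 1 ≤ A → 1 ≤ κ A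
  mono : ∀ A A', 1 ≤ A → A ≤ A' → T A ⊆ T A'
  conv : ∀ A, 1 ≤ A → Convex ℝ (T A)
  symm : ∀ A, 1 ≤ A → ∀ v ∈ T A, -v ∈ T A
  scale : ∀ A t, 1 ≤ A → 1 ≤ t → ∀ v ∈ T A, t • v ∈ T (t * A)
  mulX : ∀ A, 1 ≤ A → ∀ v ∈ T A, (∀ β, |v β| ≤ A) → ∀ i, Xop i v ∈ T (κ A)

lemma Fam.comb_one {κ : ℝ → ℝ} {T : ℝ → Set (MI m n → ℝ)} (hT : Fam κ T) {A : ℝ} (hA : 1 ≤ A)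
    (h0 : 0 ∈ T A) {ι : Type*} (s : Finset ι) (c : ι → ℝ) (v : ι → MI m n → ℝ)
    (hv : ∀ i ∈ s, v i ∈ T A) (hc : ∑ i ∈ s, |c i| ≤ 1) : ∑ i ∈ s, c i • v i ∈ T A := by
  set σ := ∑ i ∈ s, |c i| with hσ
  have hσ0 : 0 ≤ σ := Finset.sum_nonneg fun _ _ => abs_nonneg _
  rcases hσ0.eq_or_lt with h | h
  · have : ∀ i ∈ s, |c i| = 0 := (Finset.sum_eq_zero_iff_of_nonneg fun _ _ => abs_nonneg _).1 h.symm
    rw [Finset.sum_eq_zero]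
    · exact h0
    · intro i hi; rw [abs_eq_zero.1 (this i hi), zero_smul]
  · set w : ι → MI m n → ℝ := fun i => if 0 ≤ c i then v i else - v i with hw
    have hwm : ∀ i ∈ s, w i ∈ T A := by
      intro i hi
      simp only [hw]
      split_ifs
      · exact hv i hi
      · exact hT.symm A hA _ (hv i hi)
    have h1 : ∑ i ∈ s, (|c i| / σ) • w i ∈ T A := by
      apply (hT.conv A hA).sum_mem
      · intro i _; positivity
      · rw [← Finset.sum_div, ← hσ, div_self h.ne']
      · exact hwm
    have h2 : ∑ i ∈ s, c i • v i = σ • ∑ i ∈ s, (|c i| / σ) • w i := by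
      rw [Finset.smul_sum]
      apply Finset.sum_congr rfl
      intro i _
      rw [smul_smul, mul_div_cancel₀ _ h.ne']
      simp only [hw]
      split_ifs with hc0
      · rw [abs_of_nonneg hc0]
      · rw [abs_of_neg (not_le.1 hc0)]; module
    rw [h2]
    have := (hT.conv A hA) h1 h0 hσ0 (sub_nonneg.2 hc) (by ring)
    simpa using this

lemma Fam.comb {κ : ℝ → ℝ} {T : ℝ → Set (MI m n → ℝ)} (hT : Fam κ T) {A s : ℝ} (hA : 1 ≤ A)
    (hs : 1 ≤ s) (h0 : 0 ∈ T A) {ι : Type*} (S : Finset ι) (c : ι → ℝ) (v : ι → MI m n → ℝ)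
    (hv : ∀ i ∈ S, v i ∈ T A) (hc : ∑ i ∈ S, |c i| ≤ s) : ∑ i ∈ S, c i • v i ∈ T (s * A) := by
  have hs0 : 0 < s := by linarith
  have h1 := hT.comb_one hA h0 S (fun i => c i / s) v hv (by
    simp only [abs_div, abs_of_pos hs0]
    rw [← Finset.sum_div, div_le_one hs0]; exact hc)
  have h2 := hT.scale A s hA hs _ h1
  rw [Finset.smul_sum] at h2
  convert h2 using 2
  rw [smul_smul, mul_div_cancel₀ _ hs0.ne']

/-- the freeness condition -/
def FreeT (𝒜 : Set (MI m n)) (T : ℝ → Set (MI m n → ℝ)) (A : ℝ) : Prop :=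
  ∀ α ∈ 𝒜, ∃ v ∈ T A, (∀ β ∈ 𝒜, v β = if β = α then 1 else 0) ∧ ∀ β, |v β| ≤ A

lemma FreeT.mono {κ : ℝ → ℝ} {T : ℝ → Set (MI m n → ℝ)} (hT : Fam κ T) {𝒜 : Set (MI m n)}
    {A A' : ℝ} (hA : 1 ≤ A) (hAA : A ≤ A') (h : FreeT 𝒜 T A) : FreeT 𝒜 T A' := by
  intro α hα
  obtain ⟨v, h1, h2, h3⟩ := h α hα
  exact ⟨v, hT.mono A A' hA hAA h1, h2, fun β => (h3 β).trans hAA⟩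

lemma inv_near {ι : Type*} [Fintype ι] [DecidableEq ι] :
    ∀ᶠ X in nhds (1 : Matrix ι ι ℝ), IsUnit X.det ∧ ∀ i j, |X⁻¹ i j| ≤ 2 := by
  have hdet : Filter.Tendsto (fun X : Matrix ι ι ℝ => X.det) (nhds 1) (nhds 1) := by
    have : Continuous (fun X : Matrix ι ι ℝ => X.det) := continuous_id.matrix_det
    simpa using this.tendsto 1
  have hadj : Filter.Tendsto (fun X : Matrix ι ι ℝ => X.adjugate) (nhds 1) (nhds 1) := by
    have : Continuous (fun X : Matrix ι ι ℝ => X.adjugate) := continuous_id.matrix_adjugate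
    simpa using this.tendsto 1
  have hinv : Filter.Tendsto (fun X : Matrix ι ι ℝ => X⁻¹) (nhds 1) (nhds 1) := by
    have : (fun X : Matrix ι ι ℝ => X⁻¹) = fun X => (X.det)⁻¹ • X.adjugate := by
      funext X; rw [Matrix.inv_def, Ring.inverse_eq_inv']
    rw [this]
    have := (hdet.inv₀ one_ne_zero).smul hadj
    simpa using this
  have h1 : ∀ᶠ X in nhds (1 : Matrix ι ι ℝ), IsUnit X.det := by
    have := hdet.eventually_ne (one_ne_zero)
    filter_upwards [this] with X hX
    exact isUnit_iff_ne_zero.2 hX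
  have h2 : ∀ᶠ X in nhds (1 : Matrix ι ι ℝ), ∀ i j, |X⁻¹ i j| ≤ 2 := by
    rw [Filter.eventually_all]; intro i
    rw [Filter.eventually_all]; intro j
    have hij : Filter.Tendsto (fun X : Matrix ι ι ℝ => |X⁻¹ i j|) (nhds 1)
        (nhds |(1 : Matrix ι ι ℝ) i j|) :=
      (((continuous_apply j).tendsto _).comp (((continuous_apply i).tendsto _).comp hinv)).abs
    have hlt : |(1 : Matrix ι ι ℝ) i j| < 2 := by
      by_cases h : i = j
      · subst h; simp
      · simp [h]
    filter_upwards [hij.eventually_lt_const hlt] with X hX using hX.le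
  exact h1.and h2

lemma exists_eps (𝒜 : Set (MI m n)) [DecidableEq 𝒜] [Fintype 𝒜] :
    ∃ ε : ℝ, 0 < ε ∧ ∀ X : Matrix 𝒜 𝒜 ℝ,
    (∀ i j, |X i j - (1 : Matrix 𝒜 𝒜 ℝ) i j| ≤ ε) → IsUnit X.det ∧ ∀ i j, |X⁻¹ i j| ≤ 2 := by
  have h := inv_near (ι := 𝒜)
  obtain ⟨ε, hε, h⟩ := Metric.eventually_nhds_iff.1
    (show ∀ᶠ X : 𝒜 → 𝒜 → ℝ in nhds (1 : Matrix 𝒜 𝒜 ℝ),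
      IsUnit (Matrix.det X) ∧ ∀ i j, |(Matrix.of X)⁻¹ i j| ≤ 2 from h)
  refine ⟨ε / 2, by positivity, fun X hX => h ?_⟩
  refine (dist_pi_lt_iff hε).2 fun i => (dist_pi_lt_iff hε).2 fun j => ?_
  exact lt_of_le_of_lt (hX i j) (by linarith)

/-- normalization of an almost-normalized family -/
lemma fam_normalize (𝒜 : Set (MI m n)) : ∃ ε : ℝ, 0 < ε ∧ ∀ (κ : ℝ → ℝ) (T : ℝ → Set (MI m n → ℝ)),
    Fam κ T → ∀ B : ℝ, 1 ≤ B → 0 ∈ T B → ∀ v : MI m n → MI m n → ℝ,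
    (∀ α ∈ 𝒜, v α ∈ T B) → (∀ α ∈ 𝒜, ∀ β, |v α β| ≤ B) →
    (∀ α ∈ 𝒜, ∀ β ∈ 𝒜, |v α β - if β = α then 1 else 0| ≤ ε) →
    FreeT 𝒜 T ((2 * Fintype.card (MI m n) + 1) * B) := by
  classical
  obtain ⟨ε, hε, h⟩ := exists_eps 𝒜
  refine ⟨ε, hε, fun κ T hT B hB h0 v hv1 hv2 hv3 => ?_⟩
  set X : Matrix 𝒜 𝒜 ℝ := fun a b => v a.1 b.1 with hX
  obtain ⟨hu, hN⟩ := h X (fun i j => by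
    have := hv3 i.1 i.2 j.1 j.2
    simp only [hX, Matrix.one_apply]
    convert this using 5
    rw [eq_comm, Subtype.ext_iff])
  have hcard : (Fintype.card 𝒜 : ℝ) ≤ Fintype.card (MI m n) := by
    exact_mod_cast Fintype.card_subtype_le (fun a => a ∈ 𝒜)
  intro α hα
  set w : MI m n → ℝ := ∑ b : 𝒜, X⁻¹ ⟨α, hα⟩ b • v b.1 with hw
  have hsum : ∑ b : 𝒜, |X⁻¹ ⟨α, hα⟩ b| ≤ 2 * Fintype.card (MI m n) := by
    calc ∑ b : 𝒜, |X⁻¹ ⟨α, hα⟩ b| ≤ ∑ b : 𝒜, (2:ℝ) := Finset.sum_le_sum fun b _ => hN _ _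
      _ = 2 * Fintype.card 𝒜 := by simp; ring
      _ ≤ _ := by linarith
  have hs : (1:ℝ) ≤ 2 * Fintype.card (MI m n) + 1 := by
    have : (0:ℝ) ≤ Fintype.card (MI m n) := by positivity
    linarith
  refine ⟨w, hT.comb hB hs h0 Finset.univ _ _ (fun b _ => hv1 b.1 b.2) (by linarith), ?_, ?_⟩
  · intro β hβ
    have h1 : (X⁻¹ * X) ⟨α, hα⟩ ⟨β, hβ⟩ = w β := by
      rw [Matrix.mul_apply, hw, Finset.sum_apply]; rfl
    rw [← h1, Matrix.nonsing_inv_mul X hu, Matrix.one_apply]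
    simp [eq_comm]
  · intro β
    rw [hw, Finset.sum_apply]
    calc |∑ b : 𝒜, (X⁻¹ ⟨α, hα⟩ b • v b.1) β| ≤ ∑ b : 𝒜, |(X⁻¹ ⟨α, hα⟩ b • v b.1) β| :=
          Finset.abs_sum_le_sum_abs _ _
      _ ≤ ∑ b : 𝒜, |X⁻¹ ⟨α, hα⟩ b| * B := by
          apply Finset.sum_le_sum
          intro b _
          rw [Pi.smul_apply, smul_eq_mul, abs_mul]
          exact mul_le_mul_of_nonneg_left (hv2 b.1 b.2 β) (abs_nonneg _)
      _ = (∑ b : 𝒜, |X⁻¹ ⟨α, hα⟩ b|) * B := by rw [Finset.sum_mul]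
      _ ≤ _ := by
          apply mul_le_mul_of_nonneg_right _ (by linarith)
          linarith

end

end
end

section
open scoped BigOperators ContDiff

noncomputable section

section
variable {m n : ℕ}

/-- limits of bounded-level sequences -/
def InI (T : ℕ → ℝ → Set (MI m n → ℝ)) (v : MI m n → ℝ) : Prop :=
  ∃ B : ℝ, 1 ≤ B ∧ ∃ s : ℕ → MI m n → ℝ, (∀ᶠ k in (Filter.hyperfilter ℕ : Filter ℕ), s k ∈ T k B) ∧
    Filter.Tendsto s (Filter.hyperfilter ℕ : Filter ℕ) (nhds v)

lemma inI_comb {κ : ℝ → ℝ} {T : ℕ → ℝ → Set (MI m n → ℝ)} (hT : ∀ k, Fam κ (T k)) {A : ℝ}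
    (hA : 1 ≤ A) (h0 : ∀ k, 0 ∈ T k A) {v w : MI m n → ℝ} (hv : InI T v) (hw : InI T w) (a b : ℝ) :
    InI T (a • v + b • w) := by
  obtain ⟨B, hB, s, hs, hsl⟩ := hv
  obtain ⟨B', hB', s', hs', hsl'⟩ := hw
  set D := max (max B B') A with hD
  have hD1 : 1 ≤ D := hA.trans (le_max_right _ _)
  have hp : 1 ≤ 1 + |a| + |b| := by linarith [abs_nonneg a, abs_nonneg b]
  refine ⟨(1 + |a| + |b|) * D, by nlinarith, fun k => a • s k + b • s' k, ?_,
    (hsl.const_smul a).add (hsl'.const_smul b)⟩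
  filter_upwards [hs, hs'] with k hk hk'
  have h1 : s k ∈ T k D := (hT k).mono B D hB ((le_max_left _ _).trans (le_max_left _ _)) hk
  have h2 : s' k ∈ T k D := (hT k).mono B' D hB' ((le_max_right _ _).trans (le_max_left _ _)) hk'
  have h3 : 0 ∈ T k D := (hT k).mono A D hA (le_max_right _ _) (h0 k)
  have := (hT k).comb hD1 hp h3 (Finset.univ : Finset (Fin 2)) ![a, b] ![s k, s' k]
    (by intro i _; fin_cases i <;> simp [h1, h2]) (by simp [Fin.sum_univ_two])
  simpa [Fin.sum_univ_two] using this

lemma inI_X {κ : ℝ → ℝ} {T : ℕ → ℝ → Set (MI m n → ℝ)} (hT : ∀ k, Fam κ (T k))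
    {v : MI m n → ℝ} (hv : InI T v) (i : Fin n) : InI T (Xop i v) := by
  obtain ⟨B, hB, s, hs, hsl⟩ := hv
  have hc : Continuous (fun v : MI m n → ℝ => Xop i v) := by
    unfold Xop; fun_prop
  obtain ⟨D, hD⟩ : ∃ D : ℝ, ∀ β, |v β| < D := by
    refine ⟨∑ β, |v β| + 1, fun β => ?_⟩
    have := Finset.single_le_sum (f := fun β => |v β|) (fun _ _ => abs_nonneg _) (Finset.mem_univ β)
    linarith
  have hev : ∀ᶠ k in (Filter.hyperfilter ℕ : Filter ℕ), ∀ β, |s k β| < D := by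
    rw [Filter.eventually_all]
    intro β
    exact (((continuous_apply β).tendsto v).comp hsl).abs.eventually_lt_const (hD β)
  set D' := max B D
  have hD' : 1 ≤ D' := hB.trans (le_max_left _ _)
  refine ⟨κ D', (hT 0).kap _ hD', fun k => Xop i (s k), ?_, (hc.tendsto v).comp hsl⟩
  filter_upwards [hs, hev] with k h1 h2
  exact (hT k).mulX D' hD' _ ((hT k).mono B D' hB (le_max_left _ _) h1)
    (fun β => (h2 β).le.trans (le_max_right _ _)) i

lemma inI_bdd {T : ℕ → ℝ → Set (MI m n → ℝ)} {A B : ℝ} (hA : 1 ≤ A)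
    {s : ℕ → MI m n → ℝ} (hs : ∀ᶠ k in (Filter.hyperfilter ℕ : Filter ℕ), s k ∈ T k A)
    (hB : 0 ≤ B) (hb : ∀ᶠ k in (Filter.hyperfilter ℕ : Filter ℕ), ∀ β, |s k β| ≤ B) :
    ∃ v, InI T v ∧ Filter.Tendsto s (Filter.hyperfilter ℕ : Filter ℕ) (nhds v) := by
  have := (isCompact_closedBall (0 : MI m n → ℝ) B).ultrafilter_le_nhds
    ((Filter.hyperfilter ℕ).map s) (by
      rw [Filter.le_principal_iff, Ultrafilter.mem_coe, Ultrafilter.mem_map]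
      filter_upwards [hb] with k hk
      simp only [Set.mem_preimage, mem_closedBall_zero_iff]
      rw [pi_norm_le_iff_of_nonneg hB]
      exact hk)
  obtain ⟨v, _, hv⟩ := this
  exact ⟨v, ⟨A, hA, s, hs, hv⟩, hv⟩

/-- leading index -/
def IsLead (α : MI m n) (v : MI m n → ℝ) : Prop :=
  v α ≠ 0 ∧ ∀ β : MI m n, om m β.1 < om m α.1 → v β = 0

lemma exists_lead {v : MI m n → ℝ} (hv : v ≠ 0) : ∃ α, IsLead α v := by
  classical
  obtain ⟨β, hβ⟩ := Function.ne_iff.1 hv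
  obtain ⟨α, h1, h2⟩ := Finset.exists_min_image (Finset.univ.filter fun β => v β ≠ 0)
    (fun β => om m β.1) ⟨β, by simpa using hβ⟩
  refine ⟨α, by simpa using h1, fun γ hγ => ?_⟩
  by_contra h
  exact absurd (h2 γ (by simpa using h)) (not_le.2 hγ)

/-- leading indices of the limit ideal -/
def Lead (T : ℕ → ℝ → Set (MI m n → ℝ)) : Set (MI m n) := {α | ∃ v, InI T v ∧ IsLead α v}

lemma low_om {i : Fin n} {β : MI m n} (h : β.1 i ≠ 0) :
    om m (low i β).1 + om m (Pi.single i 1 : Fin n → ℕ) = om m β.1 := by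
  rw [← om_add]
  congr 1
  funext j
  by_cases h' : j = i
  · subst h'; simp [low]; omega
  · simp [low, h']

lemma low_deg {i : Fin n} {β : MI m n} (h : β.1 i ≠ 0) : deg (low i β).1 + 1 = deg β.1 := by
  rw [← deg_single i 1, ← deg_add]
  congr 1
  funext j
  by_cases h' : j = i
  · subst h'; simp [low]; omega
  · simp [low, h']

lemma upC_of_step {A : Set (MI m n)}
    (h : ∀ (i : Fin n) (β : MI m n), β.1 i ≠ 0 → low i β ∈ A → β ∈ A) : UpC A := by
  intro α hα β hle
  obtain ⟨d, hd⟩ : ∃ d, deg β.1 = deg α.1 + d :=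
    ⟨deg β.1 - deg α.1, by
      have : deg α.1 ≤ deg β.1 := Finset.sum_le_sum fun i _ => hle i
      omega⟩
  induction d generalizing β with
  | zero =>
    have : α = β := by
      apply Subtype.ext
      funext i
      have := (Finset.sum_eq_sum_iff_of_le (fun i _ => hle i)).1 (by simpa [deg] using hd.symm)
      exact this i (Finset.mem_univ _)
    exact this ▸ hα
  | succ d ih =>
    obtain ⟨i, hi⟩ : ∃ i, α.1 i < β.1 i := by
      by_contra hc
      push Not at hc
      have : deg β.1 ≤ deg α.1 := Finset.sum_le_sum fun i _ => hc i
      omega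
    have hb : β.1 i ≠ 0 := by omega
    apply h i β hb
    apply ih
    · intro j
      by_cases h' : j = i
      · subst h'; simp [low]; omega
      · simpa [low, h'] using hle j
    · have := low_deg hb; omega

lemma lead_upC {κ : ℝ → ℝ} {T : ℕ → ℝ → Set (MI m n → ℝ)} (hT : ∀ k, Fam κ (T k)) :
    UpC (Lead T) := by
  apply upC_of_step
  rintro i β hβ ⟨v, hv, h1, h2⟩
  refine ⟨Xop i v, inI_X hT hv i, ?_, fun γ hγ => ?_⟩
  · simp only [Xop]
    exact mul_ne_zero (by exact_mod_cast hβ) h1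
  · simp only [Xop]
    by_cases h0 : γ.1 i = 0
    · simp [h0]
    · rw [h2 (low i γ), mul_zero]
      have e1 := low_om h0
      have e2 := low_om hβ
      omega

lemma lead_basis {κ : ℝ → ℝ} {T : ℕ → ℝ → Set (MI m n → ℝ)} (hT : ∀ k, Fam κ (T k)) {A : ℝ}
    (hA : 1 ≤ A) (h0 : ∀ k, 0 ∈ T k A) (α : MI m n) (hα : α ∈ Lead T) :
    ∃ v, InI T v ∧ ∀ β ∈ Lead T, v β = if β = α then 1 else 0 := by
  classical
  let I : Submodule ℝ (MI m n → ℝ) :=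
    { carrier := {v | InI T v}
      add_mem' := fun {v w} hv hw => by
        have := inI_comb hT hA h0 hv hw 1 1
        simpa using this
      zero_mem' := ⟨A, hA, fun _ => 0, Filter.Eventually.of_forall h0, tendsto_const_nhds⟩
      smul_mem' := fun c v hv => by
        have := inI_comb hT hA h0 hv hv c 0
        simpa using this }
  let r : (MI m n → ℝ) →ₗ[ℝ] (Lead T → ℝ) :=
    { toFun := fun v β => v β.1, map_add' := fun _ _ => rfl, map_smul' := fun _ _ => rfl }
  have htop : I.map r = ⊤ := by
    by_contra hne
    obtain ⟨φ, hφ, hφ2⟩ := Submodule.exists_le_ker_of_lt_top _ (lt_top_iff_ne_top.2 hne)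
    have hφe : ∀ w : Lead T → ℝ, φ w = ∑ b, w b * φ (Pi.single b 1) := by
      intro w
      conv_lhs => rw [← Finset.univ_sum_single w]
      rw [map_sum]
      apply Finset.sum_congr rfl
      intro b _
      have : (Pi.single b (w b) : Lead T → ℝ) = w b • Pi.single b 1 := by
        rw [← Pi.single_smul]; simp
      rw [this, map_smul, smul_eq_mul]
    have hex : ∃ b : Lead T, φ (Pi.single b 1) ≠ 0 := by
      by_contra hc
      push Not at hc
      apply hφ
      apply LinearMap.ext
      intro w
      rw [hφe w]; simp [hc]
    obtain ⟨b0, hb0⟩ := hex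
    obtain ⟨b, hb1, hb2⟩ := Finset.exists_max_image
      (Finset.univ.filter fun b : Lead T => φ (Pi.single b 1) ≠ 0) (fun b => om m b.1.1)
      ⟨b0, by simpa using hb0⟩
    obtain ⟨v, hv, hl1, hl2⟩ := b.2
    have hz : φ (r v) = 0 := hφ2 (Submodule.mem_map_of_mem (show v ∈ I from hv))
    rw [hφe, Finset.sum_eq_single b] at hz
    · have : φ (Pi.single b 1) ≠ 0 := by simpa using hb1
      exact (mul_ne_zero hl1 this) hz
    · intro c _ hcb
      by_cases hc0 : φ (Pi.single c 1) = 0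
      · rw [hc0, mul_zero]
      · have hle := hb2 c (by simpa using hc0)
        have hlt : om m c.1.1 < om m b.1.1 :=
          lt_of_le_of_ne hle fun h => hcb (Subtype.ext (om_inj h))
        have : r v c = 0 := hl2 c.1 hlt
        rw [this, zero_mul]
    · simp
  have : (fun b : Lead T => if b.1 = α then (1:ℝ) else 0) ∈ I.map r := by rw [htop]; trivial
  obtain ⟨v, hv, hvr⟩ := this
  exact ⟨v, hv, fun β hβ => congrFun hvr ⟨β, hβ⟩⟩

/-- The relabelling lemma. -/
lemma relabel (κ : ℝ → ℝ) (𝒜 : Set (MI m n)) (strict : Prop) {A : ℝ} (hA : 1 ≤ A) :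
    ∃ A' : ℝ, 1 ≤ A' ∧ ∀ T : ℝ → Set (MI m n → ℝ), Fam κ T → 0 ∈ T A → ∀ w : MI m n → MI m n → ℝ,
    (∀ α ∈ 𝒜, w α ∈ T A) → (∀ α ∈ 𝒜, ∀ β ∈ 𝒜, w α β = if β = α then 1 else 0) →
    (∀ α ∈ 𝒜, ∀ β : MI m n, om m α.1 ≤ om m β.1 → |w α β| ≤ A) →
    (strict → ∃ u ∈ T A, (∀ β, |u β| ≤ 1) ∧ (∃ β, |u β| = 1) ∧ ∀ β ∈ 𝒜, u β = 0) →
    ∃ 𝒜' : Set (MI m n), UpC 𝒜' ∧ (𝒜' = 𝒜 ∨ prec 𝒜' 𝒜) ∧ (strict → prec 𝒜' 𝒜) ∧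
      FreeT 𝒜' T A' := by
  classical
  by_contra hcon
  push Not at hcon
  have hcon' := fun k : ℕ => hcon ((k : ℝ) + 1) (by linarith [Nat.cast_nonneg (α := ℝ) k])
  choose T hT h0 w hw1 hw2 hw3 hu hfail using hcon'
  set L : Filter ℕ := (Filter.hyperfilter ℕ : Filter ℕ) with hL
  set 𝒜' := Lead T with h𝒜'
  -- elements of the ideal with leading index not in the old set
  have key : ∀ α ∈ 𝒜, α ∉ 𝒜' → ∃ β ∈ 𝒜', β ∉ 𝒜 ∧ om m β.1 < om m α.1 := by
    intro α hα hα'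
    set N : ℕ → ℝ := fun k => 1 + ∑ β, |w k α β| with hN
    have hN1 : ∀ k, 1 ≤ N k := fun k => by
      have : 0 ≤ ∑ β, |w k α β| := Finset.sum_nonneg fun _ _ => abs_nonneg _
      simp only [hN]; linarith
    have hNb : ∀ k β, |w k α β| ≤ N k := fun k β => by
      have := Finset.single_le_sum (f := fun β => |w k α β|) (fun _ _ => abs_nonneg _)
        (Finset.mem_univ β)
      simp only [hN] at this ⊢; linarith
    set s : ℕ → MI m n → ℝ := fun k => (N k)⁻¹ • w k α with hs
    have hsT : ∀ k, s k ∈ T k A := by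
      intro k
      have := (hT k).comb_one hA (h0 k) (Finset.univ : Finset (Fin 1)) (fun _ => (N k)⁻¹)
        (fun _ => w k α) (fun _ _ => hw1 k α hα) (by
          have h1 := hN1 k
          have : 0 < N k := by linarith
          simp [abs_of_pos this, inv_le_one_of_one_le₀ h1])
      simpa using this
    have hsb : ∀ k β, |s k β| ≤ 1 := by
      intro k β
      have h1 := hN1 k
      have h2 : 0 < N k := by linarith
      simp only [hs, Pi.smul_apply, smul_eq_mul, abs_mul, abs_inv, abs_of_pos h2]
      rw [inv_mul_le_iff₀ h2]; simpa using hNb k β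
    obtain ⟨v, hv, hvl⟩ := inI_bdd hA (Filter.Eventually.of_forall hsT) zero_le_one
      (Filter.Eventually.of_forall hsb)
    have hvβ : ∀ β, Filter.Tendsto (fun k => s k β) L (nhds (v β)) := fun β =>
      ((continuous_apply β).tendsto v).comp hvl
    have hv𝒜 : ∀ β ∈ 𝒜, β ≠ α → v β = 0 := by
      intro β hβ hne
      have : (fun k => s k β) = fun _ => 0 := by
        funext k; simp [hs, hw2 k α hα β hβ, hne]
      have h2 := hvβ β
      rw [this] at h2
      exact (tendsto_nhds_unique h2 tendsto_const_nhds)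
    have hNlim : Filter.Tendsto (fun k => (N k)⁻¹) L (nhds (v α)) := by
      have : (fun k => s k α) = fun k => (N k)⁻¹ := by
        funext k; simp [hs, hw2 k α hα α hα]
      rw [← this]; exact hvβ α
    have hvne : v ≠ 0 := by
      intro hv0
      -- the sum of absolute values of `s` tends to one when `N` is unbounded
      have h1 : Filter.Tendsto (fun k => (N k)⁻¹ + ∑ β, |s k β|) L (nhds (v α + ∑ β, |v β|)) :=
        hNlim.add (tendsto_finsetSum _ fun β _ => (hvβ β).abs)
      have h2 : (fun k => (N k)⁻¹ + ∑ β, |s k β|) = fun _ => 1 := by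
        funext k
        have h1 := hN1 k
        have h2 : 0 < N k := by linarith
        have : ∑ β, |s k β| = (N k)⁻¹ * ∑ β, |w k α β| := by
          rw [Finset.mul_sum]
          apply Finset.sum_congr rfl
          intro β _
          simp [hs, abs_mul, abs_of_pos h2]
        rw [this]
        have h3 : N k = 1 + ∑ β, |w k α β| := rfl
        rw [show (N k)⁻¹ + (N k)⁻¹ * ∑ β, |w k α β| = (N k)⁻¹ * N k by rw [h3]; ring]
        exact inv_mul_cancel₀ h2.ne'
      rw [h2] at h1
      have h3 := tendsto_nhds_unique h1 tendsto_const_nhds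
      rw [hv0] at h3
      simp at h3
    obtain ⟨β, hβ⟩ := exists_lead hvne
    have hβ' : β ∈ 𝒜' := ⟨v, hv, hβ⟩
    have hne : β ≠ α := fun h => hα' (h ▸ hβ')
    refine ⟨β, hβ', fun hβ𝒜 => hβ.1 (hv𝒜 β hβ𝒜 hne), ?_⟩
    by_contra hle
    push Not at hle
    -- the entry at `β` is bounded by `A / N`, hence `v α ≠ 0`, hence leading index is below
    have h1 : |v β| ≤ v α * A := by
      apply le_of_tendsto_of_tendsto (hvβ β).abs (hNlim.mul_const A)
      apply Filter.Eventually.of_forall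
      intro k
      have h2 : 0 < N k := by linarith [hN1 k]
      simp only [hs, Pi.smul_apply, smul_eq_mul, abs_mul, abs_inv, abs_of_pos h2]
      exact mul_le_mul_of_nonneg_left (hw3 k α hα β hle) (by positivity)
    have h2 : v α = 0 := hβ.2 α (lt_of_le_of_ne hle fun h => hne (om_inj h.symm))
    rw [h2, zero_mul] at h1
    exact hβ.1 (abs_nonpos_iff.1 h1)
  have hor : 𝒜' = 𝒜 ∨ prec 𝒜' 𝒜 := by
    by_cases heq : 𝒜' = 𝒜
    · exact Or.inl heq
    right
    have hex : ∃ α : MI m n, ¬ (α ∈ 𝒜 ↔ α ∈ 𝒜') := by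
      by_contra hc
      push Not at hc
      exact heq (Set.ext fun α => (hc α).symm)
    obtain ⟨α0, hα0⟩ := hex
    obtain ⟨α, h1, h2⟩ := Finset.exists_min_image
      (Finset.univ.filter fun α : MI m n => ¬ (α ∈ 𝒜 ↔ α ∈ 𝒜')) (fun α => om m α.1)
      ⟨α0, by simpa using hα0⟩
    have h1' : ¬ (α ∈ 𝒜 ↔ α ∈ 𝒜') := (Finset.mem_filter.1 h1).2
    have hmin : ∀ β : MI m n, om m β.1 < om m α.1 → (β ∈ 𝒜 ↔ β ∈ 𝒜') := by
      intro β hβ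
      by_contra hc
      exact absurd (h2 β (Finset.mem_filter.2 ⟨Finset.mem_univ _, hc⟩)) (not_le.2 hβ)
    by_cases hα : α ∈ 𝒜
    · have hα' : α ∉ 𝒜' := fun h => h1' ⟨fun _ => h, fun _ => hα⟩
      obtain ⟨β, b1, b2, b3⟩ := key α hα hα'
      exact absurd ((hmin β b3).2 b1) b2
    · have hα' : α ∈ 𝒜' := by
        by_contra h
        exact h1' ⟨fun h' => absurd h' hα, fun h' => absurd h' h⟩
      exact ⟨α, hα', hα, hmin⟩
  have hstrict : strict → prec 𝒜' 𝒜 := by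
    intro hst
    rcases hor with h | h
    swap
    · exact h
    exfalso
    choose u hu1 hu2 hu3 hu4 using fun k => hu k hst
    obtain ⟨v, hv, hvl⟩ := inI_bdd hA (Filter.Eventually.of_forall hu1) zero_le_one
      (Filter.Eventually.of_forall hu2)
    have hvβ : ∀ β, Filter.Tendsto (fun k => u k β) L (nhds (v β)) := fun β =>
      ((continuous_apply β).tendsto v).comp hvl
    have hv0 : ∀ β ∈ 𝒜, v β = 0 := by
      intro β hβ
      have h2 := hvβ β
      have : (fun k => u k β) = fun _ => 0 := by funext k; exact hu4 k β hβ
      rw [this] at h2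
      exact tendsto_nhds_unique h2 tendsto_const_nhds
    have hvne : v ≠ 0 := by
      intro h0'
      have h1 : Filter.Tendsto (fun k => ∑ β, |u k β|) L (nhds (∑ β, |v β|)) :=
        tendsto_finsetSum _ fun β _ => (hvβ β).abs
      have h2 : (1:ℝ) ≤ ∑ β, |v β| := by
        apply ge_of_tendsto h1
        apply Filter.Eventually.of_forall
        intro k
        obtain ⟨β, hβ⟩ := hu3 k
        rw [← hβ]
        exact Finset.single_le_sum (f := fun β => |u k β|) (fun _ _ => abs_nonneg _)
          (Finset.mem_univ β)
      rw [h0'] at h2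
      simp at h2
      linarith
    obtain ⟨β, hβ⟩ := exists_lead hvne
    have hβ' : β ∈ 𝒜' := ⟨v, hv, hβ⟩
    rw [h] at hβ'
    exact hβ.1 (hv0 β hβ')
  obtain ⟨ε, hε, hnorm⟩ := fam_normalize 𝒜'
  have hb := fun α (hα : α ∈ 𝒜') => lead_basis hT hA h0 α hα
  have : ∀ α : MI m n, ∃ v, InI T v ∧ (α ∈ 𝒜' → ∀ β ∈ 𝒜', v β = if β = α then 1 else 0) := by
    intro α
    by_cases hα : α ∈ 𝒜'
    · obtain ⟨v, h1, h2⟩ := hb α hα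
      exact ⟨v, h1, fun _ => h2⟩
    · exact ⟨0, ⟨A, hA, fun _ => 0, Filter.Eventually.of_forall h0, tendsto_const_nhds⟩,
        fun h => absurd h hα⟩
  choose b hbI hb1 using this
  choose B hB1 s hsT hsl using hbI
  obtain ⟨D, hD⟩ : ∃ D : ℝ, ∀ α β, |b α β| < D := by
    refine ⟨∑ α, ∑ β, |b α β| + 1, fun α β => ?_⟩
    have h1 := Finset.single_le_sum (f := fun β => |b α β|) (fun _ _ => abs_nonneg _) (Finset.mem_univ β)
    have h2 := Finset.single_le_sum (f := fun α => ∑ β, |b α β|)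
      (fun _ _ => Finset.sum_nonneg fun _ _ => abs_nonneg _) (Finset.mem_univ α)
    linarith
  set Bm := ∑ α, B α + A + |D| with hBm
  have hBmA : A ≤ Bm := by
    have : 0 ≤ ∑ α, B α := Finset.sum_nonneg fun α _ => by linarith [hB1 α]
    rw [hBm]; linarith [abs_nonneg D]
  have hBmB : ∀ α, B α ≤ Bm := fun α => by
    have := Finset.single_le_sum (f := B) (fun α _ => by linarith [hB1 α]) (Finset.mem_univ α)
    rw [hBm]; linarith [abs_nonneg D]
  have hBmD : D ≤ Bm := by
    have : 0 ≤ ∑ α, B α := Finset.sum_nonneg fun α _ => by linarith [hB1 α]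
    rw [hBm]; linarith [le_abs_self D]
  have hBm1 : 1 ≤ Bm := hA.trans hBmA
  have e1 : ∀ᶠ k in L, ∀ α, s α k ∈ T k (B α) := by
    rw [Filter.eventually_all]; exact fun α => hsT α
  have hsβ : ∀ α β, Filter.Tendsto (fun k => s α k β) L (nhds (b α β)) := fun α β =>
    ((continuous_apply β).tendsto _).comp (hsl α)
  have e2 : ∀ᶠ k in L, ∀ α β, |s α k β| < D := by
    rw [Filter.eventually_all]; intro α
    rw [Filter.eventually_all]; intro β
    exact (hsβ α β).abs.eventually_lt_const (hD α β)
  have e3 : ∀ᶠ k in L, ∀ α β, |s α k β - b α β| < ε := by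
    rw [Filter.eventually_all]; intro α
    rw [Filter.eventually_all]; intro β
    have := ((hsβ α β).sub_const (b α β)).abs
    simp only [sub_self, abs_zero] at this
    exact this.eventually_lt_const hε
  have e4 : ∀ᶠ k : ℕ in L, (2 * Fintype.card (MI m n) + 1) * Bm ≤ (k : ℝ) + 1 := by
    have h1 : Filter.Tendsto (fun k : ℕ => (k : ℝ) + 1) Filter.atTop Filter.atTop :=
      Filter.tendsto_atTop_add_const_right _ _ tendsto_natCast_atTop_atTop
    have h2 : L ≤ Filter.atTop := by
      rw [← Nat.cofinite_eq_atTop]; exact Filter.hyperfilter_le_cofinite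
    exact (h1.mono_left h2).eventually_ge_atTop _
  obtain ⟨k, k1, k2, k3, k4⟩ := (e1.and (e2.and (e3.and e4))).exists
  have hfree := hnorm κ (T k) (hT k) Bm hBm1 ((hT k).mono A Bm hA hBmA (h0 k)) (fun α => s α k)
    (fun α _ => (hT k).mono _ _ (hB1 α) (hBmB α) (k1 α))
    (fun α _ β => (k2 α β).le.trans hBmD)
    (fun α hα β hβ => by rw [← hb1 α hα β hβ]; exact (k3 α β).le)
  refine hfail k 𝒜' (lead_upC hT) hor hstrict (hfree.mono (hT k) ?_ k4)
  have : (0:ℝ) ≤ Fintype.card (MI m n) := by positivity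
  nlinarith

end

end
end

section
open scoped BigOperators ContDiff

noncomputable section

section
variable {n m : ℕ} {E : Set (Euc n)} {f : Euc n → ℝ}

lemma dn_one_pos {j : ℕ} (hj : 1 ≤ j) (y : Euc n) : dn j (1 : Euc n → ℝ) y = 0 :=
  Pol.dn (pol_mono hj pol_one) y

lemma dn_lin_one (x : Euc n) (i : Fin n) (y : Euc n) : dn 1 (lin x i) y ≤ 1 := by
  unfold dn
  rw [norm_iteratedFDeriv_one, (lin_hasFDerivAt x i y).fderiv]
  refine ContinuousLinearMap.opNorm_le_bound _ zero_le_one fun v => ?_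
  rw [one_mul]
  exact PiLp.norm_apply_le v i

lemma dn_lin_two (x : Euc n) (i : Fin n) {j : ℕ} (hj : 2 ≤ j) (y : Euc n) : dn j (lin x i) y = 0 := by
  have h : lin x i * 1 ∈ Pol 2 n := pol_lin_mul pol_one x i
  rw [mul_one] at h
  exact Pol.dn (pol_mono hj h) y

lemma cut_lin (x : Euc n) (i : Fin n) {δ s : ℝ} (hδ : 0 < δ) (hs : |s| = δ⁻¹) :
    Cut m ((1/2 : ℝ) • (1 + s • lin x i)) x δ 1 := by
  intro y hy
  have h1 : |lin x i y| ≤ δ := (PiLp.norm_apply_le (y - x) i).trans hy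
  have h2 : |s * lin x i y| ≤ 1 := by
    rw [abs_mul, hs]
    calc δ⁻¹ * |lin x i y| ≤ δ⁻¹ * δ := by gcongr
      _ = 1 := inv_mul_cancel₀ hδ.ne'
  have h3 := abs_le.1 h2
  have e : ((1/2 : ℝ) • (1 + s • lin x i)) y = (1 + s * lin x i y) / 2 := by
    simp only [Pi.smul_apply, Pi.add_apply, Pi.one_apply, smul_eq_mul]; ring
  have S1 : Sm (1 : Euc n → ℝ) := pol_one.1
  have S2 : Sm (s • lin x i) := (Sm.lin x i).smul' s
  have a0 : 0 ≤ ((1/2 : ℝ) • (1 + s • lin x i)) y := by rw [e]; linarith [h3.1]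
  have a1 : ((1/2 : ℝ) • (1 + s • lin x i)) y ≤ 1 := by rw [e]; linarith [h3.2]
  refine ⟨a0, a1, fun j _ => ?_⟩
  rcases Nat.lt_or_ge j 1 with h | h
  · obtain rfl : j = 0 := by omega
    rw [dn_zero, abs_of_nonneg a0]; simpa using a1
  have k : dn j ((1/2 : ℝ) • (1 + s • lin x i)) y ≤ 1/2 * (0 + δ⁻¹ * dn j (lin x i) y) := by
    rw [dn_smul (S1.add' S2)]
    have := dn_add_le S1 S2 j y
    rw [dn_one_pos h, dn_smul (Sm.lin x i), hs] at this
    rw [abs_of_pos (by norm_num : (0:ℝ) < 1/2)]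
    gcongr
  refine k.trans ?_
  rcases Nat.lt_or_ge j 2 with h' | h'
  · obtain rfl : j = 1 := by omega
    have := dn_lin_one x i y
    have h5 : δ⁻¹ * dn 1 (lin x i) y ≤ δ⁻¹ * 1 := by gcongr
    rw [pow_one, one_div δ]
    have : 0 < δ⁻¹ := by positivity
    linarith
  · rw [dn_lin_two x i h' y]; simp; positivity

/-- multiplication by a coordinate -/
lemma mult_coord (hm : 1 ≤ m) (l : ℕ) : ∃ C : ℝ, 1 ≤ C ∧
    ∀ (E : Set (Euc n)) (f : Euc n → ℝ) (N δ : ℝ), 0 ≤ N → 0 < δ → ∀ (x : Euc n)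
    (P R : Euc n → ℝ) (i : Fin n) (s : ℝ), |s| = δ⁻¹ → R ∈ Pol m n →
    P + R ∈ Gam m E f l x N → P - R ∈ Gam m E f l x N → At m R x δ N →
    P + s • jet m x (lin x i * R) ∈ Gam m E f l x (C * N) := by
  obtain ⟨C, hC, H⟩ := mult_lemma (n := n) hm l (le_refl (1:ℝ))
  refine ⟨C * 2, by linarith, ?_⟩
  intro E f N δ hN hδ x P R i s hs hR h1 h2 hA
  have hP : P ∈ Pol m n := by
    have := Submodule.add_mem _ (Gam_pol h2) hR
    simpa using this
  have S1 : Sm (1 : Euc n → ℝ) := pol_one.1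
  have S2 : Sm (s • lin x i) := (Sm.lin x i).smul' s
  have key := H E f (2 * N) δ (by linarith) hδ x ((1/2 : ℝ) • (1 + s • lin x i))
    (P + s • jet m x (lin x i * R)) (P + R) (P - R) (Gam_mono (by linarith) h1)
    (Gam_mono (by linarith) h2) ?_ ((S1.add' S2).smul' _) (cut_lin x i hδ hs)
    (Submodule.add_mem _ hP (Submodule.smul_mem _ _ (jet_mem _ _))) ?_
  · rwa [mul_assoc]
  · have e : P + R - (P - R) = (2:ℝ) • R := by rw [two_smul]; abel
    rw [e]
    have := hA.smul hR.1 2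
    rwa [abs_of_pos (by norm_num : (0:ℝ) < 2)] at this
  · intro j hj
    have e : P + s • jet m x (lin x i * R) - (P - R + (1/2 : ℝ) • (1 + s • lin x i) * (P + R - (P - R)))
        = s • (jet m x (lin x i * R) - lin x i * R) := by
      funext y
      simp only [Pi.smul_apply, Pi.add_apply, Pi.sub_apply, Pi.mul_apply, Pi.one_apply, smul_eq_mul]
      ring
    have SR : Sm (lin x i * R) := (Sm.lin x i).mul' hR.1
    rw [e, dn_smul ((jet_mem x _).1.sub' SR), jet_dn x SR j hj, mul_zero]

lemma Gam_conv {l : ℕ} {x : Euc n} {N a b : ℝ} {P Q R : Euc n → ℝ} (ha : 0 ≤ a) (hb : 0 ≤ b)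
    (hab : a + b = 1) (h : P ∈ Gam m E f l x N) (h' : Q ∈ Gam m E f l x N) (e : R = a • P + b • Q) :
    R ∈ Gam m E f l x N := by
  have := Gam_convex ha hb hab h h'
  rw [← add_mul, hab, one_mul] at this
  rwa [e]

lemma Gam_shrink {l : ℕ} {x : Euc n} {N s : ℝ} {P X : Euc n → ℝ} (hs : |s| ≤ 1)
    (h : P + X ∈ Gam m E f l x N) (h' : P - X ∈ Gam m E f l x N) : P + s • X ∈ Gam m E f l x N := by
  have hs' := abs_le.1 hs
  refine Gam_conv (a := (1 + s)/2) (b := (1 - s)/2) (by linarith) (by linarith) (by ring) h h' ?_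
  module

/-- directions in which `P` can be moved -/
def TT {n : ℕ} (m : ℕ) (E : Set (Euc n)) (f : Euc n → ℝ) (l : ℕ) (x : Euc n) (δ M : ℝ)
    (P : Euc n → ℝ) (A : ℝ) : Set (MI m n → ℝ) :=
  {v | P + (M / A) • pl x δ v ∈ Gam m E f l x (A * M) ∧ P - (M / A) • pl x δ v ∈ Gam m E f l x (A * M)}

lemma TT_zero {l : ℕ} {x : Euc n} {δ M A : ℝ} {P : Euc n → ℝ} :
    0 ∈ TT m E f l x δ M P A ↔ P ∈ Gam m E f l x (A * M) := by
  simp [TT]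

lemma TT_base {l : ℕ} {x : Euc n} {δ M A : ℝ} {P : Euc n → ℝ} {v : MI m n → ℝ}
    (h : v ∈ TT m E f l x δ M P A) : P ∈ Gam m E f l x (A * M) := by
  simpa using Gam_shrink (s := 0) (by simp) h.1 h.2

lemma TT_of {l : ℕ} {x : Euc n} {δ M A s : ℝ} {P : Euc n → ℝ} {v : MI m n → ℝ} (X : Euc n → ℝ)
    (h1 : P + X ∈ Gam m E f l x (A * M)) (h2 : P - X ∈ Gam m E f l x (A * M)) (hs : |s| ≤ 1)
    (e : (M / A) • pl x δ v = s • X) : v ∈ TT m E f l x δ M P A := by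
  constructor
  · rw [e]; exact Gam_shrink hs h1 h2
  · rw [e, sub_eq_add_neg, ← neg_smul]; exact Gam_shrink (by rwa [abs_neg]) h1 h2

lemma jet_pl_X (x : Euc n) {δ : ℝ} (hδ : 0 < δ) (c : ℝ) (v : MI m n → ℝ) (i : Fin n) :
    δ⁻¹ • jet m x (lin x i * (c • pl x δ v)) = c • pl x δ (Xop i v) := by
  have S : Sm (pl x δ v) := (pl_mem x δ v).1
  refine pol_ext_mD (x := x) (Submodule.smul_mem _ _ (jet_mem _ _)) (Submodule.smul_mem _ _ (pl_mem _ _ _)) ?_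
  intro β
  rw [mD_smul (jet_mem x _).1, mD_smul (pl_mem x δ _).1]
  simp only [Pi.smul_apply, smul_eq_mul, jet_mD, pl_mD]
  rw [mD_lin_mul (S.smul' c), mD_smul S]
  simp only [Pi.smul_apply, smul_eq_mul, Xop]
  by_cases h : β.1 i = 0
  · simp [h]
  · have := pl_mD x δ v (low i β)
    have e : (low i β).1 = β.1 - Pi.single i 1 := rfl
    rw [← e, this]
    have hd := low_deg h
    have hl := (low i β).2
    have hb := β.2
    have e2 : m - deg (low i β).1 = m - deg β.1 + 1 := by omega
    rw [e2, pow_succ]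
    field_simp

lemma TT_fam (hm : 1 ≤ m) (hn : 1 ≤ n) (l : ℕ) : ∃ κ : ℝ → ℝ,
    ∀ (E : Set (Euc n)) (f : Euc n → ℝ) (M δ : ℝ), 0 < M → 0 < δ → ∀ (x : Euc n) (P : Euc n → ℝ),
    Fam κ (TT m E f l x δ M P) := by
  obtain ⟨C, hC, H⟩ := mult_coord (n := n) hm l
  refine ⟨fun A => C * (A + n ^ m), ?_⟩
  intro E f M δ hM hδ x P
  have hnm : (0:ℝ) ≤ (n:ℝ) ^ m := by positivity
  refine ⟨?_, ?_, ?_, ?_, ?_, ?_⟩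
  · intro A hA; nlinarith
  · intro A A' hA hAA v hv
    refine TT_of (s := A / A') ((M / A) • pl x δ v) (Gam_mono (by gcongr) hv.1)
      (Gam_mono (by gcongr) hv.2) ?_ ?_
    · rw [abs_of_nonneg (by apply div_nonneg <;> linarith)]; exact (div_le_one (by linarith)).2 hAA
    · rw [smul_smul]; congr 1
      field_simp
  · intro A hA v hv w hw a b ha hb hab
    constructor
    · refine Gam_conv ha hb hab hv.1 hw.1 ?_
      rw [map_add, map_smul, map_smul]
      obtain rfl : b = 1 - a := by linarith
      module
    · refine Gam_conv ha hb hab hv.2 hw.2 ?_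
      rw [map_add, map_smul, map_smul]
      obtain rfl : b = 1 - a := by linarith
      module
  · intro A hA v hv
    refine ⟨?_, ?_⟩
    · rw [map_neg, smul_neg, ← sub_eq_add_neg]; exact hv.2
    · rw [map_neg, smul_neg, sub_neg_eq_add]; exact hv.1
  · intro A t hA ht v hv
    have hle : A * M ≤ t * A * M := by
      have : A ≤ t * A := by nlinarith
      gcongr
    refine TT_of (s := 1) ((M / A) • pl x δ v) (Gam_mono hle hv.1) (Gam_mono hle hv.2) (by simp) ?_
    rw [map_smul, smul_smul, one_smul]; congr 1
    field_simp
  · intro A hA v hv hvA i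
    set N := (A + n ^ m) * M with hN
    have hN0 : 0 ≤ N := by positivity
    have hAN : A * M ≤ N := by rw [hN]; nlinarith
    have hR : (M / A) • pl x δ v ∈ Pol m n := Submodule.smul_mem _ _ (pl_mem _ _ _)
    have hAt : At m ((M / A) • pl x δ v) x δ N := by
      have := (At_pl hn x hδ (by linarith) hvA).smul (pl_mem x δ v).1 (M / A)
      refine this.mono_N hδ.le ?_
      rw [abs_of_pos (by positivity)]
      have : M / A * (n ^ m * A) = n ^ m * M := by field_simp
      rw [this, hN]; nlinarith
    have hs : |δ⁻¹| = δ⁻¹ := abs_of_pos (by positivity)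
    have hs' : |-δ⁻¹| = δ⁻¹ := by rw [abs_neg, hs]
    have k1 := H E f N δ hN0 hδ x P _ i _ hs hR (Gam_mono hAN hv.1) (Gam_mono hAN hv.2) hAt
    have k2 := H E f N δ hN0 hδ x P _ i _ hs' hR (Gam_mono hAN hv.1) (Gam_mono hAN hv.2) hAt
    rw [neg_smul, ← sub_eq_add_neg] at k2
    rw [jet_pl_X x hδ] at k1 k2
    have e : C * N = C * (A + n ^ m) * M := by rw [hN]; ring
    rw [e] at k1 k2
    have hk : A ≤ C * (A + n ^ m) := by nlinarith
    refine TT_of (s := A / (C * (A + n ^ m))) _ k1 k2 ?_ ?_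
    · rw [abs_of_nonneg (by positivity)]; exact (div_le_one (by positivity)).2 hk
    · rw [smul_smul]; congr 1
      have : (A + (n:ℝ) ^ m) ≠ 0 := by positivity
      field_simp

/-- the basic nondegeneracy condition -/
def Free {n m : ℕ} (E : Set (Euc n)) (f : Euc n → ℝ) (𝒜 : Set (MI m n)) (x : Euc n) (P : Euc n → ℝ)
    (l : ℕ) (δ M A : ℝ) : Prop :=
  P ∈ Gam m E f l x (A * M) ∧ FreeT 𝒜 (TT m E f l x δ M P) A

lemma TT_le {l l' : ℕ} (hl : l' ≤ l) {x : Euc n} {δ M A : ℝ} {P : Euc n → ℝ} {v : MI m n → ℝ}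
    (h : v ∈ TT m E f l x δ M P A) : v ∈ TT m E f l' x δ M P A :=
  ⟨Gam_le hl h.1, Gam_le hl h.2⟩

lemma Free.le {𝒜 : Set (MI m n)} {l l' : ℕ} (hl : l' ≤ l) {x : Euc n} {δ M A : ℝ} {P : Euc n → ℝ}
    (h : Free E f 𝒜 x P l δ M A) : Free E f 𝒜 x P l' δ M A := by
  refine ⟨Gam_le hl h.1, fun α hα => ?_⟩
  obtain ⟨v, h1, h2⟩ := h.2 α hα
  exact ⟨v, TT_le hl h1, h2⟩

lemma Free.mono (hm : 1 ≤ m) (hn : 1 ≤ n) {𝒜 : Set (MI m n)} {l : ℕ} {x : Euc n} {δ M A A' : ℝ}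
    (hM : 0 < M) (hδ : 0 < δ) (hA : 1 ≤ A) (hAA : A ≤ A') {P : Euc n → ℝ}
    (h : Free E f 𝒜 x P l δ M A) : Free E f 𝒜 x P l δ M A' := by
  obtain ⟨κ, hκ⟩ := TT_fam (n := n) hm hn l
  exact ⟨Gam_mono (by gcongr) h.1, FreeT.mono (hκ E f M δ hM hδ x P) hA hAA h.2⟩

lemma pl_scale (x : Euc n) {δ r : ℝ} (hr : 0 < r) (v : MI m n → ℝ) :
    pl x δ v = pl x r (fun β => (δ / r) ^ (m - deg β.1) * v β) := by
  refine pol_ext_mD (x := x) (pl_mem _ _ _) (pl_mem _ _ _) fun β => ?_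
  rw [pl_mD, pl_mD, div_pow]
  have : r ^ (m - deg β.1) ≠ 0 := by positivity
  field_simp

/-- passing to a smaller scale, raw version -/
lemma TT_rescale {l : ℕ} {x : Euc n} {δ r M A : ℝ} (hr : 0 < r) (hrδ : r ≤ δ)
    {P : Euc n → ℝ} {v : MI m n → ℝ} (α : MI m n) (h : v ∈ TT m E f l x δ M P A) :
    (fun β => ((δ / r) ^ (m - deg α.1))⁻¹ * ((δ / r) ^ (m - deg β.1) * v β)) ∈ TT m E f l x r M P A := by
  have ht : 1 ≤ δ / r := (one_le_div hr).2 hrδ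
  have ht' : 1 ≤ (δ / r) ^ (m - deg α.1) := one_le_pow₀ ht
  refine TT_of (s := ((δ / r) ^ (m - deg α.1))⁻¹) _ h.1 h.2 ?_ ?_
  · rw [abs_of_nonneg (by positivity)]; exact inv_le_one_of_one_le₀ ht'
  · have e : (fun β : MI m n => ((δ / r) ^ (m - deg α.1))⁻¹ * ((δ / r) ^ (m - deg β.1) * v β))
        = ((δ / r) ^ (m - deg α.1))⁻¹ • (fun β : MI m n => (δ / r) ^ (m - deg β.1) * v β) := rfl
    rw [e, map_smul, ← pl_scale x hr, smul_comm]

lemma rescale_bd {δ r A : ℝ} (hr : 0 < r) (hrδ : r ≤ δ) {v : MI m n → ℝ} {α β : MI m n}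
    (hv : |v β| ≤ A) (h : om m α.1 ≤ om m β.1) :
    |((δ / r) ^ (m - deg α.1))⁻¹ * ((δ / r) ^ (m - deg β.1) * v β)| ≤ A := by
  have ht : 1 ≤ δ / r := (one_le_div hr).2 hrδ
  have hd := om_deg h
  have h1 : (δ / r) ^ (m - deg β.1) ≤ (δ / r) ^ (m - deg α.1) := pow_le_pow_right₀ ht (by omega)
  have hp : 0 < (δ / r) ^ (m - deg α.1) := by positivity
  rw [abs_mul, abs_mul, abs_of_pos (inv_pos.2 hp), abs_of_pos (show 0 < (δ / r) ^ (m - deg β.1) by positivity)]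
  rw [inv_mul_le_iff₀ hp]
  exact mul_le_mul h1 hv (abs_nonneg _) hp.le

lemma rescale_eq {δ r : ℝ} (hr : 0 < r) (hrδ : r ≤ δ) {v : MI m n → ℝ} {α β : MI m n}
    (hv : v β = if β = α then 1 else 0) :
    ((δ / r) ^ (m - deg α.1))⁻¹ * ((δ / r) ^ (m - deg β.1) * v β) = if β = α then 1 else 0 := by
  have ht : 0 < δ / r := by have : 0 < δ := by linarith
                            positivity
  rw [hv]
  split_ifs with h
  · subst h
    rw [mul_one, inv_mul_cancel₀ (by positivity)]
  · simp

/-- passing to a smaller scale -/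
lemma free_relabel (hm : 1 ≤ m) (hn : 1 ≤ n) (l : ℕ) (𝒜 : Set (MI m n)) {A : ℝ} (hA : 1 ≤ A) :
    ∃ A' : ℝ, 1 ≤ A' ∧ ∀ (E : Set (Euc n)) (f : Euc n → ℝ) (M δ r : ℝ), 0 < M → 0 < r → r ≤ δ →
    ∀ (x : Euc n) (P : Euc n → ℝ), Free E f 𝒜 x P l δ M A →
    ∃ 𝒜' : Set (MI m n), UpC 𝒜' ∧ (𝒜' = 𝒜 ∨ prec 𝒜' 𝒜) ∧ Free E f 𝒜' x P l r M A' := by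
  obtain ⟨κ, hκ⟩ := TT_fam (n := n) hm hn l
  obtain ⟨A', hA', H⟩ := relabel κ 𝒜 False hA
  refine ⟨max A' A, le_max_of_le_left hA', ?_⟩
  intro E f M δ r hM hr hrδ x P hF
  have hfam := hκ E f M r hM hr x P
  choose! v hv using hF.2
  obtain ⟨𝒜', h1, h2, -, h3⟩ := H (TT m E f l x r M P) hfam (TT_zero.2 hF.1)
    (fun α β => ((δ / r) ^ (m - deg α.1))⁻¹ * ((δ / r) ^ (m - deg β.1) * v α β))
    (fun α hα => TT_rescale hr hrδ α (hv α hα).1)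
    (fun α hα β hβ => rescale_eq hr hrδ ((hv α hα).2.1 β hβ))
    (fun α hα β hab => rescale_bd hr hrδ ((hv α hα).2.2 β) hab)
    (fun h => h.elim)
  refine ⟨𝒜', h1, h2, Gam_mono (by gcongr; exact le_max_right _ _) hF.1,
    FreeT.mono hfam hA' (le_max_left _ _) h3⟩

end
end
end

section
open scoped BigOperators ContDiff

noncomputable section

section
variable {n m : ℕ} {E : Set (Euc n)} {f : Euc n → ℝ}

/-- compatible families of jets on `S` -/
def Compat {n : ℕ} (m : ℕ) (f : Euc n → ℝ) (M : ℝ) (S : Finset (Euc n)) (Q : Euc n → Euc n → ℝ) : Prop :=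
  (∀ y ∈ S, Q y ∈ Gam m ∅ f 0 y M ∧ At m (Q y) y 1 M) ∧
  ∀ y ∈ S, ∀ y' ∈ S, At m (Q y - Q y') y ‖y - y'‖ M

lemma At.conv {F G H : Euc n → ℝ} {x : Euc n} {r N a b : ℝ} (hF : Sm F) (hG : Sm G)
    (h : At m F x r N) (h' : At m G x r N) (ha : 0 ≤ a) (hb : 0 ≤ b) (hab : a + b = 1)
    (e : H = a • F + b • G) : At m H x r N := by
  have := At.add (hF.smul' a) (hG.smul' b) (h.smul hF a) (h'.smul hG b)
  rw [abs_of_nonneg ha, abs_of_nonneg hb, ← add_mul, hab, one_mul] at this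
  rwa [e]

lemma Compat.conv {M a b : ℝ} {S : Finset (Euc n)} {Q Q' : Euc n → Euc n → ℝ}
    (h : Compat m f M S Q) (h' : Compat m f M S Q') (ha : 0 ≤ a) (hb : 0 ≤ b) (hab : a + b = 1) :
    Compat m f M S (a • Q + b • Q') := by
  refine ⟨fun y hy => ⟨?_, ?_⟩, fun y hy y' hy' => ?_⟩
  · exact Gam_conv ha hb hab (h.1 y hy).1 (h'.1 y hy).1 rfl
  · exact At.conv (Gam_sm (h.1 y hy).1) (Gam_sm (h'.1 y hy).1) (h.1 y hy).2 (h'.1 y hy).2 ha hb hab rfl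
  · refine At.conv ((Gam_sm (h.1 y hy).1).sub' (Gam_sm (h.1 y' hy').1))
      ((Gam_sm (h'.1 y hy).1).sub' (Gam_sm (h'.1 y' hy').1)) (h.2 y hy y' hy') (h'.2 y hy y' hy') ha hb hab ?_
    simp only [Pi.add_apply, Pi.smul_apply]
    module

lemma Compat.mono {M : ℝ} {S S' : Finset (Euc n)} {Q : Euc n → Euc n → ℝ} (hS : S ⊆ S')
    (h : Compat m f M S' Q) : Compat m f M S Q :=
  ⟨fun y hy => h.1 y (hS hy), fun y hy y' hy' => h.2 y (hS hy) y' (hS hy')⟩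

lemma helly_gen (E : Finset (Euc n)) (k : ℕ) (K : Finset (Euc n) → Set (Pol m n))
    (hc : ∀ S, Convex ℝ (K S)) (hK : ∀ S S', S ⊆ S' → K S' ⊆ K S)
    (hne : ∀ S ⊆ E, S.card ≤ (Module.finrank ℝ (Pol m n) + 1) * k → (K S).Nonempty) :
    ∃ P, ∀ S ⊆ E, S.card ≤ k → P ∈ K S := by
  classical
  have := Convex.helly_theorem' (𝕜 := ℝ) (F := K) (s := E.powerset.filter fun S => S.card ≤ k)
    (fun S _ => hc S) ?_
  · obtain ⟨P, hP⟩ := this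
    refine ⟨P, fun S hS hk => ?_⟩
    simp only [Set.mem_iInter] at hP
    exact hP S (by simp [hS, hk])
  · intro I hI hcard
    have hU : I.biUnion id ⊆ E := by
      intro y hy
      simp only [Finset.mem_biUnion, id] at hy
      obtain ⟨S, hS, hy⟩ := hy
      have := hI hS
      simp only [Finset.mem_filter, Finset.mem_powerset] at this
      exact this.1 hy
    have hUc : (I.biUnion id).card ≤ (Module.finrank ℝ (Pol m n) + 1) * k := by
      refine (Finset.card_biUnion_le_card_mul I id k ?_).trans (Nat.mul_le_mul_right _ hcard)
      intro S hS
      have := hI hS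
      simp only [Finset.mem_filter, Finset.mem_powerset] at this
      exact this.2
    obtain ⟨P, hP⟩ := hne _ hU hUc
    refine ⟨P, ?_⟩
    simp only [Set.mem_iInter]
    intro S hS
    exact hK _ _ (Finset.subset_biUnion_of_mem id hS) hP

/-- jets at `x` extendable to `k` points -/
def GG {n : ℕ} (m : ℕ) (E : Finset (Euc n)) (f : Euc n → ℝ) (M : ℝ) (k : ℕ) (x : Euc n) (P : Euc n → ℝ) : Prop :=
  ∀ S ⊆ E, S.card ≤ k → ∃ Q : Euc n → Euc n → ℝ, Q x = P ∧ Compat m f M (insert x S) Q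

lemma GG_step {E : Finset (Euc n)} {M : ℝ} {k : ℕ} {x y : Euc n} {P : Euc n → ℝ}
    (hy : y ∈ E) (h : GG m E f M ((Module.finrank ℝ (Pol m n) + 1) * k + 1) x P) :
    ∃ P', GG m E f M k y P' ∧ At m (P - P') x ‖x - y‖ M := by
  classical
  have HH := helly_gen (m := m) E k
    (fun S => {R | ∃ Q : Euc n → Euc n → ℝ, Q x = P ∧ Q y = R ∧ Compat m f M (insert x (insert y S)) Q})
    ?_ ?_ ?_
  · obtain ⟨P', hP'⟩ := HH
    refine ⟨P', fun S hS hk => ?_, ?_⟩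
    · obtain ⟨Q, -, h2, h3⟩ := hP' S hS hk
      exact ⟨Q, h2, h3.mono (Finset.subset_insert _ _)⟩
    · obtain ⟨Q, h1, h2, h3⟩ := hP' ∅ (by simp) (by simp)
      have := h3.2 x (by simp) y (by simp)
      rwa [h1, h2] at this
  · rintro S R ⟨Q, h1, h2, h3⟩ R' ⟨Q', h1', h2', h3'⟩ a b ha hb hab
    refine ⟨a • Q + b • Q', ?_, ?_, h3.conv h3' ha hb hab⟩
    · simp only [Pi.add_apply, Pi.smul_apply, h1, h1']
      rw [← add_smul, hab, one_smul]
    · simp only [Pi.add_apply, Pi.smul_apply, h2, h2']; rfl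
  · rintro S S' hS R ⟨Q, h1, h2, h3⟩
    exact ⟨Q, h1, h2, h3.mono (Finset.insert_subset_insert _ (Finset.insert_subset_insert _ hS))⟩
  · intro S hS hc
    obtain ⟨Q, h1, h2⟩ := h (insert y S) (Finset.insert_subset hy hS)
      ((Finset.card_insert_le _ _).trans (by omega))
    exact ⟨⟨Q y, Gam_pol (h2.1 y (by simp)).1⟩, Q, h1, rfl, h2⟩

lemma GG_start {E : Finset (Euc n)} {M : ℝ} {k : ℕ} {x : Euc n} (hx : x ∈ E)
    (h : ∀ S ⊆ E, S.card ≤ (Module.finrank ℝ (Pol m n) + 1) * k + 1 → ∃ Q, Compat m f M S Q) :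
    ∃ P, GG m E f M k x P := by
  classical
  have HH := helly_gen (m := m) E k
    (fun S => {R | ∃ Q : Euc n → Euc n → ℝ, Q x = R ∧ Compat m f M (insert x S) Q})
    ?_ ?_ ?_
  · obtain ⟨P', hP'⟩ := HH
    exact ⟨P', fun S hS hk => hP' S hS hk⟩
  · rintro S R ⟨Q, h2, h3⟩ R' ⟨Q', h2', h3'⟩ a b ha hb hab
    refine ⟨a • Q + b • Q', ?_, h3.conv h3' ha hb hab⟩
    simp only [Pi.add_apply, Pi.smul_apply, h2, h2']; rfl
  · rintro S S' hS R ⟨Q, h2, h3⟩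
    exact ⟨Q, h2, h3.mono (Finset.insert_subset_insert _ hS)⟩
  · intro S hS hc
    obtain ⟨Q, h2⟩ := h (insert x S) (Finset.insert_subset hx hS)
      ((Finset.card_insert_le _ _).trans (by omega))
    exact ⟨⟨Q x, Gam_pol (h2.1 x (by simp)).1⟩, Q, rfl, h2⟩

def kk (m n : ℕ) : ℕ → ℕ
  | 0 => 0
  | l + 1 => (Module.finrank ℝ (Pol m n) + 1) * kk m n l + 1

lemma GG_Gam {E : Finset (Euc n)} {M : ℝ} (l : ℕ) {x : Euc n} {P : Euc n → ℝ}
    (h : GG m E f M (kk m n l) x P) : P ∈ Gam m E f l x M := by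
  induction l generalizing x P with
  | zero =>
    obtain ⟨Q, h1, h2⟩ := h ∅ (by simp) (by simp)
    rw [← h1]
    exact (h2.1 x (by simp)).1
  | succ l ih =>
    refine ⟨ih fun S hS hc => h S hS (hc.trans ?_), fun y hy => ?_⟩
    · rw [kk]; nlinarith
    · obtain ⟨P', h1, h2⟩ := GG_step hy h
      exact ⟨P', ih h1, h2⟩

/-- the finiteness hypothesis gives elements in the deep `Gam` -/
lemma helly_main (E : Finset (Euc n)) (f : Euc n → ℝ) (M : ℝ) (l : ℕ)
    (h : ∀ S ⊆ E, S.card ≤ kk m n (l + 1) → ∃ Q, Compat m f M S Q) :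
    ∀ x ∈ E, ∃ P ∈ Gam m E f l x M, At m P x 1 M := by
  intro x hx
  obtain ⟨P, hP⟩ := GG_start hx h
  refine ⟨P, GG_Gam l hP, ?_⟩
  obtain ⟨Q, h1, h2⟩ := hP ∅ (by simp) (by simp)
  rw [← h1]
  exact (h2.1 x (by simp)).2

end
end
end

section
open scoped BigOperators ContDiff

noncomputable section

section
variable {n : ℕ}

lemma packing (n : ℕ) : ∃ N : ℕ, ∀ (y : Euc n) (R : ℝ), 0 < R → ∀ S : Finset (Euc n),
    (∀ s ∈ S, ‖y - s‖ ≤ R) → (∀ s ∈ S, ∀ s' ∈ S, s ≠ s' → R / 20 < ‖s - s'‖) → S.card ≤ N := by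
  classical
  obtain ⟨t, -, htf, ht⟩ := (isCompact_closedBall (0 : Euc n) 1).finite_cover_balls
    (show (0:ℝ) < 1/40 by norm_num)
  refine ⟨htf.toFinset.card, fun y R hR S h1 h2 => ?_⟩
  have : ∀ s ∈ S, ∃ p ∈ htf.toFinset, dist (R⁻¹ • (s - y)) p < 1/40 := by
    intro s hs
    have : R⁻¹ • (s - y) ∈ Metric.closedBall (0 : Euc n) 1 := by
      rw [mem_closedBall_zero_iff, norm_smul, norm_inv, Real.norm_of_nonneg hR.le, norm_sub_rev]
      rw [inv_mul_le_iff₀ hR, mul_one]; exact h1 s hs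
    have := ht this
    simp only [Set.mem_iUnion, Metric.mem_ball] at this
    obtain ⟨p, hp, hd⟩ := this
    exact ⟨p, by simpa using hp, hd⟩
  choose! g hg1 hg2 using this
  refine Finset.card_le_card_of_injOn g hg1 ?_
  intro s hs s' hs' he
  by_contra hne
  have k1 := hg2 s hs
  have k2 := hg2 s' hs'
  rw [← he] at k2
  have k3 : dist (R⁻¹ • (s - y)) (R⁻¹ • (s' - y)) < 1/20 := by
    have := dist_triangle_right (R⁻¹ • (s - y)) (R⁻¹ • (s' - y)) (g s)
    linarith
  rw [dist_eq_norm, ← smul_sub, sub_sub_sub_cancel_right, norm_smul, norm_inv,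
    Real.norm_of_nonneg hR.le, inv_mul_lt_iff₀ hR] at k3
  have := h2 s hs s' hs' hne
  linarith

lemma finite_of_sep (S : Set (Euc n)) (hb : Bornology.IsBounded S) {ε : ℝ} (hε : 0 < ε)
    (h : ∀ s ∈ S, ∀ s' ∈ S, s ≠ s' → ε < ‖s - s'‖) : S.Finite := by
  obtain ⟨t, htf, ht⟩ := Metric.totallyBounded_iff.1 ((Bornology.IsBounded.isCompact_closure hb).totallyBounded.subset subset_closure) (ε/2) (by linarith)
  have : ∀ s ∈ S, ∃ p ∈ t, dist s p < ε/2 := by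
    intro s hs
    have := ht hs
    simp only [Set.mem_iUnion, Metric.mem_ball] at this
    obtain ⟨p, hp, hd⟩ := this
    exact ⟨p, hp, hd⟩
  choose! g hg1 hg2 using this
  refine Set.Finite.of_finite_image (htf.subset (Set.image_subset_iff.2 hg1)) ?_
  intro s hs s' hs' he
  by_contra hne
  have k2 := hg2 s' hs'
  rw [← he] at k2
  have := dist_triangle_right s s' (g s)
  have k := h s hs s' hs' hne
  rw [← dist_eq_norm] at k
  linarith [hg2 s hs]

/-- rescaled bump functions -/
lemma bumps (m n : ℕ) : ∃ C : ℝ, 1 ≤ C ∧ ∀ (s : Euc n) (r : ℝ), 0 < r → ∃ φ : Euc n → ℝ, Sm φ ∧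
    (∀ y, 0 ≤ φ y) ∧ (∀ y, φ y ≤ 1) ∧ (∀ y, ‖y - s‖ ≤ 0.6 * r → φ y = 1) ∧
    (∀ y, 0.9 * r ≤ ‖y - s‖ → φ y = 0) ∧ ∀ j ≤ m, ∀ y, dn j φ y ≤ C / r ^ j := by
  let b : ContDiffBump (0 : Euc n) := ⟨0.6, 0.9, by norm_num, by norm_num⟩
  have hb : Sm (b : Euc n → ℝ) := b.contDiff
  have : ∀ j : ℕ, ∃ B, ∀ y, dn j b y ≤ B := fun j =>
    (b.hasCompactSupport.iteratedFDeriv (𝕜 := ℝ) j).exists_bound_of_continuous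
      (ContDiff.continuous_iteratedFDeriv (by exact_mod_cast le_top) hb)
  choose B hB using this
  refine ⟨1 + ∑ j ∈ Finset.range (m+1), |B j|, ?_, fun s r hr => ?_⟩
  · have : 0 ≤ ∑ j ∈ Finset.range (m+1), |B j| := Finset.sum_nonneg fun _ _ => abs_nonneg _
    linarith
  let g : Euc n →L[ℝ] Euc n := r⁻¹ • ContinuousLinearMap.id ℝ (Euc n)
  have hg : ∀ y, g y = r⁻¹ • y := fun y => rfl
  have hgn : ∀ y, ‖g y‖ = r⁻¹ * ‖y‖ := fun y => by
    rw [hg, norm_smul, norm_inv, Real.norm_of_nonneg hr.le]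
  refine ⟨fun y => (b ∘ g) (y - s), ?_, fun y => b.nonneg, fun y => b.le_one, ?_, ?_, ?_⟩
  · exact (hb.comp g.contDiff).comp (contDiff_id.sub contDiff_const)
  · intro y hy
    refine b.one_of_mem_closedBall ?_
    rw [mem_closedBall_zero_iff, hgn]
    show r⁻¹ * ‖y - s‖ ≤ 0.6
    rw [inv_mul_le_iff₀ hr]; linarith
  · intro y hy
    refine b.zero_of_le_dist ?_
    rw [dist_zero_right, hgn]
    show 0.9 ≤ r⁻¹ * ‖y - s‖
    rw [le_inv_mul_iff₀ hr]; linarith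
  · intro j hj y
    unfold dn
    rw [iteratedFDeriv_comp_sub, g.iteratedFDeriv_comp_right hb _ (by exact_mod_cast le_top)]
    refine (ContinuousMultilinearMap.norm_compContinuousLinearMap_le _ _).trans ?_
    have h1 : ‖g‖ ≤ r⁻¹ := ContinuousLinearMap.opNorm_le_bound _ (by positivity) fun v => (hgn v).le
    rw [Finset.prod_const, Finset.card_univ, Fintype.card_fin, div_eq_mul_inv, ← inv_pow]
    refine mul_le_mul ?_ (pow_le_pow_left₀ (norm_nonneg _) h1 _) (by positivity) ?_
    · refine (hB j _).trans ((le_abs_self _).trans ?_)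
      have := Finset.single_le_sum (f := fun j => |B j|) (fun _ _ => abs_nonneg _)
        (Finset.mem_range.2 (Nat.lt_succ_of_le hj))
      linarith
    · have : 0 ≤ ∑ j ∈ Finset.range (m+1), |B j| := Finset.sum_nonneg fun _ _ => abs_nonneg _
      linarith

def chi (t : ℝ) : ℝ := (1 - Real.smoothTransition t + t * Real.smoothTransition t)⁻¹

lemma chi_den_pos (t : ℝ) : 0 < 1 - Real.smoothTransition t + t * Real.smoothTransition t := by
  rcases le_or_gt t 0 with h | h
  · rw [Real.smoothTransition.zero_of_nonpos h]; norm_num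
  · have h1 := Real.smoothTransition.pos_of_pos h
    have h2 := Real.smoothTransition.le_one t
    have := mul_pos h h1
    linarith

lemma chi_pos (t : ℝ) : 0 < chi t := inv_pos.2 (chi_den_pos t)

lemma chi_one {t : ℝ} (h : 1 ≤ t) : chi t = t⁻¹ := by
  unfold chi
  rw [Real.smoothTransition.one_of_one_le h]; simp

lemma chi_smooth : ContDiff ℝ ∞ chi := by
  unfold chi
  have h := Real.smoothTransition.contDiff (n := ⊤)
  refine ContDiff.inv ?_ fun t => (chi_den_pos t).ne'
  exact (contDiff_const.sub h).add (contDiff_id.mul h)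

lemma chi_bd (m : ℕ) (N : ℝ) : ∃ C : ℝ, 1 ≤ C ∧ ∀ j ≤ m, ∀ t, 0 ≤ t → t ≤ N →
    ‖iteratedFDeriv ℝ j chi t‖ ≤ C := by
  have : ∀ j : ℕ, ∃ B, ∀ t ∈ Set.Icc 0 N, ‖iteratedFDeriv ℝ j chi t‖ ≤ B := fun j =>
    isCompact_Icc.exists_bound_of_continuousOn
      (ContDiff.continuous_iteratedFDeriv (by exact_mod_cast le_top) chi_smooth).continuousOn
  choose B hB using this
  refine ⟨1 + ∑ j ∈ Finset.range (m+1), |B j|, ?_, fun j hj t h1 h2 => ?_⟩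
  · have : 0 ≤ ∑ j ∈ Finset.range (m+1), |B j| := Finset.sum_nonneg fun _ _ => abs_nonneg _
    linarith
  · have := Finset.single_le_sum (f := fun j => |B j|) (fun _ _ => abs_nonneg _)
        (Finset.mem_range.2 (Nat.lt_succ_of_le hj))
    linarith [hB j t ⟨h1, h2⟩, le_abs_self (B j)]

lemma dn_sum_le {ι : Type*} (S : Finset ι) {F : ι → Euc n → ℝ} (hF : ∀ s ∈ S, Sm (F s)) (j : ℕ)
    (x : Euc n) : dn j (∑ s ∈ S, F s) x ≤ ∑ s ∈ S, dn j (F s) x := by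
  classical
  induction S using Finset.induction_on with
  | empty =>
    simp only [Finset.sum_empty]
    have : (0 : Euc n → ℝ) = (0:ℝ) • 0 := by simp
    rw [this, dn_smul Sm.zero]; simp
  | insert a S ha ih =>
    rw [Finset.sum_insert ha, Finset.sum_insert ha]
    refine (dn_add_le (hF a (by simp)) (Sm.sum S fun s hs => hF s (by simp [hs])) j x).trans ?_
    gcongr
    exact ih fun s hs => hF s (by simp [hs])

lemma dn_zero_near {F : Euc n → ℝ} {y : Euc n} (h : F =ᶠ[nhds y] 0) (j : ℕ) : dn j F y = 0 := by
  rw [dn_congr h]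
  have : (0 : Euc n → ℝ) = (0:ℝ) • 0 := by simp
  rw [this, dn_smul Sm.zero]; simp

lemma dn_sum_le_filter {S : Finset (Euc n)} {F : Euc n → Euc n → ℝ} (hF : ∀ s ∈ S, Sm (F s)) (j : ℕ)
    {x : Euc n} {p : Euc n → Prop} [DecidablePred p] {B N : ℝ} (hB : 0 ≤ B)
    (hp : ∀ s ∈ S, ¬ p s → F s =ᶠ[nhds x] 0) (hb : ∀ s ∈ S, p s → dn j (F s) x ≤ B)
    (hN : ((S.filter p).card : ℝ) ≤ N) : dn j (∑ s ∈ S, F s) x ≤ N * B := by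
  refine (dn_sum_le S hF j x).trans ?_
  rw [← Finset.sum_filter_add_sum_filter_not S p]
  have h2 : ∑ s ∈ S with ¬ p s, dn j (F s) x = 0 := Finset.sum_eq_zero fun s hs => by
    rw [Finset.mem_filter] at hs
    exact dn_zero_near (hp s hs.1 hs.2) j
  rw [h2, add_zero]
  calc ∑ s ∈ S with p s, dn j (F s) x ≤ ∑ s ∈ S with p s, B := Finset.sum_le_sum fun s hs => by
        rw [Finset.mem_filter] at hs
        exact hb s hs.1 hs.2
    _ = (S.filter p).card * B := by rw [Finset.sum_const, nsmul_eq_mul]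
    _ ≤ N * B := by gcongr

open Classical in
lemma pou (m n : ℕ) : ∃ C : ℝ, 1 ≤ C ∧ ∀ X : Set (Euc n), Bornology.IsBounded X →
    ∀ (ρ : Euc n → ℝ) (a b : ℝ), 0 < a → (∀ x ∈ X, a ≤ ρ x) → (∀ x ∈ X, ρ x ≤ b) →
    (∀ x ∈ X, ∀ y ∈ X, ρ x - ρ y ≤ ‖x - y‖ / 20) →
    ∃ S : Finset (Euc n), (∀ s ∈ S, s ∈ X) ∧ ∃ θ : Euc n → Euc n → ℝ,
      (∀ s ∈ S, Sm (θ s)) ∧ (∀ s ∈ S, ∀ y, 0 ≤ θ s y) ∧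
      (∀ s ∈ S, ∀ y, ρ s < ‖y - s‖ → θ s =ᶠ[nhds y] 0) ∧
      (∀ s ∈ S, ∀ j ≤ m, ∀ y, dn j (θ s) y ≤ C / ρ s ^ j) ∧
      (∀ x ∈ X, (∑ s ∈ S, θ s) =ᶠ[nhds x] 1) ∧
      ∀ y, ((S.filter fun s => ‖y - s‖ ≤ ρ s).card : ℝ) ≤ C := by
  obtain ⟨N, hN⟩ := packing n
  obtain ⟨B, hB1, hB⟩ := bumps m n
  obtain ⟨D, hD1, hD⟩ := chi_bd m N
  set K : ℝ := 2 * ((N + 1) * (2 ^ m * B)) with hK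
  have h2m : (1:ℝ) ≤ 2 ^ m := one_le_pow₀ (by norm_num)
  have hK1 : 1 ≤ K := by
    have h : (1:ℝ) ≤ 2 ^ m * B := by nlinarith
    have : (0:ℝ) ≤ N := by positivity
    rw [hK]; nlinarith
  set C0 : ℝ := m.factorial * D * K ^ m with hC0
  have hC00 : 0 ≤ C0 := by positivity
  refine ⟨2 ^ m * B * C0 + N + 1, by
    have : 0 ≤ 2 ^ m * B * C0 := by positivity
    have : (0:ℝ) ≤ N := by positivity
    linarith, ?_⟩
  intro X hX ρ a b ha hρa hρb hLip
  have hρ : ∀ x ∈ X, 0 < ρ x := fun x hx => ha.trans_le (hρa x hx)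
  obtain ⟨U, hUX, hUd, hUc⟩ := Vitali.exists_disjoint_subfamily_covering_enlargement_closedBall X id
    (fun s => ρ s / 10) (b/10) (fun s hs => by linarith [hρb s hs]) 5 (by norm_num)
  have hsep : ∀ s ∈ U, ∀ s' ∈ U, s ≠ s' → ρ s / 10 < ‖s - s'‖ := by
    intro s hs s' hs' hne
    by_contra hc
    push Not at hc
    have h0 := Set.disjoint_left.1 (hUd hs hs' hne)
    have := @h0 s' (by simp only [id, Metric.mem_closedBall, dist_eq_norm]; rwa [norm_sub_rev])
    exact this (by
      simp only [id, Metric.mem_closedBall, dist_self]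
      linarith [hρ s' (hUX hs')])
  have hUf : U.Finite := finite_of_sep U (hX.subset hUX) (show 0 < a/10 by linarith) fun s hs s' hs' hne => by
    have := hsep s hs s' hs' hne
    linarith [hρa s (hUX hs)]
  have hS : ∀ s, s ∈ hUf.toFinset ↔ s ∈ U := fun s => hUf.mem_toFinset
  set S := hUf.toFinset with hSdef
  have hcomp : ∀ s ∈ S, ∀ s' ∈ S, ∀ y, ‖y - s‖ ≤ ρ s → ‖y - s'‖ ≤ ρ s' → 19 * ρ s ≤ 21 * ρ s' := by
    intro s hs s' hs' y h1 h2
    have h3 := hLip s (hUX ((hS s).1 hs)) s' (hUX ((hS s').1 hs'))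
    have h4 : ‖s - s'‖ ≤ ‖y - s‖ + ‖y - s'‖ := by
      rw [norm_sub_rev y s]
      have := norm_sub_le_norm_sub_add_norm_sub s y s'
      exact this
    linarith
  have hmult : ∀ y, (S.filter fun s => ‖y - s‖ ≤ ρ s).card ≤ N := by
    intro y
    rcases (S.filter fun s => ‖y - s‖ ≤ ρ s).eq_empty_or_nonempty with h | ⟨s0, hs0⟩
    · rw [h]; simp
    · rw [Finset.mem_filter] at hs0
      have hp := hρ s0 (hUX ((hS s0).1 hs0.1))
      refine hN y (ρ s0 * (21/19)) (by linarith) _ ?_ ?_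
      · intro s hs
        rw [Finset.mem_filter] at hs
        have := hcomp s hs.1 s0 hs0.1 y hs.2 hs0.2
        have := hρ s (hUX ((hS s).1 hs.1))
        have := hs.2
        linarith
      · intro s hs s' hs' hne
        rw [Finset.mem_filter] at hs hs'
        have h1 := hsep s ((hS s).1 hs.1) s' ((hS s').1 hs'.1) hne
        have h2 := hcomp s0 hs0.1 s hs.1 y hs0.2 hs.2
        linarith
  have : ∀ s ∈ S, ∃ φ : Euc n → ℝ, Sm φ ∧
    (∀ y, 0 ≤ φ y) ∧ (∀ y, φ y ≤ 1) ∧ (∀ y, ‖y - s‖ ≤ 0.6 * ρ s → φ y = 1) ∧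
    (∀ y, 0.9 * ρ s ≤ ‖y - s‖ → φ y = 0) ∧ ∀ j ≤ m, ∀ y, dn j φ y ≤ B / ρ s ^ j := fun s hs =>
    hB s (ρ s) (hρ s (hUX ((hS s).1 hs)))
  choose! φ hφs hφ0 hφ1 hφin hφout hφd using this
  have hoff : ∀ s ∈ S, ∀ y, ¬ (‖y - s‖ ≤ ρ s) → φ s =ᶠ[nhds y] 0 := by
    intro s hs y hy
    push Not at hy
    have hp := hρ s (hUX ((hS s).1 hs))
    have : ∀ᶠ z in nhds y, ρ s < ‖z - s‖ :=
      (show Continuous fun z : Euc n => ‖z - s‖ by fun_prop).continuousAt.eventually_const_lt hy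
    filter_upwards [this] with z hz
    exact hφout s hs z (by linarith)
  set Φ : Euc n → ℝ := ∑ s ∈ S, φ s with hΦ
  have hΦs : Sm Φ := Sm.sum S hφs
  have hΦ0 : ∀ y, 0 ≤ Φ y := fun y => by
    rw [hΦ, Finset.sum_apply]; exact Finset.sum_nonneg fun s hs => hφ0 s hs y
  have hΦN : ∀ y, Φ y ≤ N := fun y => by
    rw [hΦ, Finset.sum_apply, ← Finset.sum_filter_add_sum_filter_not S (fun s => ‖y - s‖ ≤ ρ s)]
    have h2 : ∑ s ∈ S with ¬ (‖y - s‖ ≤ ρ s), φ s y = 0 := Finset.sum_eq_zero fun s hs => by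
      rw [Finset.mem_filter] at hs
      exact (hoff s hs.1 y hs.2).eq_of_nhds
    rw [h2, add_zero]
    calc ∑ s ∈ S with ‖y - s‖ ≤ ρ s, φ s y ≤ ∑ s ∈ S with ‖y - s‖ ≤ ρ s, 1 :=
          Finset.sum_le_sum fun s hs => hφ1 s (Finset.mem_filter.1 hs).1 y
      _ ≤ N := by simpa using hmult y
  have hchi : Sm (chi ∘ Φ) := chi_smooth.comp hΦs
  have hchid : ∀ s ∈ S, ∀ y, ‖y - s‖ ≤ ρ s → ∀ j ≤ m, dn j (chi ∘ Φ) y ≤ C0 / ρ s ^ j := by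
    intro s hs y hy j hj
    have hp := hρ s (hUX ((hS s).1 hs))
    have := norm_iteratedFDeriv_comp_le (n := j) (N := ∞) chi_smooth hΦs (by exact_mod_cast le_top) y (C := D)
      (D := K / ρ s) (fun i hi => hD i (hi.trans hj) _ (hΦ0 y) (hΦN y)) ?_
    · refine this.trans ?_
      rw [div_pow, hC0, mul_div_assoc']
      have h1 : (j.factorial : ℝ) ≤ m.factorial := by exact_mod_cast Nat.factorial_le hj
      have h2 : K ^ j ≤ K ^ m := pow_le_pow_right₀ hK1 hj
      gcongr
    · intro i hi hij
      have hsum : dn i Φ y ≤ (N:ℝ) * (B / (ρ s / 2) ^ i) := by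
        refine dn_sum_le_filter hφs i (p := fun s => ‖y - s‖ ≤ ρ s) (by positivity)
          (fun s' hs' h' => hoff s' hs' y h') ?_ (by exact_mod_cast hmult y)
        intro s' hs' h'
        refine (hφd s' hs' i (hij.trans hj) y).trans ?_
        have := hcomp s hs s' hs' y hy h'
        have hp' := hρ s' (hUX ((hS s').1 hs'))
        gcongr
        linarith
      refine hsum.trans ?_
      have h3 : (N:ℝ) * (B / (ρ s / 2) ^ i) = (N * (2 ^ i * B)) / ρ s ^ i := by
        rw [div_pow]; field_simp
      rw [h3, div_pow]
      gcongr
      have h4 : (2:ℝ) ^ i ≤ 2 ^ m := pow_le_pow_right₀ (by norm_num) (hij.trans hj)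
      calc (N:ℝ) * (2 ^ i * B) ≤ (N + 1) * (2 ^ m * B) := by gcongr; linarith
        _ ≤ K := by
          have : 0 ≤ ((N:ℝ) + 1) * (2 ^ m * B) := by positivity
          rw [hK]; linarith
        _ ≤ K ^ i := le_self_pow₀ hK1 (by omega)
  refine ⟨S, fun s hs => hUX ((hS s).1 hs), fun s => φ s * (chi ∘ Φ), fun s hs => (hφs s hs).mul' hchi,
    fun s hs y => mul_nonneg (hφ0 s hs y) (chi_pos _).le, ?_, ?_, ?_, ?_⟩
  · intro s hs y hy
    filter_upwards [hoff s hs y (not_le.2 hy)] with z hz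
    simp [hz]
  · intro s hs j hj y
    have hp := hρ s (hUX ((hS s).1 hs))
    by_cases hy : ‖y - s‖ ≤ ρ s
    · refine (dn_mul_le (hφs s hs) hchi j y).trans ?_
      have : ∀ i ∈ Finset.range (j+1), (j.choose i : ℝ) * dn i (φ s) y * dn (j - i) (chi ∘ Φ) y
          ≤ j.choose i * (B * C0 / ρ s ^ j) := by
        intro i hi
        have hij : i ≤ j := Nat.lt_succ_iff.1 (Finset.mem_range.1 hi)
        have h1 := hφd s hs i (hij.trans hj) y
        have h2 := hchid s hs y hy (j - i) (by omega)
        rw [mul_assoc]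
        refine mul_le_mul_of_nonneg_left ?_ (by positivity)
        calc dn i (φ s) y * dn (j - i) (chi ∘ Φ) y ≤ B / ρ s ^ i * (C0 / ρ s ^ (j - i)) :=
              mul_le_mul h1 h2 (dn_nonneg _ _ _) (by positivity)
          _ = B * C0 / ρ s ^ j := by
              rw [div_mul_div_comm, ← pow_add, Nat.add_sub_cancel' hij]
      refine (Finset.sum_le_sum this).trans ?_
      rw [← Finset.sum_mul, ← Nat.cast_sum, Nat.sum_range_choose, mul_div_assoc']
      gcongr
      push_cast
      have h4 : (2:ℝ) ^ j ≤ 2 ^ m := pow_le_pow_right₀ (by norm_num) hj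
      have h5 : (2:ℝ) ^ j * (B * C0) ≤ 2 ^ m * (B * C0) := by gcongr
      have : (0:ℝ) ≤ N := by positivity
      linarith
    · rw [dn_zero_near _ j]
      · have : (0:ℝ) ≤ 2 ^ m * B * C0 := by positivity
        positivity
      · filter_upwards [hoff s hs y hy] with z hz
        simp [hz]
  · intro x hx
    obtain ⟨s, hs, hc⟩ := hUc x hx
    have hp := hρ s (hUX hs)
    have hxs : ‖x - s‖ ≤ ρ s / 2 := by
      have := hc (Metric.mem_closedBall_self (by linarith [hρ x hx]))
      rw [Metric.mem_closedBall, dist_eq_norm] at this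
      simp only [id] at this
      linarith
    have : ∀ᶠ z in nhds x, ‖z - s‖ < 0.6 * ρ s :=
      (show Continuous fun z : Euc n => ‖z - s‖ by fun_prop).continuousAt.eventually_lt_const
        (by linarith)
    filter_upwards [this] with z hz
    have h1 : 1 ≤ Φ z := by
      have := Finset.single_le_sum (f := fun s => φ s z) (fun s hs => hφ0 s hs z) ((hS s).2 hs)
      rw [hφin s ((hS s).2 hs) z hz.le] at this
      rw [hΦ, Finset.sum_apply]; exact this
    have h2 : (∑ s ∈ S, φ s * (chi ∘ Φ)) z = Φ z * chi (Φ z) := by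
      rw [← Finset.sum_mul]; rfl
    rw [h2, chi_one h1, mul_inv_cancel₀ (by linarith)]; rfl
  · intro y
    have := hmult y
    have h1 : ((S.filter fun s => ‖y - s‖ ≤ ρ s).card : ℝ) ≤ N := by exact_mod_cast this
    have : 0 ≤ 2 ^ m * B * C0 := by positivity
    linarith

end
end
end

section
open scoped BigOperators ContDiff

noncomputable section

section
variable {n m : ℕ} {E : Set (Euc n)} {f : Euc n → ℝ}

lemma nc_add (x : Euc n) (δ : ℝ) {F G : Euc n → ℝ} (hF : Sm F) (hG : Sm G) :
    nc (m := m) x δ (F + G) = nc x δ F + nc x δ G := by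
  funext β
  simp only [nc, Pi.add_apply]
  rw [mD_add hF hG, Pi.add_apply, add_div]

lemma nc_sub (x : Euc n) (δ : ℝ) {F G : Euc n → ℝ} (hF : Sm F) (hG : Sm G) :
    nc (m := m) x δ (F - G) = nc x δ F - nc x δ G := by
  funext β
  simp only [nc, Pi.sub_apply]
  rw [mD_sub hF hG, Pi.sub_apply, sub_div]

lemma nc_smul (x : Euc n) (δ : ℝ) {F : Euc n → ℝ} (hF : Sm F) (c : ℝ) :
    nc (m := m) x δ (c • F) = c • nc x δ F := by
  funext β
  simp only [nc, Pi.smul_apply, smul_eq_mul]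
  rw [mD_smul hF, Pi.smul_apply, smul_eq_mul, mul_div_assoc]

lemma mD_diff_le {P : Euc n → ℝ} (hP : Sm P) (α : Fin n → ℕ) (x z : Euc n) :
    |mD α P z - mD α P x| ≤ ‖iteratedFDeriv ℝ (deg α) P z - iteratedFDeriv ℝ (deg α) P x‖ := by
  rw [← lst_length α, mD_eq, dL_eq _ (hP.nat _), dL_eq _ (hP.nat _), ← ContinuousMultilinearMap.sub_apply,
    ← Real.norm_eq_abs]
  refine (ContinuousMultilinearMap.le_opNorm _ _).trans ?_
  simp

lemma nc_shift {P : Euc n → ℝ} (hP : P ∈ Pol m n) {x z : Euc n} {δ N c : ℝ} (hδ : 0 < δ) (hN : 0 ≤ N)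
    (hc : 0 ≤ c) (hc1 : c ≤ 1) (h : At m P x δ N) (hz : ‖z - x‖ ≤ c * δ) (β : MI m n) :
    |nc z δ P β - nc x δ P β| ≤ 2 ^ m * N * c := by
  have hb := β.2
  have h1 := dn_mvt (hP.1.nat m) hb (convex_closedBall x δ) (x := x) (y := z)
    (by simp [hδ.le]) (by rw [mem_closedBall_iff_norm]; nlinarith)
    (L := 2 ^ m * N * δ ^ (m - (deg β.1 + 1))) (fun w hw => by
      have := Pol.near hP h hN (K := 1) zero_le_one hδ.le (y := w)
        (by rw [one_mul]; exact mem_closedBall_iff_norm.1 hw) (j := deg β.1 + 1) hb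
      norm_num at this
      exact this)
  have h2 := (mD_diff_le hP.1 β.1 x z).trans h1
  simp only [nc]
  rw [← sub_div, abs_div, abs_of_pos (show 0 < δ ^ (m - deg β.1) by positivity), div_le_iff₀ (by positivity)]
  refine h2.trans ?_
  have e : δ ^ (m - deg β.1) = δ ^ (m - (deg β.1 + 1)) * δ := by
    rw [← pow_succ]; congr 1; omega
  rw [e]
  calc _ ≤ 2 ^ m * N * δ ^ (m - (deg β.1 + 1)) * (c * δ) := by gcongr
    _ = _ := by ring

lemma free_move (hm : 1 ≤ m) (hn : 1 ≤ n) {𝒜 : Set (MI m n)} {z : Euc n} {Q : Euc n → ℝ} {l : ℕ}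
    {δ M B : ℝ} (hM : 0 < M) (hδ : 0 < δ) (hB : 1 ≤ B) (h : Free E f 𝒜 z Q l δ M B)
    (a : MI m n → ℝ) (ha : (∑ γ, |a γ|) * B ≤ 1/2) :
    ∃ P, Free E f 𝒜 z P l δ M (2 * B) ∧ At m (P - Q) z δ (n ^ m * M) ∧
      ∀ α ∈ 𝒜, nc z δ (P - Q) α = M * a α := by
  classical
  obtain ⟨κ, hκ⟩ := TT_fam (n := n) hm hn l
  have hfam := hκ E f M δ hM hδ z Q
  have h0 : 0 ∈ TT m E f l z δ M Q B := TT_zero.2 h.1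
  have hu : ∀ α : MI m n, ∃ v ∈ TT m E f l z δ M Q B, (α ∈ 𝒜 → ∀ β ∈ 𝒜, v β = if β = α then 1 else 0)
      ∧ (∀ β, |v β| ≤ B) ∧ (α ∉ 𝒜 → v = 0) := by
    intro α
    by_cases hα : α ∈ 𝒜
    · obtain ⟨v, h1, h2, h3⟩ := h.2 α hα
      exact ⟨v, h1, fun _ => h2, h3, fun h' => absurd hα h'⟩
    · exact ⟨0, h0, fun h' => absurd h' hα, fun β => by simp; linarith, fun _ => rfl⟩
  choose u hu1 hu2 hu3 hu4 using hu
  set w : MI m n → ℝ := ∑ γ, a γ • u γ with hw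
  have hsa : 0 ≤ ∑ γ, |a γ| := Finset.sum_nonneg fun _ _ => abs_nonneg _
  have hwb : ∀ β, |w β| ≤ 1/2 := by
    intro β
    rw [hw, Finset.sum_apply]
    refine (Finset.abs_sum_le_sum_abs _ _).trans ?_
    refine le_trans ?_ ha
    rw [Finset.sum_mul]
    refine Finset.sum_le_sum fun γ _ => ?_
    simp only [Pi.smul_apply, smul_eq_mul, abs_mul]
    exact mul_le_mul_of_nonneg_left (hu3 γ β) (abs_nonneg _)
  have hcomb : ∀ (α : MI m n) (s : ℝ), |s| ≤ 1/2 → B • w + s • u α ∈ TT m E f l z δ M Q B := by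
    intro α s hs
    have := hfam.comb_one hB h0 Finset.univ (fun γ => B * a γ + if γ = α then s else 0) u
      (fun i _ => hu1 i) (by
        calc _ ≤ ∑ γ, (|a γ| * B + if γ = α then |s| else 0) := Finset.sum_le_sum fun γ _ => by
                refine (abs_add_le _ _).trans ?_
                rw [abs_mul, abs_of_pos (by linarith : 0 < B), mul_comm]
                gcongr
                split_ifs <;> simp
          _ ≤ 1 := by
                rw [Finset.sum_add_distrib, ← Finset.sum_mul]
                simp only [Finset.sum_ite_eq', Finset.mem_univ, if_true]
                linarith)
    convert this using 1
    simp only [add_smul, Finset.sum_add_distrib, hw, Finset.smul_sum, smul_smul, ite_smul, zero_smul,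
      Finset.sum_ite_eq', Finset.mem_univ, if_true]
  have hMB : B * M ≤ 2 * B * M := by nlinarith
  have hB0 : B ≠ 0 := by linarith
  refine ⟨Q + M • pl z δ w, ⟨?_, ?_⟩, ?_, ?_⟩
  · have h1 : B • w ∈ TT m E f l z δ M Q B := by
      by_cases hne : Nonempty (MI m n)
      · obtain ⟨α⟩ := hne
        simpa using hcomb α 0 (by norm_num)
      · have : w = 0 := by funext β; exact absurd ⟨β⟩ hne
        rw [this, smul_zero]; exact h0
    have h2 := h1.1
    rw [map_smul, smul_smul, div_mul_cancel₀ _ hB0] at h2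
    exact Gam_mono hMB h2
  · intro α hα
    refine ⟨u α, ⟨?_, ?_⟩, hu2 α hα, fun β => (hu3 α β).trans (by linarith)⟩
    · have h2 := (hcomb α (1/2) (by norm_num [abs_of_pos])).1
      refine Gam_mono hMB ?_
      convert h2 using 1
      rw [map_add, map_smul, map_smul, smul_add, smul_smul, smul_smul, div_mul_cancel₀ _ hB0, add_assoc]
      congr 3
      field_simp
    · have h2 := (hcomb α (-(1/2)) (by norm_num [abs_of_pos])).1
      refine Gam_mono hMB ?_
      convert h2 using 1
      rw [map_add, map_smul, map_smul, smul_add, smul_smul, smul_smul, div_mul_cancel₀ _ hB0, add_sub_assoc,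
        sub_eq_add_neg, ← neg_smul]
      congr 3
      field_simp
  · rw [add_sub_cancel_left]
    have := (At_pl hn z hδ (by norm_num) hwb).smul (pl_mem _ _ _).1 M
    refine this.mono_N hδ.le ?_
    rw [abs_of_pos hM]
    have : (0:ℝ) ≤ n ^ m := by positivity
    nlinarith [mul_nonneg this hM.le]
  · intro α hα
    rw [add_sub_cancel_left, nc_smul _ _ (pl_mem _ _ _).1, nc_pl _ hδ, Pi.smul_apply, smul_eq_mul]
    congr 1
    rw [hw, Finset.sum_apply, Finset.sum_eq_single α]
    · simp [hu2 α hα α hα]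
    · intro γ _ hγ
      by_cases hγ' : γ ∈ 𝒜
      · simp [hu2 γ hγ' α hα, hγ.symm]
      · simp [hu4 γ hγ']
    · simp

end
end
end

section
open scoped BigOperators ContDiff

noncomputable section

section
variable {n m : ℕ} {E : Set (Euc n)} {f : Euc n → ℝ}

lemma exists_small {X e : ℝ} (hX : 0 ≤ X) (he : 0 < e) : ∃ c : ℝ, 0 < c ∧ ∀ c', c' ≤ c → X * c' ≤ e := by
  refine ⟨e / (X + 1), by positivity, fun c' h => ?_⟩
  by_cases h0 : c' ≤ 0
  · nlinarith [mul_nonneg hX (neg_nonneg.2 h0)]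
  · push Not at h0
    rw [le_div_iff₀ (by positivity)] at h
    nlinarith

lemma At.sum {ι : Type*} (s : Finset ι) {F : ι → Euc n → ℝ} (hF : ∀ i ∈ s, Sm (F i)) {x : Euc n} {r N : ℝ}
    (h : ∀ i ∈ s, At m (F i) x r N) : At m (∑ i ∈ s, F i) x r (s.card * N) := by
  intro j hj
  refine (dn_sum_le s hF j x).trans ?_
  refine (Finset.sum_le_sum fun i hi => h i hi j hj).trans ?_
  rw [Finset.sum_const, nsmul_eq_mul, mul_assoc]

lemma At.small {G : Euc n → ℝ} {x : Euc n} {r c δ N : ℝ} (h : At m G x r N) (hN : 0 ≤ N) (hr : 0 ≤ r)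
    (hc : 0 ≤ c) (hc1 : c ≤ 1) (hδ : 0 ≤ δ) (hrc : r ≤ c * δ) : At m G x δ (N * c) := by
  intro j hj
  refine (h j hj).trans ?_
  have h1 : r ^ (m - j) ≤ (c * δ) ^ (m - j) := pow_le_pow_left₀ hr hrc _
  have h2 : c ^ (m - j) ≤ c := pow_le_of_le_one hc hc1 (by omega)
  rw [mul_pow] at h1
  rw [mul_assoc]
  refine mul_le_mul_of_nonneg_left (h1.trans ?_) hN
  exact mul_le_mul_of_nonneg_right h2 (by positivity)

lemma Gam_Convex (l : ℕ) (x : Euc n) (N : ℝ) : Convex ℝ (Gam m E f l x N) := by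
  intro P hP Q hQ a b ha hb hab
  exact Gam_conv ha hb hab hP hQ rfl

lemma S1 (hm : 1 ≤ m) (hn : 1 ≤ n) (l : ℕ) {𝒜 : Set (MI m n)} (hU : UpC 𝒜) {A : ℝ} (hA : 1 ≤ A) :
    ∃ c0 A' : ℝ, 0 < c0 ∧ c0 ≤ 1 ∧ 1 ≤ A' ∧ ∀ (E : Set (Euc n)) (f : Euc n → ℝ) (M δ : ℝ), 0 < M → 0 < δ →
    ∀ (x0 : Euc n) (P0 : Euc n → ℝ), Free E f 𝒜 x0 P0 (l + 1) δ M A → ∀ z ∈ E, ‖z - x0‖ ≤ c0 * δ →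
    ∃ P ∈ Pol m n, (∀ α ∈ 𝒜, ∀ y, mD α.1 (P - P0) y = 0) ∧ Free E f 𝒜 z P l δ M A' ∧
      At m (P - P0) z δ (A' * M) := by
  classical
  obtain ⟨ε, hε, hnorm⟩ := fam_normalize 𝒜
  obtain ⟨κ, hκ⟩ := TT_fam (n := n) hm hn l
  set K : ℝ := (Fintype.card (MI m n) : ℝ) with hK
  have hK1 : 1 ≤ K := by
    have : 0 < Fintype.card (MI m n) := Fintype.card_pos_iff.2 ⟨⟨0, by simp [deg]; omega⟩⟩
    rw [hK]; exact_mod_cast this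
  have hK0 : 0 < K := by linarith
  set B : ℝ := 2 * K * A with hBd
  set B' : ℝ := (2 * K + 1) * B with hB'd
  have hnm : (0:ℝ) ≤ n ^ m := by positivity
  have h2m : (1:ℝ) ≤ 2 ^ m := one_le_pow₀ (by norm_num)
  have hAB : A + 1 ≤ B := by
    have : 2 * 1 * A ≤ 2 * K * A := by gcongr
    linarith
  have hBB' : B ≤ B' := by nlinarith
  obtain ⟨c1, hc1, hc1'⟩ := exists_small (X := 2 ^ m * (A ^ 2 + n ^ m * A)) (by positivity) (lt_min hε one_pos)
  obtain ⟨c2, hc2, hc2'⟩ := exists_small (X := K * (2 ^ m * A) * B') (e := 1/2) (by positivity) (by norm_num)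
  set c0 := min 1 (min c1 c2) with hc0
  have hc0p : 0 < c0 := lt_min one_pos (lt_min hc1 hc2)
  have hc01 : c0 ≤ 1 := min_le_left _ _
  have hs1 := hc1' c0 ((min_le_right _ _).trans (min_le_left _ _))
  have hs2 := hc2' c0 ((min_le_right _ _).trans (min_le_right _ _))
  refine ⟨c0, 2 * B' + n ^ m + 2 ^ m * A, hc0p, hc01, by nlinarith, ?_⟩
  intro E f M δ hM hδ x0 P0 hF z hz hzx
  have hfam := hκ E f M δ hM hδ z
  have hv : ∀ α : MI m n, ∃ v ∈ TT m E f (l+1) x0 δ M P0 A, (α ∈ 𝒜 → ∀ β ∈ 𝒜, v β = if β = α then 1 else 0)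
      ∧ (∀ β, |v β| ≤ A) := by
    intro α
    by_cases hα : α ∈ 𝒜
    · obtain ⟨v, h1, h2, h3⟩ := hF.2 α hα
      exact ⟨v, h1, fun _ => h2, h3⟩
    · exact ⟨0, TT_zero.2 hF.1, fun h' => absurd h' hα, fun β => by simp; linarith⟩
  choose v hv1 hv2 hv3 using hv
  choose Qp hQp hQp' using fun α => (hv1 α).1.2 z hz
  choose Qm hQm hQm' using fun α => (hv1 α).2.2 z hz
  have hP0 : Sm P0 := Gam_sm hF.1
  have hP0p : P0 ∈ Pol m n := Gam_pol hF.1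
  have hAM : 0 ≤ A * M := by positivity
  have hsmall : ∀ {G : Euc n → ℝ}, At m G x0 ‖x0 - z‖ (A * M) → At m G x0 δ (A * M * c0) := fun h =>
    h.small hAM (norm_nonneg _) hc0p.le hc01 hδ.le (by rwa [norm_sub_rev])
  set X : MI m n → Euc n → ℝ := fun α => (M / A) • pl x0 δ (v α) with hX
  have hXs : ∀ α, Sm (X α) := fun α => Sm.smul' (pl_mem _ _ _).1 _
  have hp : ∀ α, At m (P0 + X α - Qp α) x0 δ (A * M * c0) := fun α => hsmall (hQp' α)
  have hm' : ∀ α, At m (P0 - X α - Qm α) x0 δ (A * M * c0) := fun α => hsmall (hQm' α)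
  have hQps : ∀ α, Qp α ∈ Pol m n := fun α => Gam_pol (hQp α)
  have hQms : ∀ α, Qm α ∈ Pol m n := fun α => Gam_pol (hQm α)
  set D : MI m n → Euc n → ℝ := fun α => (1/2 : ℝ) • (Qp α - Qm α) with hD
  set Cc : MI m n → Euc n → ℝ := fun α => (1/2 : ℝ) • (Qp α + Qm α) with hCc
  have hDp : ∀ α, D α ∈ Pol m n := fun α => Submodule.smul_mem _ _ (Submodule.sub_mem _ (hQps α) (hQms α))
  have hCp : ∀ α, Cc α ∈ Pol m n := fun α => Submodule.smul_mem _ _ (Submodule.add_mem _ (hQps α) (hQms α))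
  have hCG : ∀ α, Cc α ∈ Gam m E f l z (A * M) := fun α =>
    Gam_conv (a := 1/2) (b := 1/2) (by norm_num) (by norm_num) (by norm_num) (hQp α) (hQm α) (by
      simp only [hCc]; module)
  have hDx : ∀ α, At m (D α - X α) x0 δ (A * M * c0) := by
    intro α
    have := (At.sub ((hP0.sub' (hXs α)).sub' (hQms α).1) ((hP0.add' (hXs α)).sub' (hQps α).1) (hm' α) (hp α)).smul
      (((hP0.sub' (hXs α)).sub' (hQms α).1).sub' ((hP0.add' (hXs α)).sub' (hQps α).1)) (1/2)
    convert this using 1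
    · simp only [hD]; module
    · rw [abs_of_pos (by norm_num)]; ring
  have hCx : ∀ α, At m (Cc α - P0) x0 δ (A * M * c0) := by
    intro α
    have := (At.add ((hP0.sub' (hXs α)).sub' (hQms α).1) ((hP0.add' (hXs α)).sub' (hQps α).1) (hm' α) (hp α)).smul
      (((hP0.sub' (hXs α)).sub' (hQms α).1).add' ((hP0.add' (hXs α)).sub' (hQps α).1)) (-(1/2))
    convert this using 1
    · simp only [hCc]; module
    · rw [abs_of_neg (by norm_num)]; ring
  have hsum : ∀ q : MI m n → Euc n → ℝ, (∀ γ, q γ ∈ Gam m E f l z (A * M)) →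
      ∑ γ, K⁻¹ • q γ ∈ Gam m E f l z (A * M) := fun q hq =>
    (Gam_Convex l z (A * M)).sum_mem (fun _ _ => by positivity)
      (by rw [Finset.sum_const, nsmul_eq_mul, Finset.card_univ, ← hK]; field_simp) (fun γ _ => hq γ)
  set Qb : Euc n → ℝ := ∑ γ, K⁻¹ • Cc γ with hQb
  have hQbp : Qb ∈ Pol m n := Submodule.sum_mem _ fun γ _ => Submodule.smul_mem _ _ (hCp γ)
  have hpert : ∀ α (s : ℝ), Cc α + s • D α ∈ Gam m E f l z (A * M) → Qb + s • K⁻¹ • D α ∈ Gam m E f l z (A * M) := by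
    intro α s h
    have := hsum (fun γ => Cc γ + if γ = α then s • D α else 0) (fun γ => by
      by_cases hγ : γ = α
      · subst hγ; simpa using h
      · simpa [hγ] using hCG γ)
    convert this using 1
    simp only [smul_add, Finset.sum_add_distrib, smul_ite, smul_zero, Finset.sum_ite_eq', Finset.mem_univ, if_true]
    rw [smul_comm]
  have hpp : ∀ α, Qb + K⁻¹ • D α ∈ Gam m E f l z (A * M) := fun α => by
    have := hpert α 1 (by convert hQp α using 1; simp only [hCc, hD]; module)
    simpa using this
  have hpm : ∀ α, Qb - K⁻¹ • D α ∈ Gam m E f l z (A * M) := fun α => by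
    have := hpert α (-1) (by convert hQm α using 1; simp only [hCc, hD]; module)
    rw [neg_one_smul, ← sub_eq_add_neg] at this
    exact this
  set u : MI m n → MI m n → ℝ := fun α => nc z δ ((A / M) • D α) with hu
  have hAMB : A * M ≤ B * M := by
    apply mul_le_mul_of_nonneg_right _ hM.le; linarith
  have huT : ∀ α, u α ∈ TT m E f l z δ M Qb B := by
    intro α
    refine TT_of (s := 1/2) _ (Gam_mono hAMB (hpp α)) (Gam_mono hAMB (hpm α)) (by rw [abs_of_pos] <;> norm_num) ?_
    simp only [hu]
    rw [pl_nc z hδ (Submodule.smul_mem _ _ (hDp α)), smul_smul (M / B) (A / M) (D α), smul_smul (1/2) K⁻¹ (D α)]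
    congr 1
    rw [hBd]
    field_simp
  have huv : ∀ α β, |u α β - v α β| ≤ min ε 1 := by
    intro α β
    refine le_trans ?_ hs1
    have e1 : u α = (A / M) • nc z δ (D α - X α) + nc z δ (pl x0 δ (v α)) := by
      simp only [hu]
      rw [← nc_smul _ _ (Sm.sub' (hDp α).1 (hXs α)), ← nc_add _ _ (Sm.smul' (Sm.sub' (hDp α).1 (hXs α)) _) (pl_mem _ _ _).1]
      congr 1
      simp only [hX]
      rw [smul_sub, smul_smul (A / M) (M / A)]
      have : A / M * (M / A) = 1 := by field_simp
      rw [this, one_smul, sub_add_cancel]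
    have e2 : v α β = nc x0 δ (pl x0 δ (v α)) β := by rw [nc_pl _ hδ]
    have hXp : X α ∈ Pol m n := Submodule.smul_mem _ _ (pl_mem _ _ _)
    have b1 := abs_nc_le hδ (Sm.sub' (hDp α).1 (hXs α)) (Pol.recenter (Submodule.sub_mem _ (hDp α) hXp) (hDx α) (by positivity) zero_le_one
      hδ.le (y := z) (by nlinarith)) β
    have b2 := nc_shift (pl_mem x0 δ (v α)) hδ (N := n ^ m * A) (by positivity) hc0p.le hc01
      (At_pl hn x0 hδ (by linarith) (hv3 α)) hzx β
    rw [e1, e2, Pi.add_apply, Pi.smul_apply, smul_eq_mul, add_sub_assoc]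
    refine (abs_add_le _ _).trans ?_
    rw [abs_mul, abs_of_pos (show 0 < A / M by positivity)]
    have b3 := mul_le_mul_of_nonneg_left b1 (show 0 ≤ A / M by positivity)
    have e3 : A / M * ((1 + 1) ^ m * (A * M * c0)) = 2 ^ m * A ^ 2 * c0 := by
      field_simp; norm_num
    rw [e3] at b3
    linarith
  have hub : ∀ α β, |u α β| ≤ B := by
    intro α β
    have h1 := (huv α β).trans (min_le_right _ _)
    have h2 := hv3 α β
    have h3 := abs_add_le (u α β - v α β) (v α β)
    rw [sub_add_cancel] at h3
    linarith
  have hB1 : 1 ≤ B := by linarith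
  have hQbG : Qb ∈ Gam m E f l z (A * M) := hsum _ hCG
  have hfree : Free E f 𝒜 z Qb l δ M B' := by
    refine ⟨Gam_mono (hAMB.trans (mul_le_mul_of_nonneg_right hBB' hM.le)) hQbG, ?_⟩
    refine hnorm κ _ (hfam Qb) B hB1 (TT_zero.2 (Gam_mono hAMB hQbG)) u (fun α _ => huT α) (fun α _ => hub α) ?_
    intro α hα β hβ
    rw [← hv2 α hα β hβ]
    exact (huv α β).trans (min_le_left _ _)
  have hQP : At m (Qb - P0) x0 δ (A * M * c0) := by
    have e : Qb - P0 = K⁻¹ • ∑ γ, (Cc γ - P0) := by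
      rw [Finset.sum_sub_distrib, smul_sub, Finset.smul_sum, Finset.sum_const, Finset.card_univ, ← Nat.cast_smul_eq_nsmul ℝ, ← hK,
        smul_smul, inv_mul_cancel₀ hK0.ne', one_smul]
    rw [e]
    have := (At.sum Finset.univ (fun γ _ => Sm.sub' (hCp γ).1 hP0) (fun γ _ => hCx γ)).smul
      (Sm.sum _ fun γ _ => Sm.sub' (hCp γ).1 hP0) K⁻¹
    convert this using 1
    rw [Finset.card_univ, ← hK, abs_of_pos (by positivity)]
    field_simp
  have hQPp : Qb - P0 ∈ Pol m n := Submodule.sub_mem _ hQbp hP0p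
  have hQPz := Pol.recenter hQPp hQP (by positivity) zero_le_one hδ.le (y := z) (by nlinarith)
  have e11 : (1 + 1 : ℝ) = 2 := by norm_num
  rw [e11] at hQPz
  set a : MI m n → ℝ := fun α => - (nc z δ (Qb - P0) α / M) with ha
  have hab : ∀ α, |a α| ≤ 2 ^ m * A * c0 := by
    intro α
    simp only [ha]
    rw [abs_neg, abs_div, abs_of_pos hM, div_le_iff₀ hM]
    refine (abs_nc_le hδ hQPp.1 hQPz α).trans (le_of_eq (by ring))
  obtain ⟨P, hPF, hPA, hPn⟩ := free_move hm hn hM hδ (hB1.trans hBB') hfree a (by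
    have : ∑ γ, |a γ| ≤ K * (2 ^ m * A * c0) := by
      refine (Finset.sum_le_sum fun γ _ => hab γ).trans ?_
      rw [Finset.sum_const, nsmul_eq_mul, Finset.card_univ]
    refine (mul_le_mul_of_nonneg_right this (by linarith)).trans ?_
    linarith)
  have hPp : P ∈ Pol m n := Gam_pol hPF.1
  have hsplit : P - P0 = (P - Qb) + (Qb - P0) := by abel
  have hPQ : P - Qb ∈ Pol m n := Submodule.sub_mem _ hPp hQbp
  refine ⟨P, hPp, ?_, hPF.mono hm hn hM hδ (by linarith) (by nlinarith), ?_⟩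
  · apply W_inv hU (Submodule.sub_mem _ hPp hP0p) (x := z)
    intro α hα
    have : nc z δ (P - P0) α = 0 := by
      rw [hsplit, nc_add _ _ hPQ.1 hQPp.1, Pi.add_apply, hPn α hα]
      simp only [ha]; field_simp; ring
    rw [nc, div_eq_zero_iff] at this
    rcases this with h | h
    · exact h
    · exact absurd h (by positivity)
  · rw [hsplit]
    refine (At.add hPQ.1 hQPp.1 hPA hQPz).mono_N hδ.le ?_
    have h1 : 2 ^ m * (A * M * c0) ≤ 2 ^ m * (A * M * 1) := by gcongr
    have h2 : 0 ≤ B' * M := by have : 0 ≤ B' := by linarith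
                               positivity
    nlinarith

end
end
end

section
open scoped BigOperators ContDiff

noncomputable section

section
variable {n m : ℕ} {E : Set (Euc n)} {f : Euc n → ℝ}

lemma At_of_nc (hn : 1 ≤ n) {z : Euc n} {R N : ℝ} (hR : 0 < R) (hN : 0 ≤ N) {P : Euc n → ℝ} (hP : P ∈ Pol m n)
    (h : ∀ β : MI m n, |nc z R P β| ≤ N) : At m P z R (n ^ m * N) := by
  have := At_pl hn z hR hN h
  rwa [pl_nc z hR hP] at this

lemma strict_step (hm : 1 ≤ m) (hn : 1 ≤ n) (l : ℕ) (𝒜 : Set (MI m n)) {A : ℝ} (hA : 1 ≤ A) :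
    ∃ A' : ℝ, 1 ≤ A' ∧ ∀ (E : Set (Euc n)) (f : Euc n → ℝ) (M R : ℝ), 0 < M → 0 < R → ∀ (z : Euc n)
    (P Q : Euc n → ℝ), Free E f 𝒜 z Q l R M A → P ∈ Gam m E f l z (A * M) →
    (∀ α ∈ 𝒜, ∀ y, mD α.1 (P - Q) y = 0) →
    At m (P - Q) z R (n ^ m * M) ∨
    ∃ (𝒜' : Set (MI m n)) (P' : Euc n → ℝ), UpC 𝒜' ∧ prec 𝒜' 𝒜 ∧ Free E f 𝒜' z P' l R M A' ∧
      (∀ α ∈ 𝒜, ∀ y, mD α.1 (P' - Q) y = 0) ∧ At m (P' - Q) z R (n ^ m * M) := by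
  classical
  obtain ⟨κ, hκ⟩ := TT_fam (n := n) hm hn l
  obtain ⟨A', hA', H⟩ := relabel κ 𝒜 True (A := 2 * A) (by linarith)
  refine ⟨max A' (2 * A), le_max_of_le_left hA', ?_⟩
  intro E f M R hM hR z P Q hQ hP hW
  have hPQ : P - Q ∈ Pol m n := Submodule.sub_mem _ (Gam_pol hP) (Gam_pol hQ.1)
  set u : MI m n → ℝ := nc z R ((1 / M) • (P - Q)) with hu
  have hplu : M • pl z R u = P - Q := by
    rw [hu, pl_nc z hR (Submodule.smul_mem _ _ hPQ), smul_smul, mul_one_div_cancel hM.ne', one_smul]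
  by_cases hu1 : ∀ β, |u β| ≤ 1
  · left
    have := (At_pl hn z hR zero_le_one hu1).smul (pl_mem _ _ _).1 M
    rw [hplu] at this
    refine this.mono_N hR.le ?_
    rw [abs_of_pos hM]; linarith
  right
  push Not at hu1
  obtain ⟨β1, hβ1⟩ := hu1
  have hne : (Finset.univ : Finset (MI m n)).Nonempty := ⟨β1, Finset.mem_univ _⟩
  obtain ⟨β0, -, hβ0⟩ := Finset.exists_max_image Finset.univ (fun β => |u β|) hne
  set t := |u β0| with ht
  have ht1 : 1 < t := lt_of_lt_of_le hβ1 (hβ0 β1 (Finset.mem_univ _))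
  have ht0 : 0 < t := by linarith
  set uh : MI m n → ℝ := (1 / t) • u with huh
  have huhb : ∀ β, |uh β| ≤ 1 := fun β => by
    simp only [huh, Pi.smul_apply, smul_eq_mul]
    rw [abs_mul, abs_of_pos (by positivity), one_div, inv_mul_le_iff₀ ht0, mul_one]
    exact hβ0 β (Finset.mem_univ _)
  have hpluh : M • pl z R uh = (1 / t) • (P - Q) := by
    rw [huh, map_smul, smul_comm, hplu]
  set X : Euc n → ℝ := (M / 2) • pl z R uh with hX
  have hX2 : Q + X + X = Q + M • pl z R uh := by simp only [hX]; module
  have hS : Sm (P - Q) := hPQ.1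
  have hMA : A * M ≤ 2 * A * M := by nlinarith
  have hQXX : Q + X + X ∈ Gam m E f l z (A * M) := by
    rw [hX2, hpluh]
    refine Gam_conv (a := 1 - 1/t) (b := 1/t) ?_ (by positivity) (by ring) hQ.1 hP ?_
    · have : 1 / t ≤ 1 := by rw [div_le_one ht0]; exact ht1.le
      linarith
    · module
  have hXe : X = (1 / (2 * t)) • (P - Q) := by
    have : X = (1/2 : ℝ) • (M • pl z R uh) := by simp only [hX]; module
    rw [this, hpluh, smul_smul]; congr 1; field_simp
  have huT : uh ∈ TT m E f l z R M (Q + X) (2 * A) := by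
    refine TT_of (s := 1 / A) X (Gam_mono hMA hQXX) (by
      rw [add_sub_cancel_right]; exact Gam_mono hMA hQ.1) ?_ ?_
    · rw [abs_of_pos (by positivity), div_le_one (by linarith)]; exact hA
    · simp only [hX]; rw [smul_smul]; congr 1; field_simp
  have hvT : ∀ v, v ∈ TT m E f l z R M Q A → v ∈ TT m E f l z R M (Q + X) (2 * A) := by
    intro v hv
    have hc : M / (2 * A) = (1/2) * (M / A) := by field_simp
    constructor
    · refine Gam_mono hMA (Gam_conv (a := 1/2) (b := 1/2) (by norm_num) (by norm_num) (by norm_num) hQXX hv.1 ?_)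
      rw [hc]; module
    · refine Gam_mono hMA (Gam_conv (a := 1/2) (b := 1/2) (by norm_num) (by norm_num) (by norm_num) hQXX hv.2 ?_)
      rw [hc]; module
  have hw : ∀ α : MI m n, ∃ v, α ∈ 𝒜 → v ∈ TT m E f l z R M Q A ∧ (∀ β ∈ 𝒜, v β = if β = α then 1 else 0)
      ∧ (∀ β, |v β| ≤ A) := by
    intro α
    by_cases hα : α ∈ 𝒜
    · obtain ⟨v, h1, h2, h3⟩ := hQ.2 α hα
      exact ⟨v, fun _ => ⟨h1, h2, h3⟩⟩
    · exact ⟨0, fun h => absurd h hα⟩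
  choose w hw using hw
  have hfam := hκ E f M R hM hR z (Q + X)
  obtain ⟨𝒜', h1, -, h3, h4⟩ := H _ hfam (TT_zero.2 (TT_base huT)) w (fun α hα => hvT _ (hw α hα).1)
    (fun α hα => (hw α hα).2.1) (fun α hα β _ => ((hw α hα).2.2 β).trans (by linarith)) (fun _ =>
      ⟨uh, huT, huhb, ⟨β0, by
        simp only [huh, Pi.smul_apply, smul_eq_mul]
        rw [abs_mul, abs_of_pos (by positivity), ← ht]; field_simp⟩, fun β hβ => by
        simp only [huh, hu, Pi.smul_apply, smul_eq_mul, nc]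
        rw [mD_smul hS, Pi.smul_apply, hW β hβ]; simp⟩)
  refine ⟨𝒜', Q + X, h1, h3 trivial, ⟨?_, FreeT.mono hfam hA' (le_max_left _ _) h4⟩, ?_, ?_⟩
  · exact Gam_mono (mul_le_mul_of_nonneg_right (le_max_right _ _) hM.le) (TT_base huT)
  · intro α hα y
    rw [add_sub_cancel_left, hXe, mD_smul hS, Pi.smul_apply, hW α hα]; simp
  · rw [add_sub_cancel_left]
    have := (At_pl hn z hR zero_le_one huhb).smul (pl_mem _ _ _).1 (M / 2)
    refine this.mono_N hR.le ?_
    rw [abs_of_pos (by positivity)]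
    have : (0:ℝ) ≤ n ^ m := by positivity
    nlinarith [mul_nonneg this hM.le]

/-- comparison of auxiliary polynomials -/
lemma cmp_aux (hm : 1 ≤ m) (hn : 1 ≤ n) (l : ℕ) (𝒜 : Set (MI m n)) {A : ℝ} (hA : 1 ≤ A) :
    ∃ A1 C : ℝ, 1 ≤ A1 ∧ 1 ≤ C ∧ ∀ (E : Set (Euc n)) (f : Euc n → ℝ) (M R : ℝ), 0 < M → 0 < R → ∀ (z w : Euc n)
    (Pz Pw : Euc n → ℝ), w ∈ E → ‖w - z‖ ≤ R → Pz ∈ Gam m E f (l + 1) z (A * M) → Free E f 𝒜 w Pw l R M A →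
    (∀ α ∈ 𝒜, ∀ y, mD α.1 (Pz - Pw) y = 0) → UpC 𝒜 →
    At m (Pz - Pw) w R (C * M) ∨
    ∃ (𝒜' : Set (MI m n)) (P' : Euc n → ℝ), UpC 𝒜' ∧ prec 𝒜' 𝒜 ∧ Free E f 𝒜' w P' l R M A1 ∧
      (∀ α ∈ 𝒜, ∀ y, mD α.1 (P' - Pw) y = 0) := by
  classical
  obtain ⟨A1, hA1, H⟩ := strict_step hm hn l 𝒜 (A := 2 * A) (by linarith)
  set K : ℝ := (Fintype.card (MI m n) : ℝ) with hK
  have hK0 : 0 ≤ K := by positivity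
  obtain ⟨lam, hl0, hl⟩ := exists_small (X := K * (2 * (2 ^ m * A)) * A) (e := 1/2) (by positivity) (by norm_num)
  set b := min lam (1/2) with hb
  have hb0 : 0 < b := lt_min hl0 (by norm_num)
  have hb1 : b ≤ 1/2 := min_le_right _ _
  have hbl := hl b (min_le_left _ _)
  have hnm : (1:ℝ) ≤ n ^ m := one_le_pow₀ (by exact_mod_cast hn)
  have h2m : (1:ℝ) ≤ 2 ^ m := one_le_pow₀ (by norm_num)
  refine ⟨A1, 2 * n ^ m / b + 2 ^ m * A, hA1, by
    have : 0 ≤ 2 * (n:ℝ) ^ m / b := by positivity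
    nlinarith, ?_⟩
  intro E f M R hM hR z w Pz Pw hw hzw hPz hPw hW hU
  obtain ⟨P2, hP2, hP2'⟩ := hPz.2 w hw
  have hPzp := Gam_pol hPz
  have hPwp := Gam_pol hPw.1
  have hP2p := Gam_pol hP2
  have hAM : 0 ≤ A * M := by positivity
  have hD : Pz - P2 ∈ Pol m n := Submodule.sub_mem _ hPzp hP2p
  have h1 : At m (Pz - P2) w R (2 ^ m * (A * M)) := by
    have := Pol.recenter hD (hP2'.mono_r hAM (norm_nonneg _) (show ‖z - w‖ ≤ R by rwa [norm_sub_rev])) hAM zero_le_one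
      hR.le (y := w) (by rwa [one_mul])
    norm_num at this ⊢
    exact this
  have hD2 : P2 - Pw ∈ Pol m n := Submodule.sub_mem _ hP2p hPwp
  have hD3 : Pz - Pw ∈ Pol m n := Submodule.sub_mem _ hPzp hPwp
  have hncb : ∀ α ∈ 𝒜, |nc w R (P2 - Pw) α| ≤ 2 ^ m * (A * M) := by
    intro α hα
    have e : P2 - Pw = (P2 - Pz) + (Pz - Pw) := by abel
    rw [e, nc_add _ _ (Sm.sub' hP2p.1 hPzp.1) hD3.1, Pi.add_apply]
    have : nc w R (Pz - Pw) α = 0 := by simp [nc, hW α hα]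
    rw [this, add_zero]
    exact abs_nc_le hR (Sm.sub' hP2p.1 hPzp.1) h1.symm α
  set a : MI m n → ℝ := fun α => if α ∈ 𝒜 then - (b / (1 - b)) * (nc w R (P2 - Pw) α / M) else 0 with ha
  have hbb : b / (1 - b) ≤ 2 * b := by
    rw [div_le_iff₀ (by linarith)]; nlinarith
  have hbb0 : 0 ≤ b / (1 - b) := div_nonneg hb0.le (by linarith)
  have hab : ∀ α, |a α| ≤ 2 * b * (2 ^ m * A) := by
    intro α
    simp only [ha]
    split_ifs with hα
    · rw [abs_mul, abs_neg, abs_of_nonneg hbb0, abs_div, abs_of_pos hM]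
      refine mul_le_mul hbb ?_ (by positivity) (by positivity)
      rw [div_le_iff₀ hM]
      exact (hncb α hα).trans (le_of_eq (by ring))
    · simp; positivity
  obtain ⟨Q, hQF, hQA, hQn⟩ := free_move hm hn hM hR hA hPw a (by
    have : ∑ γ, |a γ| ≤ K * (2 * b * (2 ^ m * A)) := by
      refine (Finset.sum_le_sum fun γ _ => hab γ).trans ?_
      rw [Finset.sum_const, nsmul_eq_mul, Finset.card_univ]
    refine (mul_le_mul_of_nonneg_right this (by linarith)).trans ?_
    linarith)
  have hQp := Gam_pol hQF.1
  have hQPw : Q - Pw ∈ Pol m n := Submodule.sub_mem _ hQp hPwp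
  set P3 : Euc n → ℝ := (1 - b) • Q + b • P2 with hP3
  have hP3G : P3 ∈ Gam m E f l w (2 * A * M) :=
    Gam_conv (by linarith) hb0.le (by ring) hQF.1 (Gam_mono (by nlinarith) hP2) rfl
  have e3 : P3 - Pw = (1 - b) • (Q - Pw) + b • (P2 - Pw) := by simp only [hP3]; module
  have hP3p := Gam_pol hP3G
  have hW3 : ∀ α ∈ 𝒜, ∀ y, mD α.1 (P3 - Pw) y = 0 := by
    apply W_inv hU (Submodule.sub_mem _ hP3p hPwp) (x := w)
    intro α hα
    have : nc w R (P3 - Pw) α = 0 := by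
      rw [e3, nc_add _ _ (Sm.smul' hQPw.1 _) (Sm.smul' hD2.1 _), nc_smul _ _ hQPw.1, nc_smul _ _ hD2.1]
      simp only [Pi.add_apply, Pi.smul_apply, smul_eq_mul]
      rw [hQn α hα]
      simp only [ha, if_pos hα]
      have : 1 - b ≠ 0 := by linarith
      field_simp; ring
    rw [nc, div_eq_zero_iff] at this
    rcases this with h | h
    · exact h
    · exact absurd h (by positivity)
  rcases H E f M R hM hR w P3 Pw (hPw.mono hm hn hM hR hA (by linarith)) hP3G hW3 with h | ⟨𝒜', P', h⟩
  · left
    have e4 : Pz - Pw = (1 / b) • ((P3 - Pw) - (1 - b) • (Q - Pw)) + (Pz - P2) := by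
      have : Pz - Pw = ((1 / b) * b) • (P2 - Pw) + (Pz - P2) := by
        rw [one_div_mul_cancel hb0.ne', one_smul]; abel
      rw [this, e3, add_sub_cancel_left, smul_smul]
    have hs3 : Sm (P3 - Pw) := Sm.sub' hP3p.1 hPwp.1
    have hsq : Sm ((1 - b) • (Q - Pw)) := Sm.smul' hQPw.1 _
    have := At.add (Sm.smul' (hs3.sub' hsq) _) hD.1
      ((At.sub hs3 hsq h (hQA.smul hQPw.1 (1 - b))).smul (hs3.sub' hsq) (1 / b)) h1
    rw [← e4] at this
    refine this.mono_N hR.le ?_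
    rw [abs_of_pos (by positivity), abs_of_pos (by linarith)]
    have h5 : (1 - b) * ((n:ℝ) ^ m * M) ≤ n ^ m * M := by
      have : 0 ≤ (n:ℝ) ^ m * M := by positivity
      nlinarith
    calc 1 / b * ((n:ℝ) ^ m * M + (1 - b) * (n ^ m * M)) + 2 ^ m * (A * M)
        ≤ 1 / b * ((n:ℝ) ^ m * M + n ^ m * M) + 2 ^ m * (A * M) := by gcongr
      _ = _ := by ring
  · right
    exact ⟨𝒜', P', h.1, h.2.1, h.2.2.1, h.2.2.2.1⟩

end
end
end

section
open scoped BigOperators ContDiff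

noncomputable section

section
variable {n m : ℕ} {E : Set (Euc n)} {f : Euc n → ℝ}

lemma stop_fn (OK : Euc n → ℝ → Prop) {κ rmin rmax : ℝ} (hκ : 0 < κ) (hr0 : 0 < rmin) (hrr : rmin ≤ rmax)
    (mono : ∀ x y r s, OK x r → 0 < s → ‖x - y‖ + κ * s ≤ κ * r → OK y s) (h : ∀ x, OK x rmin) :
    ∃ r : Euc n → ℝ, (∀ x, rmin / 2 ≤ r x) ∧ (∀ x, r x ≤ rmax / 2) ∧
      (∀ x y, r x - r y ≤ ‖x - y‖ / (2 * κ)) ∧ (∀ x, OK x (r x)) ∧ ∀ x, 4 * r x ≤ rmax → ¬ OK x (4 * r x) := by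
  set Z : Euc n → Set ℝ := fun x => {r | 0 < r ∧ r ≤ rmax ∧ OK x r} with hZ
  have hb : ∀ x, BddAbove (Z x) := fun x => ⟨rmax, fun r hr => hr.2.1⟩
  have hmem : ∀ x, rmin ∈ Z x := fun x => ⟨hr0, hrr, h x⟩
  have hle : ∀ x, rmin ≤ sSup (Z x) := fun x => le_csSup (hb x) (hmem x)
  have hge : ∀ x, sSup (Z x) ≤ rmax := fun x => csSup_le ⟨_, hmem x⟩ fun r hr => hr.2.1
  refine ⟨fun x => sSup (Z x) / 2, fun x => by linarith [hle x], fun x => by linarith [hge x], ?_, ?_, ?_⟩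
  · intro x y
    have key : sSup (Z x) ≤ sSup (Z y) + ‖x - y‖ / κ := by
      refine csSup_le ⟨_, hmem x⟩ fun r hr => ?_
      by_cases hs : r - ‖x - y‖ / κ ≤ 0
      · linarith [hle y]
      push Not at hs
      have : r - ‖x - y‖ / κ ∈ Z y := by
        refine ⟨hs, ?_, mono x y r _ hr.2.2 hs ?_⟩
        · have : 0 ≤ ‖x - y‖ / κ := by positivity
          linarith [hr.2.1]
        · rw [mul_sub, mul_div_cancel₀ _ hκ.ne']; linarith
      linarith [le_csSup (hb y) this]
    have e : ‖x - y‖ / (2 * κ) = (‖x - y‖ / κ) / 2 := by field_simp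
    rw [e]; linarith
  · intro x
    have h1 : sSup (Z x) / 2 < sSup (Z x) := by linarith [hle x]
    obtain ⟨r, hr, hlt⟩ := exists_lt_of_lt_csSup ⟨_, hmem x⟩ h1
    refine mono x x r _ hr.2.2 (by linarith [hle x]) ?_
    rw [sub_self, norm_zero, zero_add]
    exact mul_le_mul_of_nonneg_left hlt.le hκ.le
  · intro x h4 hOK
    have := le_csSup (hb x) (show 4 * (sSup (Z x) / 2) ∈ Z x from ⟨by linarith [hle x], h4, hOK⟩)
    linarith [hle x]

lemma dn_lin_sq {z y : Euc n} {ρ : ℝ} (hρ : 0 < ρ) (hy : ‖y - z‖ ≤ ρ) (i : Fin n) {j : ℕ} (hj : j ≤ m) :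
    dn j (lin z i * lin z i) y ≤ 2 ^ m * ρ * (ρ / ρ ^ m) * ρ ^ (m - j) := by
  have hl : |lin z i y| ≤ ρ := (PiLp.norm_apply_le (y - z) i).trans hy
  refine dn_mul_scale (Sm.lin z i) (Sm.lin z i) hρ hρ.le le_rfl hj (by positivity) ?_ ?_
  · intro k hk
    rcases Nat.lt_or_ge k 2 with h | h
    · interval_cases k
      · rw [dn_zero]; simpa using hl
      · refine (dn_lin_one z i y).trans ?_
        rw [pow_one, div_self hρ.ne']
    · rw [dn_lin_two z i h]; positivity
  · intro k hk
    rcases Nat.lt_or_ge k 2 with h | h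
    · interval_cases k
      · rw [dn_zero]; simp only [Nat.sub_zero]; rw [div_mul_cancel₀ _ (by positivity)]; exact hl
      · refine (dn_lin_one z i y).trans ?_
        have e : ρ ^ m = ρ ^ (m - 1) * ρ := by rw [← pow_succ]; congr 1; omega
        rw [e]; apply le_of_eq; field_simp
    · rw [dn_lin_two z i h]; positivity

lemma one_point (hm : 2 ≤ m) {z : Euc n} {P : Euc n → ℝ} {N ρ : ℝ} (hN : 0 ≤ N) (hρ : 0 < ρ)
    (hP : P ∈ Gam m E f 0 z N) :
    ∃ F, Sm F ∧ F z = f z ∧ (∀ y, ‖y - z‖ ≤ ρ → 0 ≤ F y) ∧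
      ∀ j ≤ m, ∀ y, ‖y - z‖ ≤ ρ → dn j (F - P) y ≤ n * 2 ^ m * N * ρ ^ (m - j) := by
  have hs : ∀ i ∈ (Finset.univ : Finset (Fin n)), Sm (lin z i * lin z i) := fun i _ => (Sm.lin z i).mul' (Sm.lin z i)
  have hq : ∀ y, (∑ i, lin z i * lin z i : Euc n → ℝ) y = ‖y - z‖ ^ 2 := by
    intro y
    rw [EuclideanSpace.norm_sq_eq, Finset.sum_apply]
    refine Finset.sum_congr rfl fun i _ => ?_
    simp [lin, sq]
  refine ⟨P + (N * ρ ^ (m - 2)) • ∑ i, lin z i * lin z i, hP.1.1.add' ((Sm.sum _ hs).smul' _), ?_, ?_, ?_⟩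
  · rw [Pi.add_apply, Pi.smul_apply, hq, hP.2.1]; simp
  · intro y hy
    rw [Pi.add_apply, Pi.smul_apply, hq, smul_eq_mul]
    refine (hP.2.2 y).trans ?_
    have e : ‖y - z‖ ^ m = ‖y - z‖ ^ (m - 2) * ‖y - z‖ ^ 2 := by rw [← pow_add]; congr 1; omega
    rw [e, mul_assoc]
    gcongr
  · intro j hj y hy
    rw [add_sub_cancel_left, dn_smul (Sm.sum _ hs), abs_of_nonneg (by positivity)]
    have h1 : dn j (∑ i, lin z i * lin z i) y ≤ n * (2 ^ m * ρ * (ρ / ρ ^ m) * ρ ^ (m - j)) := by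
      refine (dn_sum_le _ hs j y).trans ?_
      refine (Finset.sum_le_sum fun i _ => dn_lin_sq hρ hy i hj).trans ?_
      rw [Finset.sum_const, nsmul_eq_mul, Finset.card_univ, Fintype.card_fin]
    refine (mul_le_mul_of_nonneg_left h1 (by positivity)).trans (le_of_eq ?_)
    have e : ρ ^ m = ρ ^ (m - 2) * ρ ^ 2 := by rw [← pow_add]; congr 1; omega
    rw [e]
    field_simp

end
end
end

section
open scoped BigOperators ContDiff

noncomputable section

section
variable {n m : ℕ} {E : Set (Euc n)} {f : Euc n → ℝ}

lemma glue (m n : ℕ) : ∃ C : ℝ, 1 ≤ C ∧ ∀ X : Set (Euc n), Bornology.IsBounded X →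
    ∀ (ρ : Euc n → ℝ) (a b : ℝ), 0 < a → (∀ x ∈ X, a ≤ ρ x) → (∀ x ∈ X, ρ x ≤ b) →
    (∀ x ∈ X, ∀ y ∈ X, ρ x - ρ y ≤ ‖x - y‖ / 20) →
    ∀ (E : Set (Euc n)) (f : Euc n → ℝ) (Fs Ps : Euc n → Euc n → ℝ) (D : ℝ), 0 ≤ D →
    (∀ s ∈ X, Sm (Fs s)) → (∀ s ∈ X, Sm (Ps s)) →
    (∀ s ∈ X, ∀ y, ‖y - s‖ ≤ ρ s → 0 ≤ Fs s y) →
    (∀ s ∈ X, ∀ y ∈ E, ‖y - s‖ ≤ ρ s → Fs s y = f y) →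
    (∀ s ∈ X, ∀ j ≤ m, ∀ y, ‖y - s‖ ≤ ρ s → dn j (Fs s - Ps s) y ≤ D * ρ s ^ (m - j)) →
    (∀ s ∈ X, ∀ x ∈ X, ‖x - s‖ ≤ ρ s → ∀ j ≤ m, dn j (Ps s - Ps x) x ≤ D * ρ s ^ (m - j)) →
    ∃ F, Sm F ∧ (∀ y, 0 ≤ F y) ∧ (∀ y ∈ E, y ∈ X → F y = f y) ∧
      ∀ x ∈ X, ∀ j ≤ m, dn j (F - Ps x) x ≤ C * D * b ^ (m - j) := by
  classical
  obtain ⟨C, hC, H⟩ := pou m n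
  have h2m : (1:ℝ) ≤ 2 ^ m := one_le_pow₀ (by norm_num)
  refine ⟨C * (2 ^ m * C * 2), by
    have h1 : 1 ≤ C * C := by nlinarith
    nlinarith, ?_⟩
  intro X hX ρ a b ha hρa hρb hρ E f Fs Ps D hD hFs hPs hpos hval hFP hPP
  obtain ⟨S, hSX, θ, hθ, hθ0, hθs, hθd, hθ1, hcard⟩ := H X hX ρ a b ha hρa hρb hρ
  have hzero : ∀ s ∈ S, ∀ y, ρ s < ‖y - s‖ → θ s y = 0 := fun s hs y h => (hθs s hs y h).eq_of_nhds
  refine ⟨∑ s ∈ S, θ s * Fs s, Sm.sum _ fun s hs => (hθ s hs).mul' (hFs s (hSX s hs)), ?_, ?_, ?_⟩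
  · intro y
    rw [Finset.sum_apply]
    refine Finset.sum_nonneg fun s hs => ?_
    rw [Pi.mul_apply]
    by_cases h : ρ s < ‖y - s‖
    · rw [hzero s hs y h, zero_mul]
    · exact mul_nonneg (hθ0 s hs y) (hpos s (hSX s hs) y (not_lt.1 h))
  · intro y hyE hyX
    have h1 := (hθ1 y hyX).eq_of_nhds
    rw [Finset.sum_apply, Pi.one_apply] at h1
    rw [Finset.sum_apply]
    calc ∑ s ∈ S, (θ s * Fs s) y = ∑ s ∈ S, θ s y * f y := by
          refine Finset.sum_congr rfl fun s hs => ?_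
          rw [Pi.mul_apply]
          by_cases h : ρ s < ‖y - s‖
          · rw [hzero s hs y h, zero_mul, zero_mul]
          · rw [hval s (hSX s hs) y hyE (not_lt.1 h)]
      _ = f y := by rw [← Finset.sum_mul, h1, one_mul]
  · intro x hx j hj
    have hb : 0 < b := lt_of_lt_of_le ha ((hρa x hx).trans (hρb x hx))
    have hloc : (∑ s ∈ S, θ s * Fs s) - Ps x =ᶠ[nhds x] ∑ s ∈ S, θ s * (Fs s - Ps x) := by
      filter_upwards [hθ1 x hx] with y hy
      rw [Finset.sum_apply, Pi.one_apply] at hy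
      simp only [Pi.sub_apply, Finset.sum_apply, Pi.mul_apply, mul_sub, Finset.sum_sub_distrib]
      rw [← Finset.sum_mul, hy, one_mul]
    rw [dn_congr hloc]
    have hsm : ∀ s ∈ S, Sm (Fs s - Ps x) := fun s hs => (hFs s (hSX s hs)).sub' (hPs x hx)
    have := dn_sum_le_filter (S := S) (F := fun s => θ s * (Fs s - Ps x)) (p := fun s => ‖x - s‖ ≤ ρ s)
      (fun s hs => (hθ s hs).mul' (hsm s hs)) j (x := x) (B := 2 ^ m * C * (2 * D) * b ^ (m - j)) (by positivity)
      (fun s hs h => by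
        filter_upwards [hθs s hs x (not_le.1 h)] with y hy
        rw [Pi.mul_apply, hy]; simp)
      (fun s hs h => by
        have hsX := hSX s hs
        have hρ0 : 0 < ρ s := lt_of_lt_of_le ha (hρa s hsX)
        refine (dn_mul_scale (hθ s hs) (hsm s hs) (r := ρ s) (s := ρ s) (m := m) (B := C) (N := 2 * D) hρ0 hρ0.le le_rfl hj (by positivity)
          (fun i hi => hθd s hs i (hi.trans hj) x) ?_).trans ?_
        · intro i hi
          have e : Fs s - Ps x = (Fs s - Ps s) + (Ps s - Ps x) := by abel
          rw [e]
          refine (dn_add_le ((hFs s hsX).sub' (hPs s hsX)) ((hPs s hsX).sub' (hPs x hx)) i x).trans ?_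
          have h1 := hFP s hsX i (hi.trans hj) x h
          have h2 := hPP s hsX x hx h i (hi.trans hj)
          linarith
        · have := hρb s hsX
          gcongr)
      (hcard x)
    refine this.trans (le_of_eq (by ring))

end
end
end

section
open scoped BigOperators ContDiff

noncomputable section

/-- the set of free multi-indices can be improved at `(z, r)` -/
def Imp {n m : ℕ} (E : Set (Euc n)) (f : Euc n → ℝ) (𝒜 : Set (MI m n)) (P0 : Euc n → ℝ) (l : ℕ) (M A : ℝ)
    (z : Euc n) (r : ℝ) : Prop :=
  ∃ (𝒜' : Set (MI m n)) (P : Euc n → ℝ), UpC 𝒜' ∧ prec 𝒜' 𝒜 ∧ (∀ α ∈ 𝒜, ∀ y, mD α.1 (P - P0) y = 0) ∧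
    Free E f 𝒜' z P l r M A

section
variable {n m : ℕ} {E : Set (Euc n)} {f : Euc n → ℝ}

instance : Finite (Set (MI m n)) := by classical infer_instance

lemma free_relabel_unif (hm : 1 ≤ m) (hn : 1 ≤ n) (l : ℕ) {A : ℝ} (hA : 1 ≤ A) :
    ∃ A' : ℝ, 1 ≤ A' ∧ ∀ (𝒜 : Set (MI m n)) (E : Set (Euc n)) (f : Euc n → ℝ) (M δ r : ℝ), 0 < M → 0 < r → r ≤ δ →
    ∀ (x : Euc n) (P : Euc n → ℝ), Free E f 𝒜 x P l δ M A →
    ∃ 𝒜' : Set (MI m n), UpC 𝒜' ∧ (𝒜' = 𝒜 ∨ prec 𝒜' 𝒜) ∧ Free E f 𝒜' x P l r M A' := by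
  choose a ha H using fun 𝒜 : Set (MI m n) => free_relabel hm hn l 𝒜 hA
  obtain ⟨𝒜0, h0⟩ := Finite.exists_max a
  refine ⟨a 𝒜0, ha _, ?_⟩
  intro 𝒜 E f M δ r hM hr hrδ x P h
  obtain ⟨𝒜', h1, h2, h3⟩ := H 𝒜 E f M δ r hM hr hrδ x P h
  exact ⟨𝒜', h1, h2, h3.mono hm hn hM hr (ha _) (h0 𝒜)⟩

lemma At_self (P : Euc n → ℝ) (x : Euc n) {r N : ℝ} (hr : 0 ≤ r) (hN : 0 ≤ N) : At m (P - P) x r N := by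
  intro j hj
  rw [sub_self]
  have : (0 : Euc n → ℝ) = (0:ℝ) • 0 := by simp
  rw [this, dn_smul Sm.zero, abs_zero, zero_mul]
  positivity

lemma W_add {𝒜 : Set (MI m n)} {P Q R : Euc n → ℝ} (hP : Sm P) (hQ : Sm Q) (hR : Sm R)
    (h1 : ∀ α ∈ 𝒜, ∀ y, mD α.1 (P - Q) y = 0) (h2 : ∀ α ∈ 𝒜, ∀ y, mD α.1 (Q - R) y = 0) :
    ∀ α ∈ 𝒜, ∀ y, mD α.1 (P - R) y = 0 := by
  intro α hα y
  have e : P - R = (P - Q) + (Q - R) := by abel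
  rw [e, mD_add (hP.sub' hQ) (hQ.sub' hR), Pi.add_apply, h1 α hα, h2 α hα, add_zero]

lemma W_symm {𝒜 : Set (MI m n)} {P Q : Euc n → ℝ} (hP : Sm P) (hQ : Sm Q)
    (h1 : ∀ α ∈ 𝒜, ∀ y, mD α.1 (P - Q) y = 0) :
    ∀ α ∈ 𝒜, ∀ y, mD α.1 (Q - P) y = 0 := by
  intro α hα y
  have := h1 α hα y
  rw [mD_sub hP hQ, Pi.sub_apply] at this
  rw [mD_sub hQ hP, Pi.sub_apply]; linarith

lemma aux_step (hm : 1 ≤ m) (hn : 1 ≤ n) (L : ℕ) {𝒜 : Set (MI m n)} (hU : UpC 𝒜) {A : ℝ} (hA : 1 ≤ A) :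
    ∃ c0 A' A1 A2 C : ℝ, 0 < c0 ∧ c0 ≤ 1 ∧ 1 ≤ A' ∧ 1 ≤ A2 ∧ 1 ≤ C ∧
    ∀ (E : Set (Euc n)) (f : Euc n → ℝ) (M δ : ℝ), 0 < M → 0 < δ →
    ∀ (x0 : Euc n) (P0 : Euc n → ℝ), Free E f 𝒜 x0 P0 (L + 2) δ M A →
    ∃ Pz : Euc n → Euc n → ℝ,
      (∀ z ∈ E, ‖z - x0‖ ≤ c0 * δ → Pz z ∈ Gam m E f 0 z (A' * M) ∧ At m (Pz z - P0) z δ (A' * M)) ∧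
      (∀ z ∈ E, ‖z - x0‖ ≤ c0 * δ → ∀ R r', 0 < R → R ≤ δ → R ≤ r' → Imp E f 𝒜 P0 L M A1 z r' →
        ∃ (𝒜' : Set (MI m n)) (P : Euc n → ℝ), UpC 𝒜' ∧ prec 𝒜' 𝒜 ∧ Free E f 𝒜' z P L R M A2 ∧
          At m (P - Pz z) z R (C * M)) ∧
      (∀ z ∈ E, ∀ w ∈ E, ‖z - x0‖ ≤ c0 * δ → ‖w - x0‖ ≤ c0 * δ → ∀ R, 0 < R → R ≤ δ → ‖w - z‖ ≤ R →
        ¬ Imp E f 𝒜 P0 L M A1 w R → At m (Pz z - Pz w) w R (C * M)) := by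
  classical
  obtain ⟨c0, A', hc0, hc01, hA', hS1⟩ := S1 hm hn (L + 1) hU hA
  obtain ⟨Ar, hAr, hrel⟩ := free_relabel_unif (n := n) hm hn L hA'
  have hAs : 1 ≤ max A' Ar := le_max_of_le_left hA'
  obtain ⟨A1c, Cc, hA1c, hCc, hcmp⟩ := cmp_aux hm hn L 𝒜 hAs
  have hA1 : 1 ≤ max A1c Ar := le_max_of_le_left hA1c
  set A1 := max A1c Ar with hA1d
  obtain ⟨Ast, hAst, hstr⟩ := strict_step hm hn L 𝒜 (A := max Ar A1) (le_max_of_le_left hAr)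
  obtain ⟨Arel, hArel, hrel2⟩ := free_relabel_unif (n := n) hm hn L hA1
  set A2 := max Ast (max Arel Ar) with hA2d
  have h21 : Ast ≤ A2 := le_max_left _ _
  have h22 : Arel ≤ A2 := (le_max_left _ _).trans (le_max_right _ _)
  have h23 : Ar ≤ A2 := (le_max_right _ _).trans (le_max_right _ _)
  set C := max ((n:ℝ) ^ m) Cc with hC
  refine ⟨c0, A', A1, A2, C, hc0, hc01, hA', hAst.trans h21, le_max_of_le_right hCc, ?_⟩
  intro E f M δ hM hδ x0 P0 hF
  have hP0 : Sm P0 := Gam_sm hF.1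
  have hex : ∀ z : Euc n, ∃ P, z ∈ E → ‖z - x0‖ ≤ c0 * δ → P ∈ Pol m n ∧ (∀ α ∈ 𝒜, ∀ y, mD α.1 (P - P0) y = 0) ∧
      Free E f 𝒜 z P (L + 1) δ M A' ∧ At m (P - P0) z δ (A' * M) := by
    intro z
    by_cases hz : z ∈ E ∧ ‖z - x0‖ ≤ c0 * δ
    · obtain ⟨P, h1, h2⟩ := hS1 E f M δ hM hδ x0 P0 hF z hz.1 hz.2
      exact ⟨P, fun _ _ => ⟨h1, h2⟩⟩
    · exact ⟨0, fun h h' => absurd ⟨h, h'⟩ hz⟩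
  choose Pz hPz using hex
  refine ⟨Pz, ?_, ?_, ?_⟩
  · intro z hz hzx
    obtain ⟨-, -, h3, h4⟩ := hPz z hz hzx
    exact ⟨Gam_zero h3.1, h4⟩
  · intro z hz hzx R r' hR hRδ hRr hImp
    obtain ⟨h1, h2, h3, h4⟩ := hPz z hz hzx
    obtain ⟨𝒜1, hu1, hp1, hf1⟩ := hrel 𝒜 E f M δ R hM hR hRδ z (Pz z) (h3.le (Nat.le_succ _))
    have hnC : (n:ℝ) ^ m * M ≤ C * M := mul_le_mul_of_nonneg_right (le_max_left _ _) hM.le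
    rcases hp1 with rfl | hp1
    swap
    · exact ⟨𝒜1, Pz z, hu1, hp1, hf1.mono hm hn hM hR hAr h23, At_self _ _ hR.le (by
        have : 0 ≤ C := le_trans (by positivity) (le_max_left ((n:ℝ)^m) Cc)
        positivity)⟩
    obtain ⟨𝒜2, P, hu2, hp2, hW, hf2⟩ := hImp
    have hPs : Sm P := Gam_sm hf2.1
    rcases hstr E f M R hM hR z P (Pz z) (hf1.mono hm hn hM hR hAr (le_max_left _ _))
      (Gam_mono (mul_le_mul_of_nonneg_right (le_max_right _ _) hM.le) hf2.1)
      (W_add hPs hP0 h1.1 hW (W_symm h1.1 hP0 h2)) with h | ⟨𝒜3, P3, hu3, hp3, hf3, hW3, hA3⟩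
    · obtain ⟨𝒜4, hu4, hp4, hf4⟩ := hrel2 𝒜2 E f M r' R hM hR hRr z P hf2
      refine ⟨𝒜4, P, hu4, ?_, hf4.mono hm hn hM hR hArel h22, h.mono_N hR.le hnC⟩
      rcases hp4 with rfl | hp4
      · exact hp2
      · exact prec_trans hp4 hp2
    · exact ⟨𝒜3, P3, hu3, hp3, hf3.mono hm hn hM hR hAst h21, hA3.mono_N hR.le hnC⟩
  · intro z hz w hw hzx hwx R hR hRδ hwz hnot
    obtain ⟨h1, h2, h3, h4⟩ := hPz z hz hzx
    obtain ⟨k1, k2, k3, k4⟩ := hPz w hw hwx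
    obtain ⟨𝒜1, hu1, hp1, hf1⟩ := hrel 𝒜 E f M δ R hM hR hRδ w (Pz w) (k3.le (Nat.le_succ _))
    rcases hp1 with rfl | hp1
    swap
    · exact absurd ⟨𝒜1, Pz w, hu1, hp1, k2, hf1.mono hm hn hM hR hAr (le_max_right _ _)⟩ hnot
    rcases hcmp E f M R hM hR z w (Pz z) (Pz w) hw hwz
      (Gam_mono (mul_le_mul_of_nonneg_right (le_max_left _ _) hM.le) h3.1)
      (hf1.mono hm hn hM hR hAr (le_max_right _ _))
      (W_add h1.1 hP0 k1.1 h2 (W_symm k1.1 hP0 k2)) hU with h | ⟨𝒜3, P3, hu3, hp3, hf3, hW3⟩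
    · exact h.mono_N hR.le (mul_le_mul_of_nonneg_right (le_max_right _ _) hM.le)
    · exact absurd ⟨𝒜3, P3, hu3, hp3, W_add (Gam_sm hf3.1) k1.1 hP0 hW3 k2,
        hf3.mono hm hn hM hR hA1c (le_max_left _ _)⟩ hnot

end
end
end

section
open scoped BigOperators ContDiff

noncomputable section

/-- the local main lemma for a given set of free multi-indices -/
def ML (m n : ℕ) (𝒜 : Set (MI m n)) (l : ℕ) : Prop :=
  ∀ A : ℝ, 1 ≤ A → ∃ c C : ℝ, 0 < c ∧ c ≤ 1 ∧ 0 ≤ C ∧ ∀ (E : Set (Euc n)), E.Finite → ∀ (f : Euc n → ℝ) (M δ : ℝ)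
    (x0 : Euc n) (P0 : Euc n → ℝ), 0 < M → 0 < δ → x0 ∈ E → Free E f 𝒜 x0 P0 l δ M A →
    ∃ F, Sm F ∧ ∀ y, ‖y - x0‖ ≤ c * δ → 0 ≤ F y ∧ (y ∈ E → F y = f y) ∧ ∀ j ≤ m, dn j (F - P0) y ≤ C * M * δ ^ (m - j)

section
variable {n m : ℕ} {E : Set (Euc n)} {f : Euc n → ℝ}

lemma ML.le {𝒜 : Set (MI m n)} {l l' : ℕ} (hl : l ≤ l') (h : ML m n 𝒜 l) : ML m n 𝒜 l' := by
  intro A hA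
  obtain ⟨c, C, h1, h2, h3, H⟩ := h A hA
  exact ⟨c, C, h1, h2, h3, fun E hE f M δ x0 P0 hM hδ hx h => H E hE f M δ x0 P0 hM hδ hx (h.le hl)⟩

lemma pow_scale {a r : ℝ} (ha : 1 ≤ a) (hr : 0 ≤ r) (j : ℕ) : (a * r) ^ (m - j) ≤ a ^ m * r ^ (m - j) := by
  rw [mul_pow]
  have : a ^ (m - j) ≤ a ^ m := pow_le_pow_right₀ ha (Nat.sub_le _ _)
  gcongr

lemma sep_finite (hE : E.Finite) {κ rmax : ℝ} (hκ : 0 < κ) (hr : 0 < rmax) : ∃ rmin, 0 < rmin ∧ rmin ≤ rmax ∧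
    ∀ z ∈ E, ∀ z' ∈ E, ‖z - z'‖ ≤ κ * rmin → z = z' := by
  classical
  have : ∀ p : E × E, ∃ e : ℝ, 0 < e ∧ (‖p.1.1 - p.2.1‖ ≤ κ * e → p.1.1 = p.2.1) := by
    intro p
    by_cases h : p.1.1 = p.2.1
    · exact ⟨1, one_pos, fun _ => h⟩
    · have h0 : 0 < ‖p.1.1 - p.2.1‖ := norm_pos_iff.2 (sub_ne_zero.2 h)
      refine ⟨‖p.1.1 - p.2.1‖ / (2 * κ), by positivity, fun h' => ?_⟩
      have : κ * (‖p.1.1 - p.2.1‖ / (2 * κ)) = ‖p.1.1 - p.2.1‖ / 2 := by field_simp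
      linarith
  choose e he1 he2 using this
  have := hE.to_subtype
  rcases isEmpty_or_nonempty (E × E) with hem | hne
  · refine ⟨rmax, hr, le_refl _, fun z hz z' hz' _ => (hem.false (⟨z, hz⟩, ⟨z', hz'⟩)).elim⟩
  · obtain ⟨p0, hp0⟩ := Finite.exists_min e
    refine ⟨min (e p0) rmax, lt_min (he1 _) hr, min_le_right _ _, fun z hz z' hz' h => ?_⟩
    refine he2 (⟨z, hz⟩, ⟨z', hz'⟩) (h.trans ?_)
    have := (min_le_left (e p0) rmax).trans (hp0 (⟨z, hz⟩, ⟨z', hz'⟩))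
    gcongr

set_option maxHeartbeats 2000000 in
lemma ML_step (hm : 2 ≤ m) (hn : 1 ≤ n) {𝒜 : Set (MI m n)} (hU : UpC 𝒜) (L : ℕ)
    (hL : ∀ 𝒜', UpC 𝒜' → prec 𝒜' 𝒜 → ML m n 𝒜' L) : ML m n 𝒜 (L + 2) := by
  classical
  intro A hA
  obtain ⟨c0, A', A1, A2, C, hc0, hc01, hA', hA2, hC, haux⟩ := aux_step (by omega) hn L hU hA
  -- uniform constants from the induction hypothesis
  have hIH : ∃ k CI : ℝ, 0 < k ∧ k ≤ 1 ∧ 0 ≤ CI ∧ ∀ 𝒜' : Set (MI m n), UpC 𝒜' → prec 𝒜' 𝒜 →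
      ∀ (E : Set (Euc n)), E.Finite → ∀ (f : Euc n → ℝ) (M δ : ℝ)
    (x0 : Euc n) (P0 : Euc n → ℝ), 0 < M → 0 < δ → x0 ∈ E → Free E f 𝒜' x0 P0 L δ M A2 →
    ∃ F, Sm F ∧ ∀ y, ‖y - x0‖ ≤ k * δ → 0 ≤ F y ∧ (y ∈ E → F y = f y) ∧
      ∀ j ≤ m, dn j (F - P0) y ≤ CI * M * δ ^ (m - j) := by
    have : ∀ 𝒜' : Set (MI m n), ∃ k CI : ℝ, 0 < k ∧ k ≤ 1 ∧ 0 ≤ CI ∧ (UpC 𝒜' → prec 𝒜' 𝒜 →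
      ∀ (E : Set (Euc n)), E.Finite → ∀ (f : Euc n → ℝ) (M δ : ℝ)
      (x0 : Euc n) (P0 : Euc n → ℝ), 0 < M → 0 < δ → x0 ∈ E → Free E f 𝒜' x0 P0 L δ M A2 →
      ∃ F, Sm F ∧ ∀ y, ‖y - x0‖ ≤ k * δ → 0 ≤ F y ∧ (y ∈ E → F y = f y) ∧
      ∀ j ≤ m, dn j (F - P0) y ≤ CI * M * δ ^ (m - j)) := by
      intro 𝒜'
      by_cases h : UpC 𝒜' ∧ prec 𝒜' 𝒜
      · obtain ⟨c, C, h1, h2, h3, h4⟩ := hL 𝒜' h.1 h.2 A2 hA2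
        exact ⟨c, C, h1, h2, h3, fun _ _ => h4⟩
      · exact ⟨1, 0, one_pos, le_refl _, le_refl _, fun a b => (h ⟨a, b⟩).elim⟩
    choose k CI h1 h2 h3 h4 using this
    obtain ⟨a, ha⟩ := Finite.exists_min k
    obtain ⟨b, hb⟩ := Finite.exists_max CI
    refine ⟨k a, CI b, h1 a, h2 a, h3 b, ?_⟩
    intro 𝒜' hu hp E hE f M δ x0 P0 hM hδ hx hF
    obtain ⟨F, hF1, hF2⟩ := h4 𝒜' hu hp E hE f M δ x0 P0 hM hδ hx hF
    refine ⟨F, hF1, fun y hy => ?_⟩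
    have := ha 𝒜'
    obtain ⟨g1, g2, g3⟩ := hF2 y (hy.trans (by gcongr))
    refine ⟨g1, g2, fun j hj => (g3 j hj).trans ?_⟩
    have := hb 𝒜'
    gcongr
  obtain ⟨k, CI, hk, hk1, hCI, IH⟩ := hIH
  obtain ⟨Cg, hCg, hglue⟩ := glue m n
  set Λ : ℝ := 30 / k with hΛd
  have hΛ30 : 30 ≤ Λ := by rw [hΛd, le_div_iff₀ hk]; nlinarith
  have hkΛ : k * Λ = 30 := by rw [hΛd]; field_simp
  set c1 : ℝ := min (k / 30) (c0 / 30) with hc1d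
  have hc1 : 0 < c1 := lt_min (by positivity) (by positivity)
  have hc1a : Λ * c1 ≤ 1 := by
    have : c1 ≤ k / 30 := min_le_left _ _
    have h2 : Λ * (k / 30) = 1 := by rw [hΛd]; field_simp
    nlinarith
  have hc1b : 30 * c1 ≤ c0 := by
    have : c1 ≤ c0 / 30 := min_le_right _ _
    linarith
  have hc11 : 30 * c1 ≤ 1 := hc1b.trans hc01
  set D1 : ℝ := n * 2 ^ m * A' * 50 ^ m + (CI + 2 ^ m * C) * Λ ^ m with hD1
  set D2 : ℝ := 2 ^ m * (2 * C) * (4 * Λ) ^ m + 2 * (2 ^ m * A') * (4 / c1) ^ m with hD2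
  have hD10 : 0 ≤ D1 := by positivity
  have hD20 : 0 ≤ D2 := by positivity
  refine ⟨c1, Cg * (D1 + D2) + 2 ^ m * A', hc1, by linarith, by positivity, ?_⟩
  intro E hE f M δ x0 P0 hM hδ hx0 hFree
  obtain ⟨Pz, hPz1, hPz2, hPz3⟩ := haux E f M δ hM hδ x0 P0 hFree
  have hP0 : P0 ∈ Pol m n := Gam_pol hFree.1
  set OK : Euc n → ℝ → Prop := fun x r =>
    (∀ z ∈ E, ∀ z' ∈ E, ‖z - x‖ ≤ 10 * r → ‖z' - x‖ ≤ 10 * r → z = z') ∨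
    (∀ z ∈ E, ‖z - x‖ ≤ 10 * r → ∃ r', Λ * r ≤ r' ∧ Imp E f 𝒜 P0 L M A1 z r') with hOK
  have hrmax : 0 < c1 * δ := by positivity
  obtain ⟨rmin, hrm0, hrm1, hrm2⟩ := sep_finite hE (κ := 20) (by norm_num) hrmax
  have mono : ∀ x y r s, OK x r → 0 < s → ‖x - y‖ + 10 * s ≤ 10 * r → OK y s := by
    intro x y r s h hs hr
    have tr : ∀ z : Euc n, ‖z - y‖ ≤ 10 * s → ‖z - x‖ ≤ 10 * r := by
      intro z hz
      have := norm_sub_le_norm_sub_add_norm_sub z y x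
      rw [norm_sub_rev y x] at this
      linarith
    have hsr : s ≤ r := by linarith [norm_nonneg (x - y)]
    rcases h with h | h
    · exact Or.inl fun z hz z' hz' h1 h2 => h z hz z' hz' (tr z h1) (tr z' h2)
    · refine Or.inr fun z hz h1 => ?_
      obtain ⟨r', hr', h2⟩ := h z hz (tr z h1)
      refine ⟨r', le_trans ?_ hr', h2⟩
      gcongr
  have hmin : ∀ x, OK x rmin := by
    intro x
    refine Or.inl fun z hz z' hz' h1 h2 => hrm2 z hz z' hz' ?_
    have := norm_sub_le_norm_sub_add_norm_sub z x z'
    rw [norm_sub_rev x z'] at this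
    linarith
  obtain ⟨r, hr1, hr2, hr3, hr4, hr5⟩ := stop_fn OK (by norm_num) hrm0 hrm1 mono hmin
  have hr0 : ∀ x, 0 < r x := fun x => by linarith [hr1 x]
  -- two points witness
  have hnot : ∀ x, 4 * r x ≤ c1 * δ → ∃ w ∈ E, ‖w - x‖ ≤ 40 * r x ∧ ∀ r', 4 * Λ * r x ≤ r' → ¬ Imp E f 𝒜 P0 L M A1 w r' := by
    intro x hx
    have := hr5 x hx
    simp only [hOK, not_or] at this
    obtain ⟨-, h2⟩ := this
    push Not at h2
    obtain ⟨w, hw, h3, h4⟩ := h2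
    exact ⟨w, hw, by linarith, fun r' hr' => h4 r' (by linarith)⟩
  have hzx : ∀ x, ∃ z, ‖x - x0‖ ≤ c1 * δ → z ∈ E ∧ ‖z - x‖ ≤ 40 * r x ∧
      ((∃ z' ∈ E, ‖z' - x‖ ≤ 10 * r x) → ‖z - x‖ ≤ 10 * r x) := by
    intro x
    by_cases h1 : ∃ z' ∈ E, ‖z' - x‖ ≤ 10 * r x
    · obtain ⟨z', h2, h3⟩ := h1
      exact ⟨z', fun _ => ⟨h2, by linarith [hr0 x], fun _ => h3⟩⟩
    · by_cases h2 : 4 * r x ≤ c1 * δ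
      · obtain ⟨w, hw, h3, -⟩ := hnot x h2
        exact ⟨w, fun _ => ⟨hw, h3, fun h => (h1 h).elim⟩⟩
      · refine ⟨x0, fun hx => ⟨hx0, ?_, fun h => (h1 h).elim⟩⟩
        rw [norm_sub_rev]
        linarith [hr0 x]
  choose zz hzz using hzx
  have hz0 : ∀ x z : Euc n, ‖x - x0‖ ≤ c1 * δ → ‖z - x‖ ≤ 40 * r x → ‖z - x0‖ ≤ c0 * δ := by
    intro x z hx hz
    have := norm_sub_le_norm_sub_add_norm_sub z x x0
    have := hr2 x
    nlinarith
  have hpol : ∀ x, ‖x - x0‖ ≤ c1 * δ → Pz (zz x) ∈ Pol m n := fun x hx =>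
    Gam_pol (hPz1 _ (hzz x hx).1 (hz0 x _ hx (hzz x hx).2.1)).1
  have hΛδ : ∀ x, 2 * Λ * r x ≤ δ := by
    intro x
    have := hr2 x
    have h2 : Λ * (c1 * δ) ≤ δ := by nlinarith
    nlinarith
  -- local solutions
  have hloc : ∀ s, ∃ F, ‖s - x0‖ ≤ c1 * δ → Sm F ∧ ∀ y, ‖y - s‖ ≤ r s → 0 ≤ F y ∧ (y ∈ E → F y = f y) ∧
      ∀ j ≤ m, dn j (F - Pz (zz s)) y ≤ D1 * M * r s ^ (m - j) := by
    intro s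
    by_cases hs : ‖s - x0‖ ≤ c1 * δ
    swap
    · exact ⟨0, fun h => (hs h).elim⟩
    obtain ⟨hz1, hz2, hz3⟩ := hzz s hs
    have hzc := hz0 s _ hs hz2
    have hr0s := hr0 s
    by_cases hone : ∀ z ∈ E, ∀ z' ∈ E, ‖z - s‖ ≤ 10 * r s → ‖z' - s‖ ≤ 10 * r s → z = z'
    · obtain ⟨F, hF1, hF2, hF3, hF4⟩ := one_point hm (N := A' * M) (ρ := 50 * r s) (by positivity) (by positivity)
        (hPz1 _ hz1 hzc).1
      refine ⟨F, fun _ => ⟨hF1, fun y hy => ?_⟩⟩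
      have hyz : ‖y - zz s‖ ≤ 50 * r s := by
        have := norm_sub_le_norm_sub_add_norm_sub y s (zz s)
        rw [norm_sub_rev s] at this
        linarith
      refine ⟨hF3 y hyz, fun hyE => ?_, fun j hj => (hF4 j hj y hyz).trans ?_⟩
      · have hy10 : ‖y - s‖ ≤ 10 * r s := by linarith
        have := hone y hyE _ hz1 hy10 (hz3 ⟨y, hyE, hy10⟩)
        rw [this, hF2]
      · have h1 := pow_scale (m := m) (a := 50) (by norm_num) hr0s.le j
        calc (n:ℝ) * 2 ^ m * (A' * M) * (50 * r s) ^ (m - j)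
            ≤ (n:ℝ) * 2 ^ m * (A' * M) * (50 ^ m * r s ^ (m - j)) := by gcongr
          _ = (n * 2 ^ m * A' * 50 ^ m) * M * r s ^ (m - j) := by ring
          _ ≤ D1 * M * r s ^ (m - j) := by
            have : (n * 2 ^ m * A' * 50 ^ m) ≤ D1 := le_add_of_nonneg_right (by positivity)
            gcongr
    · have hokk := (hr4 s).resolve_left hone
      push Not at hone
      obtain ⟨z', hz', -, -, h10, -⟩ := hone
      have hz10 := hz3 ⟨z', hz', h10⟩
      obtain ⟨r', hr', himp⟩ := hokk _ hz1 hz10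
      have hR0 : 0 < Λ * r s := by positivity
      obtain ⟨𝒜', P, hu, hp, hfr, hat⟩ := hPz2 _ hz1 hzc (Λ * r s) r' hR0
        (by linarith [hΛδ s]) hr' himp
      obtain ⟨F, hF1, hF2⟩ := IH 𝒜' hu hp E hE f M (Λ * r s) (zz s) P hM hR0 hz1 hfr
      refine ⟨F, fun _ => ⟨hF1, fun y hy => ?_⟩⟩
      have hyz : ‖y - zz s‖ ≤ 11 * r s := by
        have := norm_sub_le_norm_sub_add_norm_sub y s (zz s)
        rw [norm_sub_rev s] at this
        linarith
      obtain ⟨g1, g2, g3⟩ := hF2 y (by rw [← mul_assoc, hkΛ]; linarith)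
      refine ⟨g1, g2, fun j hj => ?_⟩
      have hPp := Gam_pol hfr.1
      have hPzp := hpol s hs
      have h1 := Pol.near (sub_mem hPp hPzp) hat (K := 1) (by positivity) (by norm_num) hR0.le (y := y) (by nlinarith) hj
      have e : F - Pz (zz s) = (F - P) + (P - Pz (zz s)) := by abel
      rw [e]
      refine (dn_add_le (hF1.sub' hPp.1) (hPp.1.sub' hPzp.1) j y).trans ?_
      have h2 := pow_scale (m := m) (a := Λ) (by linarith) hr0s.le j
      calc _ ≤ CI * M * (Λ * r s) ^ (m - j) + (1 + 1) ^ m * (C * M) * (Λ * r s) ^ (m - j) := add_le_add (g3 j hj) h1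
        _ = (CI + 2 ^ m * C) * M * (Λ * r s) ^ (m - j) := by rw [show (1:ℝ) + 1 = 2 by norm_num]; ring
        _ ≤ (CI + 2 ^ m * C) * M * (Λ ^ m * r s ^ (m - j)) := by gcongr
        _ = ((CI + 2 ^ m * C) * Λ ^ m) * M * r s ^ (m - j) := by ring
        _ ≤ D1 * M * r s ^ (m - j) := by
            have : (CI + 2 ^ m * C) * Λ ^ m ≤ D1 := le_add_of_nonneg_left (by positivity)
            gcongr
  choose Fs hFs using hloc
  have hP0near : ∀ s x, ‖s - x0‖ ≤ c1 * δ → ‖x - s‖ ≤ r s → ∀ j ≤ m,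
      dn j (Pz (zz s) - P0) x ≤ 2 ^ m * A' * M * δ ^ (m - j) := by
    intro s x hs hx j hj
    obtain ⟨hz1, hz2, hz3⟩ := hzz s hs
    have hzc := hz0 s _ hs hz2
    have h1 := Pol.near (sub_mem (hpol s hs) hP0) (hPz1 _ hz1 hzc).2 (K := 1) (by positivity) (by norm_num) hδ.le (y := x) (by
      have := norm_sub_le_norm_sub_add_norm_sub x s (zz s)
      rw [norm_sub_rev s] at this
      have := hr2 s
      nlinarith) hj
    refine h1.trans (le_of_eq ?_)
    rw [show (1:ℝ) + 1 = 2 by norm_num]; ring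
  have hcons : ∀ s, ‖s - x0‖ ≤ c1 * δ → ∀ x, ‖x - x0‖ ≤ c1 * δ → ‖x - s‖ ≤ r s → ∀ j ≤ m,
      dn j (Pz (zz s) - Pz (zz x)) x ≤ D2 * M * r s ^ (m - j) := by
    intro s hs x hx hxs j hj
    obtain ⟨hz1, hz2, hz3⟩ := hzz s hs
    have hzc := hz0 s _ hs hz2
    obtain ⟨hy1, hy2, hy3⟩ := hzz x hx
    have hyc := hz0 x _ hx hy2
    have hr0s := hr0 s
    have hrx := hr3 x s
    by_cases h4 : 4 * r s ≤ c1 * δ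
    · obtain ⟨w, hw, hws, hwi⟩ := hnot s h4
      have hwc := hz0 s w hs hws
      have hR0 : 0 < 4 * Λ * r s := by positivity
      have hRδ : 4 * Λ * r s ≤ δ := by
        have h2 : Λ * (c1 * δ) ≤ δ := by nlinarith
        nlinarith
      have hR120 : 120 * r s ≤ 4 * Λ * r s := by nlinarith
      have t1 := norm_sub_le_norm_sub_add_norm_sub w s (zz s)
      rw [norm_sub_rev s] at t1
      have t2 := norm_sub_le_norm_sub_add_norm_sub w s x
      rw [norm_sub_rev s] at t2
      have t3 := norm_sub_le_norm_sub_add_norm_sub w x (zz x)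
      rw [norm_sub_rev x (zz x)] at t3
      have a1 := hPz3 _ hz1 w hw hzc hwc _ hR0 hRδ (by linarith) (hwi _ le_rfl)
      have a2 := hPz3 _ hy1 w hw hyc hwc _ hR0 hRδ (by linarith) (hwi _ le_rfl)
      have hpw : Pz w ∈ Pol m n := Gam_pol (hPz1 _ hw hwc).1
      have a3 := At.sub ((hpol s hs).1.sub' hpw.1) ((hpol x hx).1.sub' hpw.1) a1 a2
      have e : Pz (zz s) - Pz w - (Pz (zz x) - Pz w) = Pz (zz s) - Pz (zz x) := by abel
      rw [e] at a3
      have h1 := Pol.near (sub_mem (hpol s hs) (hpol x hx)) a3 (K := 1) (by positivity) (by norm_num) hR0.le (y := x)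
        (by rw [norm_sub_rev]; linarith) hj
      have h2 := pow_scale (m := m) (a := 4 * Λ) (by linarith) hr0s.le j
      calc _ ≤ _ := h1
        _ = 2 ^ m * (2 * C) * M * (4 * Λ * r s) ^ (m - j) := by rw [show (1:ℝ) + 1 = 2 by norm_num]; ring
        _ ≤ 2 ^ m * (2 * C) * M * ((4 * Λ) ^ m * r s ^ (m - j)) := by gcongr
        _ = (2 ^ m * (2 * C) * (4 * Λ) ^ m) * M * r s ^ (m - j) := by ring
        _ ≤ D2 * M * r s ^ (m - j) := by
            have : (2 ^ m * (2 * C) * (4 * Λ) ^ m) ≤ D2 := le_add_of_nonneg_right (by positivity)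
            gcongr
    · push Not at h4
      have h1 := hP0near s x hs hxs j hj
      have h2 := hP0near x x hx (by simpa using (hr0 x).le) j hj
      have e : Pz (zz s) - Pz (zz x) = (Pz (zz s) - P0) - (Pz (zz x) - P0) := by abel
      rw [e]
      refine (dn_sub_le ((hpol s hs).1.sub' hP0.1) ((hpol x hx).1.sub' hP0.1) j x).trans ?_
      have hδr : δ ≤ 4 / c1 * r s := by
        rw [div_mul_eq_mul_div, le_div_iff₀ hc1]; linarith
      have h41 : 1 ≤ 4 / c1 := by rw [le_div_iff₀ hc1]; linarith
      have h3 := pow_scale (m := m) (a := 4 / c1) h41 hr0s.le j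
      calc _ ≤ 2 ^ m * A' * M * δ ^ (m - j) + 2 ^ m * A' * M * δ ^ (m - j) := add_le_add h1 h2
        _ = 2 * (2 ^ m * A') * M * δ ^ (m - j) := by ring
        _ ≤ 2 * (2 ^ m * A') * M * (4 / c1 * r s) ^ (m - j) := by gcongr
        _ ≤ 2 * (2 ^ m * A') * M * ((4 / c1) ^ m * r s ^ (m - j)) := by gcongr
        _ = (2 * (2 ^ m * A') * (4 / c1) ^ m) * M * r s ^ (m - j) := by ring
        _ ≤ D2 * M * r s ^ (m - j) := by
            have : (2 * (2 ^ m * A') * (4 / c1) ^ m) ≤ D2 := le_add_of_nonneg_left (by positivity)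
            gcongr
  have hD1le : D1 * M ≤ (D1 + D2) * M := by gcongr; linarith
  have hD2le : D2 * M ≤ (D1 + D2) * M := by gcongr; linarith
  set X : Set (Euc n) := Metric.closedBall x0 (c1 * δ) with hX
  have hXm : ∀ x, x ∈ X ↔ ‖x - x0‖ ≤ c1 * δ := fun x => by rw [hX, mem_closedBall_iff_norm]
  obtain ⟨F, hF1, hF2, hF3, hF4⟩ := hglue X Metric.isBounded_closedBall r (rmin / 2) (c1 * δ / 2) (by linarith)
    (fun x _ => hr1 x) (fun x _ => hr2 x) (fun x _ y _ => (hr3 x y).trans (by norm_num)) E f Fs (fun s => Pz (zz s))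
    ((D1 + D2) * M) (by positivity) (fun s hs => (hFs s ((hXm s).1 hs)).1) (fun s hs => (hpol s ((hXm s).1 hs)).1)
    (fun s hs y hy => ((hFs s ((hXm s).1 hs)).2 y hy).1) (fun s hs y hyE hy => ((hFs s ((hXm s).1 hs)).2 y hy).2.1 hyE)
    (fun s hs j hj y hy => (((hFs s ((hXm s).1 hs)).2 y hy).2.2 j hj).trans
      (by have := (hr0 s).le; gcongr))
    (fun s hs x hx hxs j hj => (hcons s ((hXm s).1 hs) x ((hXm x).1 hx) hxs j hj).trans
      (by have := (hr0 s).le; gcongr))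
  refine ⟨F, hF1, fun y hy => ⟨hF2 y, fun hyE => hF3 y hyE ((hXm y).2 hy), fun j hj => ?_⟩⟩
  have e : F - P0 = (F - Pz (zz y)) + (Pz (zz y) - P0) := by abel
  rw [e]
  refine (dn_add_le (hF1.sub' (hpol y hy).1) ((hpol y hy).1.sub' hP0.1) j y).trans ?_
  have h1 := hF4 y ((hXm y).2 hy) j hj
  have h2 := hP0near y y hy (by simpa using (hr0 y).le) j hj
  have hb : c1 * δ / 2 ≤ δ := by nlinarith
  calc _ ≤ Cg * ((D1 + D2) * M) * (c1 * δ / 2) ^ (m - j) + 2 ^ m * A' * M * δ ^ (m - j) := add_le_add h1 h2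
    _ ≤ Cg * ((D1 + D2) * M) * δ ^ (m - j) + 2 ^ m * A' * M * δ ^ (m - j) := by gcongr
    _ = _ := by ring

lemma ML_exists (hm : 2 ≤ m) (hn : 1 ≤ n) (𝒜 : Set (MI m n)) (hU : UpC 𝒜) : ∃ l, ML m n 𝒜 l := by
  induction 𝒜 using prec_wf.induction with
  | _ 𝒜 ih =>
    have : ∀ 𝒜' : Set (MI m n), ∃ l, UpC 𝒜' → prec 𝒜' 𝒜 → ML m n 𝒜' l := by
      intro 𝒜'
      by_cases h : UpC 𝒜' ∧ prec 𝒜' 𝒜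
      · obtain ⟨l, hl⟩ := ih 𝒜' h.2 h.1
        exact ⟨l, fun _ _ => hl⟩
      · exact ⟨0, fun a b => (h ⟨a, b⟩).elim⟩
    choose l hl using this
    obtain ⟨a, ha⟩ := Finite.exists_max l
    exact ⟨l a + 2, ML_step hm hn hU (l a) fun 𝒜' h1 h2 => (hl 𝒜' h1 h2).le (ha 𝒜')⟩

end
end
end

section
open scoped BigOperators ContDiff

noncomputable section

section
variable {n m : ℕ} {f : Euc n → ℝ}

/-- finiteness principle for finite sets, in terms of smooth functions -/
lemma global_fin (hm : 2 ≤ m) (hn : 1 ≤ n) : ∃ (k : ℕ) (C : ℝ), 0 < C ∧ ∀ (E : Finset (Euc n)) (f : Euc n → ℝ) (M : ℝ),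
    0 < M → (∀ S ⊆ E, S.card ≤ k → ∃ Q, Compat m f M S Q) →
    ∃ F, Sm F ∧ (∀ y, 0 ≤ F y) ∧ (∀ y ∈ E, F y = f y) ∧ ∀ j ≤ m, ∀ y, dn j F y ≤ C * M := by
  classical
  obtain ⟨l, hl⟩ := ML_exists (n := n) hm hn ∅ (fun α hα => hα.elim)
  obtain ⟨c, C, hc, hc1, hC, H⟩ := hl 1 le_rfl
  obtain ⟨Cp, hCp, hpou⟩ := pou m n
  set N : ℝ := (C + 2 ^ m) / c ^ m with hN
  refine ⟨kk m n (l + 1), Cp * (2 ^ m * Cp * N), by positivity, ?_⟩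
  intro E f M hM hS
  have hloc : ∀ s, ∃ F, s ∈ E → Sm F ∧ ∀ y, ‖y - s‖ ≤ c → 0 ≤ F y ∧ (y ∈ E → F y = f y) ∧
      ∀ j ≤ m, dn j F y ≤ N * M * c ^ (m - j) := by
    intro s
    by_cases hs : s ∈ E
    swap
    · exact ⟨0, fun h => (hs h).elim⟩
    obtain ⟨P, hP, hat⟩ := helly_main E f M l hS s hs
    obtain ⟨F, hF1, hF2⟩ := H E E.finite_toSet f M 1 s P hM one_pos (by simpa using hs)
      ⟨by rwa [one_mul], fun α hα => hα.elim⟩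
    refine ⟨F, fun _ => ⟨hF1, fun y hy => ?_⟩⟩
    obtain ⟨g1, g2, g3⟩ := hF2 y (by rwa [mul_one])
    refine ⟨g1, fun h => g2 (by simpa using h), fun j hj => ?_⟩
    have hPp := Gam_pol hP
    have h1 := Pol.near hPp hat (K := 1) hM.le (by norm_num) (by norm_num) (y := y) (by linarith) hj
    have e : F = (F - P) + P := by abel
    rw [e]
    refine (dn_add_le (hF1.sub' hPp.1) hPp.1 j y).trans ?_
    have h2 := g3 j hj
    rw [one_pow, mul_one] at h1 h2
    have h3 : c ^ m ≤ c ^ (m - j) := pow_le_pow_of_le_one hc.le hc1 (Nat.sub_le _ _)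
    calc _ ≤ C * M + (1 + 1) ^ m * M := add_le_add h2 h1
      _ = N * M * c ^ m := by rw [hN]; field_simp; norm_num
      _ ≤ N * M * c ^ (m - j) := by gcongr
  choose Fs hFs using hloc
  have hb : Bornology.IsBounded (E : Set (Euc n)) := E.finite_toSet.isBounded
  obtain ⟨S, hSX, θ, hθ, hθ0, hθs, hθd, hθ1, hcard⟩ := hpou E hb (fun _ => c) c c hc
    (fun _ _ => le_rfl) (fun _ _ => le_rfl) (fun x _ y _ => by rw [sub_self]; positivity)
  have hzero : ∀ s ∈ S, ∀ y, c < ‖y - s‖ → θ s y = 0 := fun s hs y h => (hθs s hs y h).eq_of_nhds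
  have hSE : ∀ s ∈ S, s ∈ E := fun s hs => by simpa using hSX s hs
  refine ⟨∑ s ∈ S, θ s * Fs s, Sm.sum _ fun s hs => (hθ s hs).mul' (hFs s (hSE s hs)).1, ?_, ?_, ?_⟩
  · intro y
    rw [Finset.sum_apply]
    refine Finset.sum_nonneg fun s hs => ?_
    rw [Pi.mul_apply]
    by_cases h : c < ‖y - s‖
    · rw [hzero s hs y h, zero_mul]
    · exact mul_nonneg (hθ0 s hs y) ((hFs s (hSE s hs)).2 y (not_lt.1 h)).1
  · intro y hyE
    have h1 := (hθ1 y (by simpa using hyE)).eq_of_nhds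
    rw [Finset.sum_apply, Pi.one_apply] at h1
    rw [Finset.sum_apply]
    calc ∑ s ∈ S, (θ s * Fs s) y = ∑ s ∈ S, θ s y * f y := by
          refine Finset.sum_congr rfl fun s hs => ?_
          rw [Pi.mul_apply]
          by_cases h : c < ‖y - s‖
          · rw [hzero s hs y h, zero_mul, zero_mul]
          · rw [((hFs s (hSE s hs)).2 y (not_lt.1 h)).2.1 hyE]
      _ = f y := by rw [← Finset.sum_mul, h1, one_mul]
  · intro j hj x
    have := dn_sum_le_filter (S := S) (F := fun s => θ s * Fs s) (p := fun s => ‖x - s‖ ≤ c)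
      (fun s hs => (hθ s hs).mul' (hFs s (hSE s hs)).1) j (x := x) (B := 2 ^ m * Cp * (N * M) * c ^ (m - j)) (by positivity)
      (fun s hs h => by
        filter_upwards [hθs s hs x (not_le.1 h)] with y hy
        rw [Pi.mul_apply, hy]; simp)
      (fun s hs h => dn_mul_scale (hθ s hs) (hFs s (hSE s hs)).1 (r := c) (s := c) (m := m) (B := Cp) (N := N * M)
          hc hc.le le_rfl hj (by positivity)
          (fun i hi => hθd s hs i (hi.trans hj) x) fun i hi => ((hFs s (hSE s hs)).2 x h).2.2 i (hi.trans hj))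
      (hcard x)
    refine this.trans ?_
    have h3 : c ^ (m - j) ≤ 1 := pow_le_one₀ hc.le hc1
    calc Cp * (2 ^ m * Cp * (N * M) * c ^ (m - j)) ≤ Cp * (2 ^ m * Cp * (N * M) * 1) := by gcongr
      _ = _ := by ring

end
end
end

section
open scoped BigOperators ContDiff

noncomputable section

section
variable {n m : ℕ} {f : Euc n → ℝ}

lemma peval_monomial (d : ℕ) : ∀ (s : Fin n →₀ ℕ) (c : ℝ), (s.sum fun _ e => e) = d →
    peval (MvPolynomial.monomial s c : MPoly n) ∈ Pol (d + 1) n := by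
  induction d with
  | zero =>
    intro s c hs
    have : s = 0 := by
      ext i
      by_contra h
      have h1 : i ∈ s.support := by simpa using h
      have : s i ≤ s.sum fun _ e => e := Finset.single_le_sum (f := fun i => s i) (fun _ _ => Nat.zero_le _) h1
      simp only [Finsupp.coe_zero, Pi.zero_apply] at h
      omega
    subst this
    have e : peval (MvPolynomial.monomial 0 c : MPoly n) = c • (1 : Euc n → ℝ) := by
      funext y
      simp [peval]
    rw [e]
    exact Submodule.smul_mem _ _ pol_one
  | succ d ih =>
    intro s c hs
    obtain ⟨i, hi⟩ : ∃ i, s i ≠ 0 := by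
      by_contra h
      push Not at h
      have : s = 0 := Finsupp.ext h
      subst this
      simp at hs
    have hle : Finsupp.single i 1 ≤ s := by
      rw [Finsupp.single_le_iff]; omega
    obtain ⟨t, rfl⟩ := exists_add_of_le hle
    have ht : (t.sum fun _ e => e) = d := by
      rw [Finsupp.sum_add_index' (fun _ => rfl) (fun _ _ _ => rfl), Finsupp.sum_single_index rfl] at hs
      omega
    have e : peval (MvPolynomial.monomial (Finsupp.single i 1 + t) c : MPoly n)
        = lin 0 i * peval (MvPolynomial.monomial t c : MPoly n) := by
      funext y
      have : (MvPolynomial.monomial (Finsupp.single i 1 + t) c : MPoly n)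
          = MvPolynomial.X i * MvPolynomial.monomial t c := by
        rw [MvPolynomial.X, MvPolynomial.monomial_mul, one_mul]
      rw [this]
      simp only [peval, map_mul, MvPolynomial.eval_X, Pi.mul_apply, lin]
      simp
    rw [e]
    exact pol_lin_mul (ih t c ht) 0 i

lemma peval_pol (hm : 1 ≤ m) {P : MPoly n} (hP : P.totalDegree ≤ m - 1) : peval P ∈ Pol m n := by
  have e : peval P = ∑ s ∈ P.support, peval (MvPolynomial.monomial s (P.coeff s)) := by
    funext y
    rw [Finset.sum_apply]
    unfold peval
    rw [← map_sum]
    congr 1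
    exact P.as_sum
  rw [e]
  refine Submodule.sum_mem _ fun s hs => ?_
  have h1 := MvPolynomial.le_totalDegree hs
  exact pol_mono (by omega) (peval_monomial _ s _ rfl)

lemma peval_sub (P Q : MPoly n) : peval (P - Q) = peval P - peval Q := by
  funext y; simp [peval]

lemma mD_sub_cd {F G : Euc n → ℝ} (α : Fin n → ℕ) (hF : ContDiff ℝ (deg α) F) (hG : ContDiff ℝ (deg α) G) (x : Euc n) :
    mD α (F - G) x = mD α F x - mD α G x := by
  rw [← lst_length α] at hF hG
  rw [mD_eq, mD_eq, mD_eq, dL_eq _ hF, dL_eq _ hG, dL_eq (F := F - G) _ (hF.sub hG),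
    iteratedFDeriv_sub_apply hF.contDiffAt hG.contDiffAt]
  rfl

lemma coord_lip {g : Euc n → ℝ} {M : ℝ} (h : ∀ i x (t : ℝ), |g (x + t • ee i) - g x| ≤ M * |t|)
    (x z : Euc n) : |g z - g x| ≤ n * M * ‖z - x‖ := by
  classical
  have key : ∀ s : Finset (Fin n), |g (x + ∑ i ∈ s, (z - x) i • ee i) - g x| ≤ ∑ i ∈ s, M * |(z - x) i| := by
    intro s
    induction s using Finset.induction_on with
    | empty => simp
    | insert a s ha ih =>
      rw [Finset.sum_insert ha, Finset.sum_insert ha]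
      have h1 := h a (x + ∑ i ∈ s, (z - x) i • ee i) ((z - x) a)
      have e : x + ∑ i ∈ s, (z - x) i • ee i + (z - x) a • ee a = x + ((z - x) a • ee a + ∑ i ∈ s, (z - x) i • ee i) := by
        abel
      rw [e] at h1
      have := abs_sub_le (g (x + ((z - x) a • ee a + ∑ i ∈ s, (z - x) i • ee i))) (g (x + ∑ i ∈ s, (z - x) i • ee i)) (g x)
      linarith
  have h1 := key Finset.univ
  have e : x + ∑ i, (z - x) i • ee i = z := by
    ext k
    simp [Finset.sum_apply, Pi.single_apply]
  rw [e] at h1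
  refine h1.trans ?_
  rcases Nat.eq_zero_or_pos n with h0 | h0
  · subst h0; simp
  have hM : 0 ≤ M := by
    have := (abs_nonneg _).trans (h ⟨0, h0⟩ x 1)
    simpa using this
  calc ∑ i, M * |(z - x) i| ≤ ∑ _i : Fin n, M * ‖z - x‖ := by
        refine Finset.sum_le_sum fun i _ => ?_
        have : |(z - x) i| ≤ ‖z - x‖ := by
          have := PiLp.norm_apply_le (z - x) i
          simpa using this
        gcongr
    _ = n * M * ‖z - x‖ := by simp; ring

lemma mD_top_const {P : Euc n → ℝ} (hP : P ∈ Pol m n) (hm : 1 ≤ m) {α : Fin n → ℕ} (hα : deg α = m - 1) (x z : Euc n) :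
    mD α P z = mD α P x := by
  have h1 := mD_diff_le hP.1 α x z
  have h2 := dn_mvt (hP.1.nat m) (j := deg α) (by omega) convex_univ (Set.mem_univ x) (Set.mem_univ z) (L := 0)
    (fun y _ => by
      have : deg α + 1 = m := by omega
      rw [this, Pol.dn hP])
  rw [zero_mul] at h2
  have := abs_nonpos_iff.1 (h1.trans h2)
  linarith

lemma gammaF_Gam (hm : 1 ≤ m) (hn : 1 ≤ n) {x : Euc n} {M : ℝ} (hM : 0 < M) {P : MPoly n} (hP : P ∈ GammaF' m n f x M) :
    peval P ∈ Gam m ∅ f 0 x (n ^ m * 2 ^ m * M) ∧ At m (peval P) x 1 (n ^ m * 2 ^ m * M) := by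
  obtain ⟨⟨F, ⟨hF1, hF2, hF3⟩, hF0, hdeg, hjet⟩, hval⟩ := hP
  have hpol := peval_pol hm hdeg
  have hn1 : (1:ℝ) ≤ n := by exact_mod_cast hn
  have h2m : (1:ℝ) ≤ 2 ^ m := one_le_pow₀ (by norm_num)
  have hF1' : ContDiff ℝ (m - 1 : ℕ) F := by exact_mod_cast hF1
  have hcd : ∀ j ≤ m - 1, ContDiff ℝ j F := fun j hj => hF1'.of_le (by exact_mod_cast hj)
  refine ⟨⟨hpol, hval, fun y => ?_⟩, fun j hj => ?_⟩
  · set G := F - peval P with hG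
    have hmD0 : ∀ α : Fin n → ℕ, deg α ≤ m - 1 → mD α G x = 0 := by
      intro α hα
      rw [hG, mD_sub_cd α (hcd _ hα) (hpol.1.nat _), hjet α hα, sub_self]
    set r := ‖y - x‖ with hr
    have hgr := dn_growth (G := G) (m := m - 1) (hF1'.sub (hpol.1.nat _)) (convex_closedBall x r) (x := x)
      (Metric.mem_closedBall_self (norm_nonneg _)) (N := n ^ (m - 1) * (n * M * r)) (K := 1) (r := r) (by positivity) (by norm_num)
      (norm_nonneg _) (fun j hj => by
        have := dn_le_of_mD (F := G) (j := j) ((hcd j hj.le).sub (hpol.1.nat _)) (x := x) le_rfl (fun α hα => by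
          rw [hmD0 α (by omega)]; simp)
        rw [mul_zero] at this
        exact this.trans (by positivity))
      (fun z hz => by
        have hz' : ‖z - x‖ ≤ r := by simpa [dist_eq_norm] using hz
        refine dn_le_of_mD (F := G) (hF1'.sub (hpol.1.nat _)) (by positivity) fun α hα => ?_
        have h1 := coord_lip (hF3 α hα) x z
        have h2 := hmD0 α hα.le
        rw [hG, mD_sub_cd α (hcd _ hα.le) (hpol.1.nat _)] at h2 ⊢
        rw [mD_top_const hpol hm hα x z]
        have e : mD α F z - mD α (peval P) x = mD α F z - mD α F x := by linarith
        rw [e]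
        exact h1.trans (by gcongr))
      (fun z hz => by
        have hz' : ‖z - x‖ ≤ r := by simpa [dist_eq_norm] using hz
        linarith) 0 (Nat.zero_le _) y (by simp [dist_eq_norm, hr])
    rw [dn_zero, Nat.sub_zero] at hgr
    have hb : (n:ℝ) ^ (m - 1) * (n * M * r) * (1 + 1) ^ (m - 1) * r ^ (m - 1) ≤ n ^ m * 2 ^ m * M * r ^ m := by
      obtain ⟨k, rfl⟩ : ∃ k, m = k + 1 := ⟨m - 1, by omega⟩
      have e2 : (2:ℝ) ^ (k + 1) = 2 ^ k * 2 := pow_succ _ _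
      have e1 : (n:ℝ) ^ (k + 1) = n ^ k * n := pow_succ _ _
      have e3 : r ^ (k + 1) = r ^ k * r := pow_succ _ _
      have h12 : (1:ℝ) + 1 = 2 := by norm_num
      rw [Nat.add_sub_cancel, e1, e2, e3, h12]
      have : 0 ≤ (n:ℝ) ^ k * n * 2 ^ k * M * (r ^ k * r) := by positivity
      nlinarith
    have h3 := hF0 y
    have h4 := (abs_le.1 (hgr.trans hb)).2
    have h5 : G y = F y - peval P y := rfl
    linarith
  · have h1 := dn_le_of_mD (F := peval P) (hpol.1.nat j) (x := x) hM.le (fun α hα => by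
      rw [hjet α (by omega)]
      exact hF2 α (by omega) x)
    rw [one_pow, mul_one]
    refine h1.trans ?_
    have : (n:ℝ) ^ j ≤ n ^ m := pow_le_pow_right₀ hn1 hj.le
    calc (n:ℝ) ^ j * M ≤ n ^ m * 1 * M := by rw [mul_one]; gcongr
      _ ≤ n ^ m * 2 ^ m * M := by gcongr

lemma compat_of (hm : 1 ≤ m) (hn : 1 ≤ n) {M : ℝ} (hM : 0 < M) {S : Finset (Euc n)} {P : Euc n → MPoly n}
    (h1 : ∀ x ∈ S, P x ∈ GammaF' m n f x M)
    (h2 : ∀ x ∈ S, ∀ y ∈ S, ∀ β : Fin n → ℕ, deg β ≤ m - 1 →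
              |mD β (peval (P x - P y)) x| ≤ M * ‖x - y‖ ^ (m - deg β)) :
    Compat m f (n ^ m * 2 ^ m * M) S (fun x => peval (P x)) := by
  refine ⟨fun y hy => gammaF_Gam hm hn hM (h1 y hy), fun y hy y' hy' j hj => ?_⟩
  have hn1 : (1:ℝ) ≤ n := by exact_mod_cast hn
  have h2m : (1:ℝ) ≤ 2 ^ m := one_le_pow₀ (by norm_num)
  have hp := gammaF_Gam hm hn hM (h1 y hy)
  have hp' := gammaF_Gam hm hn hM (h1 y' hy')
  have h3 := dn_le_of_mD (F := peval (P y) - peval (P y')) (j := j) (((Gam_sm hp.1).sub' (Gam_sm hp'.1)).nat j) (x := y)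
    (B := M * ‖y - y'‖ ^ (m - j)) (by positivity) (fun α hα => by
      have := h2 y hy y' hy' α (by omega)
      rwa [peval_sub, hα] at this)
  refine h3.trans ?_
  have : (n:ℝ) ^ j ≤ n ^ m := pow_le_pow_right₀ hn1 hj.le
  calc (n:ℝ) ^ j * (M * ‖y - y'‖ ^ (m - j)) ≤ n ^ m * (M * ‖y - y'‖ ^ (m - j)) := by gcongr
    _ = n ^ m * 1 * M * ‖y - y'‖ ^ (m - j) := by ring
    _ ≤ n ^ m * 2 ^ m * M * ‖y - y'‖ ^ (m - j) := by gcongr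

end
end
end

section
open scoped BigOperators ContDiff

noncomputable section

section
variable {n m : ℕ} {f : Euc n → ℝ}

lemma dn_dL_le {F : Euc n → ℝ} (hF : Sm F) (l : List (Fin n)) (k : ℕ) (x : Euc n) :
    dn k (dL l F) x ≤ dn (k + l.length) F x := by
  induction l generalizing k with
  | nil => exact le_rfl
  | cons i l ih =>
    rw [dL_cons]
    refine (dn_pD_le (hF.dL l) i k x).trans ((ih (k + 1)).trans (le_of_eq ?_))
    congr 1
    simp only [List.length_cons]; omega

lemma vec_sum (v : Euc n) : v = ∑ i, v i • ee i := by
  ext k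
  simp [Finset.sum_apply, Pi.single_apply]

lemma taylor_two {H : Euc n → ℝ} (hH : Sm H) {B : ℝ} (hB : ∀ z, dn 2 H z ≤ B) (x y : Euc n) :
    |H y - H x - ∑ i, (y - x) i * pD i H x| ≤ B * ‖y - x‖ * ‖y - x‖ := by
  have hd : Differentiable ℝ H := hH.differentiable (by simp)
  have hfs : ContDiff ℝ 1 (fderiv ℝ H) := (hH.nat 2).fderiv_right (by norm_num)
  have h1 : ∀ z, ‖fderiv ℝ H z - fderiv ℝ H x‖ ≤ B * ‖z - x‖ := by
    intro z
    refine convex_univ.norm_image_sub_le_of_norm_fderiv_le (𝕜 := ℝ) (fun z _ => hfs.differentiable (by norm_num) z)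
      (fun z _ => ?_) (Set.mem_univ x) (Set.mem_univ z)
    have h2 := hB z
    unfold dn at h2
    rwa [← norm_iteratedFDeriv_fderiv, ← zero_add 1, ← norm_fderiv_iteratedFDeriv, norm_fderiv_iteratedFDeriv,
      zero_add, norm_iteratedFDeriv_one] at h2
  have hB0 : 0 ≤ B := (dn_nonneg 2 H x).trans (hB x)
  have h3 := (convex_closedBall x ‖y - x‖).norm_image_sub_le_of_norm_fderiv_le' (𝕜 := ℝ) (f := H) (φ := fderiv ℝ H x)
    (C := B * ‖y - x‖) (x := x) (y := y) (fun z _ => hd z) (fun z hz => (h1 z).trans (by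
      have : ‖z - x‖ ≤ ‖y - x‖ := by simpa [dist_eq_norm] using hz
      gcongr)) (by simp) (by simp [dist_eq_norm])
  have e : fderiv ℝ H x (y - x) = ∑ i, (y - x) i * pD i H x := by
    conv_lhs => rw [vec_sum (y - x)]
    rw [map_sum]
    refine Finset.sum_congr rfl fun i _ => ?_
    rw [map_smul]; rfl
  rw [← e, ← Real.norm_eq_abs]
  exact h3

/-- passage to the limit along an ultrafilter -/
lemma limit_fun (hm : 1 ≤ m) {ι : Type*} (𝓤 : Ultrafilter ι) {F : ι → Euc n → ℝ} {B : ℝ} (hF : ∀ t, Sm (F t))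
    (hB : ∀ t, ∀ j ≤ m, ∀ y, dn j (F t) y ≤ B) :
    ∃ G : Euc n → ℝ, CmLipNormLe m n G B ∧ ∀ x, Filter.Tendsto (fun t => F t x) 𝓤 (nhds (G x)) := by
  have hex : ∀ (l : List (Fin n)) (x : Euc n), ∃ g : ℝ, l.length ≤ m →
      |g| ≤ B ∧ Filter.Tendsto (fun t => dL l (F t) x) 𝓤 (nhds g) := by
    intro l x
    by_cases hl : l.length ≤ m
    swap
    · exact ⟨0, fun h => (hl h).elim⟩
    have hb : ∀ t, dL l (F t) x ∈ Set.Icc (-B) B := fun t =>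
      abs_le.1 ((abs_dL_le l ((hF t).nat _) x).trans (hB t _ hl x))
    obtain ⟨g, hg, hle⟩ := (isCompact_Icc (a := -B) (b := B)).ultrafilter_le_nhds (𝓤.map fun t => dL l (F t) x) (by
      rw [Filter.le_principal_iff]
      exact Filter.mem_map.2 (Filter.univ_mem' hb))
    exact ⟨g, fun _ => ⟨abs_le.2 hg, hle⟩⟩
  choose G hG using hex
  have hder : ∀ l : List (Fin n), l.length + 2 ≤ m → ∀ x,
      HasFDerivAt (G l) (∑ i, G (i :: l) x • (EuclideanSpace.proj i : Euc n →L[ℝ] ℝ)) x := by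
    intro l hl x
    have hin : ∀ y, |G l y - G l x - ∑ i, (y - x) i * G (i :: l) x| ≤ B * ‖y - x‖ * ‖y - x‖ := by
      intro y
      have ht : Filter.Tendsto (fun t => |dL l (F t) y - dL l (F t) x - ∑ i, (y - x) i * dL (i :: l) (F t) x|) 𝓤
          (nhds |G l y - G l x - ∑ i, (y - x) i * G (i :: l) x|) := by
        refine ((((hG l y (by omega)).2.sub (hG l x (by omega)).2).sub (tendsto_finsetSum _ fun i _ => ?_))).abs
        exact ((hG (i :: l) x (by simp only [List.length_cons]; omega)).2).const_mul _
      refine le_of_tendsto ht (Filter.Eventually.of_forall fun t => ?_)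
      exact taylor_two ((hF t).dL l) (fun z => (dn_dL_le (hF t) l 2 z).trans (hB t _ (by omega) z)) x y
    rw [hasFDerivAt_iff_isLittleO]
    have hO : (fun y => G l y - G l x - (∑ i, G (i :: l) x • (EuclideanSpace.proj i : Euc n →L[ℝ] ℝ)) (y - x))
        =O[nhds x] fun y => ‖y - x‖ * ‖y - x‖ := by
      refine Asymptotics.IsBigO.of_bound B (Filter.Eventually.of_forall fun y => ?_)
      have e : (∑ i, G (i :: l) x • (EuclideanSpace.proj i : Euc n →L[ℝ] ℝ)) (y - x) = ∑ i, (y - x) i * G (i :: l) x := by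
        rw [ContinuousLinearMap.sum_apply]
        refine Finset.sum_congr rfl fun i _ => ?_
        simp [mul_comm]
      rw [e, Real.norm_eq_abs, Real.norm_eq_abs, abs_of_nonneg (by positivity : 0 ≤ ‖y - x‖ * ‖y - x‖), ← mul_assoc]
      exact hin y
    refine hO.trans_isLittleO ?_
    have h1 : (fun y : Euc n => ‖y - x‖) =o[nhds x] fun _ => (1:ℝ) := by
      rw [Asymptotics.isLittleO_one_iff]
      have : Continuous fun y : Euc n => ‖y - x‖ := by fun_prop
      have := this.tendsto x
      simpa using this
    have h2 : (fun y : Euc n => ‖y - x‖) =O[nhds x] fun y => y - x := (Asymptotics.isBigO_refl _ _).norm_left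
    have := h1.mul_isBigO h2.norm_right
    simp only [one_mul] at this
    exact this.of_norm_right
  have hlip : ∀ l : List (Fin n), l.length + 1 ≤ m → ∀ x y, |G l y - G l x| ≤ B * ‖y - x‖ := by
    intro l hl x y
    refine le_of_tendsto ((hG l y (by omega)).2.sub (hG l x (by omega)).2).abs (Filter.Eventually.of_forall fun t => ?_)
    have := dn_mvt (((hF t).dL l).nat 1) (j := 0) (by norm_num) convex_univ (Set.mem_univ x) (Set.mem_univ y) (L := B)
      (fun z _ => (dn_dL_le (hF t) l 1 z).trans (hB t _ (by omega) z))
    have e := mD_diff_le ((hF t).dL l) (0 : Fin n → ℕ) x y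
    have e0 : deg (0 : Fin n → ℕ) = 0 := by simp [deg]
    have e1 : ∀ z, mD (0 : Fin n → ℕ) (dL l (F t)) z = dL l (F t) z := by
      intro z; rw [mD_eq]
      have : lst (0 : Fin n → ℕ) = [] := List.length_eq_zero_iff.1 (by rw [lst_length, e0])
      rw [this]; rfl
    rw [e1, e1, e0] at e
    exact e.trans this
  have hcd : ∀ k : ℕ, ∀ l : List (Fin n), l.length + k + 1 ≤ m → ContDiff ℝ k (G l) := by
    intro k
    induction k with
    | zero =>
      intro l hl
      rw [Nat.cast_zero, contDiff_zero]
      have hB0 : 0 ≤ B := (abs_nonneg _).trans (hG l 0 (by omega)).1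
      refine LipschitzWith.continuous (K := ⟨B, hB0⟩) (LipschitzWith.of_dist_le_mul fun x y => ?_)
      rw [dist_eq_norm, dist_eq_norm, Real.norm_eq_abs]
      exact hlip l (by omega) y x
    | succ k ih =>
      intro l hl
      rw [Nat.cast_add, Nat.cast_one, contDiff_succ_iff_hasFDerivAt]
      refine ⟨_, ?_, hder l (by omega)⟩
      refine ContDiff.sum fun i _ => ?_
      exact (ih (i :: l) (by simp only [List.length_cons]; omega)).smul contDiff_const
  have hdL : ∀ l : List (Fin n), l.length + 1 ≤ m → dL l (G []) = G l := by
    intro l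
    induction l with
    | nil => intro _; rfl
    | cons i l ih =>
      intro hl
      simp only [List.length_cons] at hl
      rw [dL_cons, ih (by omega)]
      funext x
      unfold pD
      rw [(hder l (by omega) x).fderiv, ContinuousLinearMap.sum_apply]
      simp [Pi.single_apply]
  have hmD : ∀ α : Fin n → ℕ, deg α ≤ m - 1 → mD α (G []) = G (lst α) := by
    intro α hα
    rw [mD_eq, hdL _ (by rw [lst_length]; omega)]
  refine ⟨G [], ⟨?_, ?_, ?_⟩, fun x => (hG [] x (by simp)).2⟩
  · have := hcd (m - 1) [] (by simp; omega)
    exact_mod_cast this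
  · intro α hα x
    rw [hmD α hα]
    exact (hG _ x (by rw [lst_length]; omega)).1
  · intro α hα i x t
    rw [hmD α hα.le]
    refine (hlip _ (by rw [lst_length]; omega) x _).trans (le_of_eq ?_)
    rw [add_sub_cancel_left, norm_smul, Real.norm_eq_abs]
    simp

lemma case_two (hm : 2 ≤ m) (hn : 1 ≤ n) : ∃ (kSharp : ℕ) (C : ℝ), 0 < C ∧
      ∀ (E : Set (Euc n)), ∀ f : Euc n → ℝ, (∀ x ∈ E, 0 ≤ f x) →
        ∀ M₀ : ℝ, 0 < M₀ →
        (∀ S : Set (Euc n), S ⊆ E → S.Finite → S.ncard ≤ kSharp →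
          ∃ P : Euc n → MPoly n,
            (∀ x ∈ S, P x ∈ GammaF' m n f x M₀) ∧
            (∀ x ∈ S, ∀ y ∈ S, ∀ β : Fin n → ℕ, deg β ≤ m - 1 →
              |mD β (peval (P x - P y)) x| ≤ M₀ * ‖x - y‖ ^ (m - deg β))) →
        ∃ F : Euc n → ℝ, CmLipNormLe m n F (C * M₀) ∧ (∀ y, 0 ≤ F y) ∧
          ∀ x ∈ E, F x = f x := by
  classical
  obtain ⟨k, C, hC, H⟩ := global_fin (n := n) hm hn
  have hn1 : (1:ℝ) ≤ n := by exact_mod_cast hn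
  refine ⟨k, C * (n ^ m * 2 ^ m), by positivity, ?_⟩
  intro E f hf M₀ hM hyp
  have hfin : ∀ T : Finset E, ∃ F, Sm F ∧ (∀ y, 0 ≤ F y) ∧ (∀ y ∈ T, F y.1 = f y.1) ∧
      ∀ j ≤ m, ∀ y, dn j F y ≤ C * (n ^ m * 2 ^ m * M₀) := by
    intro T
    obtain ⟨F, h1, h2, h3, h4⟩ := H (T.image Subtype.val) f (n ^ m * 2 ^ m * M₀) (by positivity) (by
      intro S hS hcard
      obtain ⟨P, hP1, hP2⟩ := hyp S (by
        intro x hx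
        have := hS hx
        rw [Finset.mem_image] at this
        obtain ⟨a, -, rfl⟩ := this
        exact a.2) S.finite_toSet (by rwa [Set.ncard_coe_finset])
      exact ⟨_, compat_of (by omega) hn hM hP1 hP2⟩)
    exact ⟨F, h1, h2, fun y hy => h3 _ (Finset.mem_image_of_mem _ hy), h4⟩
  choose F hF1 hF2 hF3 hF4 using hfin
  obtain ⟨G, hG1, hG2⟩ := limit_fun (m := m) (by omega) (Ultrafilter.of (Filter.atTop : Filter (Finset E))) hF1 hF4
  refine ⟨G, ?_, fun y => ?_, fun x hx => ?_⟩
  · have e : C * (n ^ m * 2 ^ m) * M₀ = C * (n ^ m * 2 ^ m * M₀) := by ring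
    rw [e]; exact hG1
  · exact ge_of_tendsto' (hG2 y) fun T => hF2 T y
  · refine tendsto_nhds_unique (hG2 x) (tendsto_const_nhds.congr' ?_)
    have : ∀ᶠ T in (Filter.atTop : Filter (Finset E)), f x = F T x := by
      filter_upwards [Filter.eventually_ge_atTop ({⟨x, hx⟩} : Finset E)] with T hT
      exact (hF3 T ⟨x, hx⟩ (hT (by simp))).symm
    exact Ultrafilter.of_le _ this

lemma case_one : ∃ (kSharp : ℕ) (C : ℝ), 0 < C ∧
      ∀ (E : Set (Euc n)), ∀ f : Euc n → ℝ, (∀ x ∈ E, 0 ≤ f x) →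
        ∀ M₀ : ℝ, 0 < M₀ →
        (∀ S : Set (Euc n), S ⊆ E → S.Finite → S.ncard ≤ kSharp →
          ∃ P : Euc n → MPoly n,
            (∀ x ∈ S, P x ∈ GammaF' 1 n f x M₀) ∧
            (∀ x ∈ S, ∀ y ∈ S, ∀ β : Fin n → ℕ, deg β ≤ 1 - 1 →
              |mD β (peval (P x - P y)) x| ≤ M₀ * ‖x - y‖ ^ (1 - deg β))) →
        ∃ F : Euc n → ℝ, CmLipNormLe 1 n F (C * M₀) ∧ (∀ y, 0 ≤ F y) ∧
          ∀ x ∈ E, F x = f x := by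
  classical
  refine ⟨2, 1, one_pos, ?_⟩
  intro E f hf M hM hyp
  have e0 : deg (0 : Fin n → ℕ) = 0 := by simp [deg]
  have emD : ∀ G : Euc n → ℝ, mD (0 : Fin n → ℕ) G = G := by
    intro G; rw [mD_eq]
    have : lst (0 : Fin n → ℕ) = [] := List.length_eq_zero_iff.1 (by rw [lst_length, e0])
    rw [this]; rfl
  have hkey : ∀ x ∈ E, ∀ y ∈ E, f x ≤ M ∧ |f x - f y| ≤ M * ‖x - y‖ := by
    intro x hx y hy
    obtain ⟨P, hP1, hP2⟩ := hyp {x, y} (by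
      intro z hz
      rcases hz with rfl | hz
      · exact hx
      · rw [Set.mem_singleton_iff] at hz; exact hz ▸ hy) (by simp) ((Set.ncard_insert_le x {y}).trans (by simp))
    have hx' : x ∈ ({x, y} : Set (Euc n)) := by simp
    have hy' : y ∈ ({x, y} : Set (Euc n)) := by simp
    obtain ⟨⟨F, ⟨hF1, hF2, hF3⟩, hF0, hdeg, hjet⟩, hval⟩ := hP1 x hx'
    obtain ⟨⟨F', -, -, hdeg', -⟩, hval'⟩ := hP1 y hy'
    have h1 := hjet 0 (by simp [e0])
    rw [emD, emD, hval] at h1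
    have h2 := hF2 0 (by simp [e0]) x
    rw [emD, ← h1] at h2
    refine ⟨(le_abs_self _).trans h2, ?_⟩
    have h3 := hP2 x hx' y hy' 0 (by simp [e0])
    rw [emD, e0, peval_sub, Pi.sub_apply, hval, Nat.sub_zero, pow_one] at h3
    have h4 : peval (P y) x = peval (P y) y := by
      have : (P y).totalDegree = 0 := by omega
      rw [MvPolynomial.totalDegree_eq_zero_iff_eq_C] at this
      rw [this]; simp [peval]
    rwa [h4, hval'] at h3
  have hL : LipschitzOnWith ⟨M, hM.le⟩ f E := by
    refine LipschitzOnWith.of_dist_le_mul fun x hx y hy => ?_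
    rw [dist_eq_norm, dist_eq_norm, Real.norm_eq_abs]
    exact (hkey x hx y hy).2
  obtain ⟨g, hg, hgf⟩ := hL.extend_real
  have hF : LipschitzWith ⟨M, hM.le⟩ fun x => max 0 (min (g x) M) := (hg.min_const M).const_max 0
  refine ⟨fun x => max 0 (min (g x) M), ⟨?_, ?_, ?_⟩, fun y => le_max_left _ _, fun x hx => ?_⟩
  · have := (contDiff_zero (𝕜 := ℝ)).2 hF.continuous
    exact_mod_cast this
  · intro α hα x
    have : α = 0 := by
      funext i
      have : α i ≤ deg α := Finset.single_le_sum (f := α) (fun _ _ => Nat.zero_le _) (Finset.mem_univ i)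
      simp only [Pi.zero_apply]; omega
    rw [this, emD, one_mul, abs_of_nonneg (le_max_left _ _)]
    exact max_le hM.le (min_le_right _ _)
  · intro α hα i x t
    have : α = 0 := by
      funext i
      have : α i ≤ deg α := Finset.single_le_sum (f := α) (fun _ _ => Nat.zero_le _) (Finset.mem_univ i)
      simp only [Pi.zero_apply]; omega
    rw [this, emD, one_mul]
    have h1 := hF.dist_le_mul (x + t • ee i) x
    rw [dist_eq_norm, dist_eq_norm, add_sub_cancel_left, norm_smul, Real.norm_eq_abs] at h1
    have h2 : ‖(ee i : Euc n)‖ = 1 := ee_norm i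
    rw [h2, mul_one] at h1
    exact h1
  · show max 0 (min (g x) M) = f x
    rw [← hgf hx, min_eq_left (hkey x hx x hx).1, max_eq_right (hf x hx)]

end
end
end

/-- **Theorem 4.4**: finiteness principle for nonnegative `C^{m-1,1}` interpolation,
arbitrary `E`, jet form. -/
theorem fp_nonneg_Cm11_jets (m n : ℕ) (hm : 0 < m) (hn : 0 < n) :
    ∃ (kSharp : ℕ) (C : ℝ), 0 < C ∧
      ∀ (E : Set (Euc n)), ∀ f : Euc n → ℝ, (∀ x ∈ E, 0 ≤ f x) →
        ∀ M₀ : ℝ, 0 < M₀ →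
        (∀ S : Set (Euc n), S ⊆ E → S.Finite → S.ncard ≤ kSharp →
          ∃ P : Euc n → MPoly n,
            (∀ x ∈ S, P x ∈ GammaF' m n f x M₀) ∧
            (∀ x ∈ S, ∀ y ∈ S, ∀ β : Fin n → ℕ, deg β ≤ m - 1 →
              |mD β (peval (P x - P y)) x| ≤ M₀ * ‖x - y‖ ^ (m - deg β))) →
        ∃ F : Euc n → ℝ, CmLipNormLe m n F (C * M₀) ∧ (∀ y, 0 ≤ F y) ∧
          ∀ x ∈ E, F x = f x := by
  rcases Nat.lt_or_ge 1 m with h | h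
  · exact case_two h hn
  · have h1 : m = 1 := by omega
    subst h1
    exact case_one

end
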